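/- arXiv:2012.12929 — 2 statements merged into one kernel-verified Lean document; each statement's English description precedes it below -/
import Mathlib

section
/- Let L be a bimodular lattice of rank n with d_+(L) + d_−(L) = 0. Then L is diagonal, i.e. L is isomorphic as a lattice to Δ_n = I^{n−1} ⊕ A_1, and in particular d_+(L) = 1/4 and d_−(L) = −1/4. -/
open scoped RealInnerProductSpace

noncomputable section

/-- The dual of a subset of Euclidean space: vectors pairing integrally with everything. -/
def dualSet {n : ℕ} (Λ : Set (EuclideanSpace ℝ (Fin n))) : Set (EuclideanSpace ℝ (Fin n)) :=
  {x | ∀ v ∈ Λ, ∃ k : ℤ, ⟪x, v⟫ = (k : ℝ)}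

/-- A (positive definite integral) lattice of full rank `n` in `ℝ^n`: an additive subgroup,
free abelian of rank `n` (it has a `ℤ`-basis indexed by `Fin n`), spanning `ℝ^n` over `ℝ`,
with all pairwise inner products integral. -/
def IsLattice {n : ℕ} (Λ : Set (EuclideanSpace ℝ (Fin n))) : Prop :=
  (0 ∈ Λ ∧ (∀ x ∈ Λ, ∀ y ∈ Λ, x + y ∈ Λ) ∧ (∀ x ∈ Λ, -x ∈ Λ)) ∧
  (∃ b : Fin n → EuclideanSpace ℝ (Fin n),
      (∀ i, b i ∈ Λ) ∧ LinearIndependent ℤ b ∧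
      ∀ x ∈ Λ, ∃ c : Fin n → ℤ, x = ∑ i, (c i : ℝ) • b i) ∧
  Submodule.span ℝ Λ = ⊤ ∧
  ∀ v ∈ Λ, ∀ w ∈ Λ, ∃ k : ℤ, ⟪v, w⟫ = (k : ℝ)

/-- A unimodular lattice: a lattice equal to its own dual. -/
def IsUnimodular {n : ℕ} (Λ : Set (EuclideanSpace ℝ (Fin n))) : Prop :=
  IsLattice Λ ∧ dualSet Λ = Λ

/-- A bimodular lattice: a lattice of index 2 in its dual. -/
def IsBimodular {n : ℕ} (Λ : Set (EuclideanSpace ℝ (Fin n))) : Prop :=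
  IsLattice Λ ∧
  ∃ w ∈ dualSet Λ \ Λ, ∀ x ∈ dualSet Λ, x ∈ Λ ∨ x - w ∈ Λ

/-- Characteristic covectors: elements `ξ` of the dual with `ξ·v ≡ v·v (mod 2)` for all `v ∈ Λ`. -/
def CharSet {n : ℕ} (Λ : Set (EuclideanSpace ℝ (Fin n))) : Set (EuclideanSpace ℝ (Fin n)) :=
  {ξ | ξ ∈ dualSet Λ ∧ ∀ v ∈ Λ, ∃ k : ℤ, ⟪ξ, v⟫ - ⟪v, v⟫ = 2 * (k : ℝ)}

/-- `CharSign Λ ε` (for `ε = ±1`): characteristic covectors with `ξ·ξ ≡ n + ε (mod 8)`. -/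
def CharSign {n : ℕ} (Λ : Set (EuclideanSpace ℝ (Fin n))) (ε : ℤ) :
    Set (EuclideanSpace ℝ (Fin n)) :=
  {ξ | ξ ∈ CharSet Λ ∧ ∃ k : ℤ, ⟪ξ, ξ⟫ = (n : ℝ) + (ε : ℝ) + 8 * (k : ℝ)}

/-- The defect `d(Λ) = min_{ξ ∈ Char(Λ)} (ξ·ξ − n)/4` of a full-rank lattice in `ℝ^n`. -/
def defect {n : ℕ} (Λ : Set (EuclideanSpace ℝ (Fin n))) : ℝ :=
  sInf ((fun ξ => (⟪ξ, ξ⟫ - (n : ℝ)) / 4) '' CharSet Λ)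

/-- The two defects `d_±(L) = min_{ξ ∈ Char_±(L)} (ξ·ξ − n)/4` of a bimodular lattice. -/
def defectSign {n : ℕ} (Λ : Set (EuclideanSpace ℝ (Fin n))) (ε : ℤ) : ℝ :=
  sInf ((fun ξ => (⟪ξ, ξ⟫ - (n : ℝ)) / 4) '' CharSign Λ ε)

/-- The juxtaposition `(x, y) ∈ ℝ^n × ℝ^m = ℝ^{n+m}`. -/
def pairE {n m : ℕ} (x : EuclideanSpace ℝ (Fin n)) (y : EuclideanSpace ℝ (Fin m)) :
    EuclideanSpace ℝ (Fin (n + m)) :=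
  (EuclideanSpace.equiv (Fin (n + m)) ℝ).symm
    (Fin.append (EuclideanSpace.equiv (Fin n) ℝ x) (EuclideanSpace.equiv (Fin m) ℝ y))

/-- The first component `ℝ^{n+m} → ℝ^n` of a covector. -/
def restFst {n m : ℕ} (ξ : EuclideanSpace ℝ (Fin (n + m))) : EuclideanSpace ℝ (Fin n) :=
  (EuclideanSpace.equiv (Fin n) ℝ).symm
    (fun i => EuclideanSpace.equiv (Fin (n + m)) ℝ ξ (Fin.castAdd m i))

/-- The second component `ℝ^{n+m} → ℝ^m` of a covector. -/
def restSnd {n m : ℕ} (ξ : EuclideanSpace ℝ (Fin (n + m))) : EuclideanSpace ℝ (Fin m) :=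
  (EuclideanSpace.equiv (Fin m) ℝ).symm
    (fun i => EuclideanSpace.equiv (Fin (n + m)) ℝ ξ (Fin.natAdd n i))

/-- The orthogonal direct sum `L ⊕ A ⊂ ℝ^{n+m}`, i.e. the subgroup `L × A`. -/
def prodSet {n m : ℕ} (L : Set (EuclideanSpace ℝ (Fin n))) (A : Set (EuclideanSpace ℝ (Fin m))) :
    Set (EuclideanSpace ℝ (Fin (n + m))) :=
  {z | ∃ x ∈ L, ∃ y ∈ A, z = pairE x y}

/-- The overlattice `U_A = (L × A) ∪ ((L' \ L) × (A' \ A)) ⊂ ℝ^{n+m}`. -/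
def overLattice {n m : ℕ} (L : Set (EuclideanSpace ℝ (Fin n)))
    (A : Set (EuclideanSpace ℝ (Fin m))) : Set (EuclideanSpace ℝ (Fin (n + m))) :=
  prodSet L A ∪ prodSet (dualSet L \ L) (dualSet A \ A)

/-- The standard lattice `I^n = ℤ^n ⊂ ℝ^n`. -/
def stdLattice (n : ℕ) : Set (EuclideanSpace ℝ (Fin n)) :=
  {x | ∀ i : Fin n, ∃ k : ℤ, x i = (k : ℝ)}

/-- A lattice is diagonal if it admits a `ℤ`-basis with Gram matrix `diag(1, …, 1, 2)`,
i.e. it is isomorphic to `Δ_n = I^{n-1} ⊕ A_1`. -/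
def IsDiagonal {n : ℕ} (Λ : Set (EuclideanSpace ℝ (Fin n))) : Prop :=
  ∃ b : Fin n → EuclideanSpace ℝ (Fin n),
    (∀ i, b i ∈ Λ) ∧ LinearIndependent ℤ b ∧
    (∀ x ∈ Λ, ∃ c : Fin n → ℤ, x = ∑ i, (c i : ℝ) • b i) ∧
    (∀ i j : Fin n, ⟪b i, b j⟫ =
      if i = j then (if (i : ℕ) = n - 1 then 2 else 1) else 0)

/-- A lattice has an orthonormal `ℤ`-basis iff it is isomorphic to the standard lattice `I^n`. -/
def HasOrthonormalZBasis {n : ℕ} (Λ : Set (EuclideanSpace ℝ (Fin n))) : Prop :=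
  ∃ b : Fin n → EuclideanSpace ℝ (Fin n),
    (∀ i, b i ∈ Λ) ∧ LinearIndependent ℤ b ∧
    (∀ x ∈ Λ, ∃ c : Fin n → ℤ, x = ∑ i, (c i : ℝ) • b i) ∧
    (∀ i j : Fin n, ⟪b i, b j⟫ = if i = j then 1 else 0)

section Poisson
open MeasureTheory Set

variable {ι : Type*} [Fintype ι]

/-- Integer translates of the half-open unit cube tile Euclidean space. -/
theorem integral_eq_tsum_cube {f : (ι → ℝ) → ℂ} (hf : Integrable f) :
    ∫ x, f x = ∑' m : ι → ℤ, ∫ x in {x : ι → ℝ | ∀ i, x i ∈ Ioc (0 : ℝ) (0 + 1)},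
      f (x + fun i => (m i : ℝ)) := by
  set D : Set (ι → ℝ) := {x : ι → ℝ | ∀ i, x i ∈ Ioc (0 : ℝ) (0 + 1)} with hD
  have hDm : MeasurableSet D := MeasurableSet.univ_pi' fun i => measurableSet_Ioc
  let s : (ι → ℤ) → Set (ι → ℝ) := fun m => (fun x => x + fun i => -(m i : ℝ)) ⁻¹' D
  have hmem : ∀ m x, x ∈ s m ↔ ∀ i, ⌈x i⌉ = m i + 1 := by
    intro m x
    simp only [s, hD, mem_preimage, mem_ofPred_eq, Pi.add_apply, mem_Ioc]
    refine forall_congr' fun i => ?_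
    rw [Int.ceil_eq_iff]
    push_cast
    constructor <;> rintro ⟨h1, h2⟩ <;> constructor <;> linarith
  have hsm : ∀ m, MeasurableSet (s m) := fun m => (measurable_add_const _) hDm
  have hdisj : Pairwise (Function.onFun Disjoint s) := by
    intro m m' hne
    refine Set.disjoint_left.2 fun x hx hx' => hne ?_
    funext i
    have h1 := (hmem _ _).1 hx i
    have h2 := (hmem _ _).1 hx' i
    omega
  have hun : ⋃ m, s m = univ := by
    refine eq_univ_of_forall fun x => mem_iUnion.2 ⟨fun i => ⌈x i⌉ - 1, (hmem _ _).2 fun i => ?_⟩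
    ring
  rw [← setIntegral_univ, ← hun, integral_iUnion hsm hdisj hf.integrableOn]
  refine tsum_congr fun m => ?_
  have := (measurePreserving_add_right (volume : Measure (ι → ℝ)) (fun i => -(m i : ℝ)))
  have h2 := this.setIntegral_preimage_emb (measurableEmbedding_addRight _)
    (fun x => f (x + fun i => (m i : ℝ))) D
  rw [← h2]
  refine setIntegral_congr_fun (hsm m) fun x _ => ?_
  congr 1
  funext i
  simp

theorem mFourier_coe (n : ι → ℤ) (x : ι → ℝ) :
    UnitAddTorus.mFourier n (fun i => (x i : UnitAddCircle)) =
      Complex.exp (2 * Real.pi * Complex.I * ((∑ i, n i * x i : ℝ) : ℂ)) := by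
  simp only [UnitAddTorus.mFourier, ContinuousMap.coe_mk, fourier_coe_apply]
  rw [← Complex.exp_sum]
  congr 1
  push_cast
  rw [Finset.mul_sum]
  refine Finset.sum_congr rfl fun i _ => ?_
  ring

/-- Poisson summation over `ℤ^ι`. -/
theorem hasSum_poisson {h : (ι → ℝ) → ℂ} (hc : Continuous h) (hfi : Integrable h)
    (hloc : ∀ R : ℝ, ∃ u : (ι → ℤ) → ℝ, Summable u ∧
      ∀ m, ∀ x : ι → ℝ, ‖x‖ ≤ R → ‖h (x + fun i => (m i : ℝ))‖ ≤ u m)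
    (hsum : Summable fun n : ι → ℤ => ∫ y : ι → ℝ,
      Complex.exp (-(2 * Real.pi * Complex.I * ((∑ i, n i * y i : ℝ) : ℂ))) * h y)
    (x : ι → ℝ) :
    HasSum (fun n : ι → ℤ => (∫ y : ι → ℝ,
      Complex.exp (-(2 * Real.pi * Complex.I * ((∑ i, n i * y i : ℝ) : ℂ))) * h y) *
        Complex.exp (2 * Real.pi * Complex.I * ((∑ i, n i * x i : ℝ) : ℂ)))
      (∑' m : ι → ℤ, h (x + fun i => (m i : ℝ))) := by
  let H : (ι → ℝ) → ℂ := fun x => ∑' m : ι → ℤ, h (x + fun i => (m i : ℝ))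
  have hHc : Continuous H := by
    rw [continuous_iff_continuousAt]
    intro x₀
    obtain ⟨u, hu, hb⟩ := hloc (‖x₀‖ + 1)
    have : ContinuousOn H (Metric.closedBall 0 (‖x₀‖ + 1)) :=
      continuousOn_tsum (fun m => (hc.comp (continuous_id.add continuous_const)).continuousOn) hu
        fun m x hx => hb m x (by simpa using hx)
    refine this.continuousAt (Filter.mem_of_superset (Metric.ball_mem_nhds x₀ one_pos) ?_)
    intro y hy
    have h1 : ‖y - x₀‖ < 1 := by simpa [dist_eq_norm] using hy
    have h2 := norm_add_le (y - x₀) x₀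
    rw [sub_add_cancel] at h2
    simp only [Metric.mem_closedBall, dist_zero_right]
    linarith
  have hHp : ∀ x (k : ι → ℤ), H (x + fun i => (k i : ℝ)) = H x := by
    intro x k
    simp only [H]
    rw [← (Equiv.addLeft k).tsum_eq (fun m : ι → ℤ => h (x + fun i => (m i : ℝ)))]
    refine tsum_congr fun m => ?_
    congr 1
    funext i
    simp [add_assoc]
  let q : (ι → ℝ) → UnitAddTorus ι := fun x i => (x i : UnitAddCircle)
  have hq : IsOpenQuotientMap q :=
    IsOpenQuotientMap.piMap fun _ => QuotientAddGroup.isOpenQuotientMap_mk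
  have hfac : ∀ x y, q x = q y → H x = H y := by
    intro x y hxy
    have : ∀ i, ∃ k : ℤ, x i = y i + k := by
      intro i
      have h1 : (x i : UnitAddCircle) = (y i : UnitAddCircle) := congrFun hxy i
      rw [QuotientAddGroup.eq] at h1
      obtain ⟨k, hk⟩ := AddSubgroup.mem_zmultiples_iff.1 h1
      refine ⟨-k, ?_⟩
      simp at hk
      push_cast
      linarith
    choose k hk using this
    have : x = y + fun i => (k i : ℝ) := funext hk
    rw [this, hHp]
  let qc : C(ι → ℝ, UnitAddTorus ι) := ⟨q, hq.continuous⟩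
  have hqc : Topology.IsQuotientMap qc := hq.isQuotientMap
  let F : C(UnitAddTorus ι, ℂ) := hqc.lift ⟨H, hHc⟩ fun {x y} => hfac x y
  have hF : ∀ x, F (q x) = H x := fun x =>
    DFunLike.congr_fun (hqc.lift_comp ⟨H, hHc⟩ fun {x y} => hfac x y) x
  have hcoef : ∀ n, UnitAddTorus.mFourierCoeff F n = ∫ y : ι → ℝ,
      Complex.exp (-(2 * Real.pi * Complex.I * ((∑ i, n i * y i : ℝ) : ℂ))) * h y := by
    intro n
    set e : (ι → ℝ) → ℂ := fun y =>
      Complex.exp (-(2 * Real.pi * Complex.I * ((∑ i, n i * y i : ℝ) : ℂ))) with he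
    have hec : Continuous e := by fun_prop
    have hen : ∀ y, ‖e y‖ = 1 := by
      intro y
      rw [he]
      dsimp only
      rw [show -(2 * Real.pi * Complex.I * ((∑ i, n i * y i : ℝ) : ℂ)) =
        ((-(2 * Real.pi * ∑ i, n i * y i) : ℝ) : ℂ) * Complex.I by push_cast; ring]
      exact Complex.norm_exp_ofReal_mul_I _
    have hep : ∀ y (m : ι → ℤ), e (y + fun i => (m i : ℝ)) = e y := by
      intro y m
      simp only [he]
      rw [Complex.exp_eq_exp_iff_exists_int]
      refine ⟨-∑ i, n i * m i, ?_⟩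
      simp only [Pi.add_apply, mul_add, Finset.sum_add_distrib]
      push_cast
      ring
    have hi : Integrable (fun y => e y * h y) :=
      hfi.bdd_mul hec.aestronglyMeasurable (Filter.Eventually.of_forall fun y => (hen y).le)
    rw [UnitAddTorus.mFourierCoeff_eq_integral _ _ 0, integral_eq_tsum_cube hi]
    have hDm : MeasurableSet {x : ι → ℝ | ∀ i, x i ∈ Ioc (0 : ℝ) (0 + 1)} :=
      MeasurableSet.univ_pi' fun i => measurableSet_Ioc
    have hDn : ∀ x ∈ {x : ι → ℝ | ∀ i, x i ∈ Ioc (0 : ℝ) (0 + 1)}, ‖x‖ ≤ 1 := by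
      intro x hx
      rw [pi_norm_le_iff_of_nonneg zero_le_one]
      intro i
      have := hx i
      rw [Real.norm_eq_abs, abs_le]
      constructor <;> linarith [this.1, this.2]
    have hDv : volume {x : ι → ℝ | ∀ i, x i ∈ Ioc (0 : ℝ) (0 + 1)} ≠ ⊤ := by
      refine ((measure_mono ?_).trans_lt (measure_closedBall_lt_top (x := (0 : ι → ℝ)) (r := 1))).ne
      intro x hx
      simpa using hDn x hx
    obtain ⟨u, hu, hb⟩ := hloc 1
    have hfin : IsFiniteMeasure
      (volume.restrict {x : ι → ℝ | ∀ i, x i ∈ Ioc (0 : ℝ) (0 + 1)}) := ⟨by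
        rw [Measure.restrict_apply_univ]; exact hDv.lt_top⟩
    have hcont : ∀ m : ι → ℤ, Continuous fun y : ι → ℝ => e (y + fun i => (m i : ℝ)) *
        h (y + fun i => (m i : ℝ)) := by
      intro m
      fun_prop
    refine Eq.trans ?_ (integral_tsum_of_summable_integral_norm ?_ ?_).symm
    · refine setIntegral_congr_fun hDm fun y _ => ?_
      change UnitAddTorus.mFourier (-n) (q y) • F (q y) = _
      rw [hF]
      simp only [hep]
      rw [tsum_mul_left, smul_eq_mul]
      congr 1
      rw [show q y = fun i => (y i : UnitAddCircle) from rfl, mFourier_coe]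
      simp only [he]
      congr 1
      simp [Finset.sum_neg_distrib]
    · intro m
      refine Integrable.of_bound (hcont m).aestronglyMeasurable (u m) ?_
      refine (ae_restrict_iff' hDm).2 (Filter.Eventually.of_forall fun y hy => ?_)
      rw [norm_mul, hen, one_mul]
      exact hb m y (hDn y hy)
    · refine Summable.of_nonneg_of_le (fun m => integral_nonneg fun _ => norm_nonneg _) (fun m => ?_)
        (hu.mul_right (volume.real {x : ι → ℝ | ∀ i, x i ∈ Ioc (0 : ℝ) (0 + 1)}))
      refine (Real.le_norm_self _).trans
        (norm_setIntegral_le_of_norm_le_const hDv.lt_top fun y hy => ?_)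
      rw [norm_norm, norm_mul, hen, one_mul]
      exact hb m y (hDn y hy)
  have key := UnitAddTorus.hasSum_mFourier_series_apply_of_summable (f := F)
    (by convert hsum using 1; funext n; exact hcoef n) (q x)
  rw [hF] at key
  convert key using 2 with n
  rw [hcoef, smul_eq_mul, ← mFourier_coe]

end Poisson

section Theta
open MeasureTheory Set Complex

variable {E : Type*} [NormedAddCommGroup E] [InnerProductSpace ℝ E]

/-- A subgroup of Euclidean space equal to its own dual. -/
def SelfDual (Λ : Submodule ℤ E) : Prop :=
  ∀ x, x ∈ Λ ↔ ∀ v ∈ Λ, ∃ k : ℤ, ⟪x, v⟫ = (k : ℝ)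

namespace SelfDual

variable {Λ : Submodule ℤ E} (hΛ : SelfDual Λ)
include hΛ

theorem inner_int {x v : E} (hx : x ∈ Λ) (hv : v ∈ Λ) : ∃ k : ℤ, ⟪x, v⟫ = (k : ℝ) :=
  (hΛ x).1 hx v hv

theorem norm_sq_int {x : E} (hx : x ∈ Λ) : ∃ k : ℤ, ‖x‖ ^ 2 = (k : ℝ) := by
  obtain ⟨k, hk⟩ := hΛ.inner_int hx hx
  exact ⟨k, by rw [← real_inner_self_eq_norm_sq, hk]⟩

theorem one_le_norm_sq {x : E} (hx : x ∈ Λ) (h0 : x ≠ 0) : 1 ≤ ‖x‖ ^ 2 := by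
  obtain ⟨k, hk⟩ := hΛ.norm_sq_int hx
  have : 0 < ‖x‖ ^ 2 := by positivity
  rw [hk] at this ⊢
  exact_mod_cast this

theorem discreteTopology : DiscreteTopology Λ := by
  refine discreteTopology_of_isOpen_singleton_zero (Metric.isOpen_singleton_iff.2
    ⟨1, one_pos, fun y hy => ?_⟩)
  by_contra h0
  have h1 := hΛ.one_le_norm_sq y.2 (by simpa using h0)
  have h2 : ‖(y : E)‖ < 1 := by simpa [dist_eq_norm] using hy
  nlinarith [norm_nonneg (y : E)]

theorem span_eq_top [FiniteDimensional ℝ E] : Submodule.span ℝ (Λ : Set E) = ⊤ := by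
  rw [← Submodule.orthogonal_eq_bot_iff, Submodule.eq_bot_iff]
  intro x hx
  by_contra h0
  have hmem : ((2 * ‖x‖)⁻¹ : ℝ) • x ∈ Λ := by
    refine (hΛ _).2 fun v hv => ⟨0, ?_⟩
    rw [real_inner_smul_left, real_inner_comm,
      Submodule.inner_right_of_mem_orthogonal (Submodule.subset_span hv) hx]
    simp
  have hx0 : 0 < ‖x‖ := norm_pos_iff.2 h0
  have h1 := hΛ.one_le_norm_sq hmem (by simp [h0])
  rw [norm_smul, norm_inv, norm_mul, norm_norm, mul_inv, mul_assoc, inv_mul_cancel₀ hx0.ne'] at h1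
  norm_num at h1

theorem isZLattice [FiniteDimensional ℝ E] [DiscreteTopology Λ] : IsZLattice ℝ Λ :=
  ⟨hΛ.span_eq_top⟩

theorem summable_exp [FiniteDimensional ℝ E] {t : ℝ} (ht : 0 < t) :
    Summable fun v : Λ => Real.exp (-t * ‖(v : E)‖ ^ 2) := by
  have := hΛ.discreteTopology
  have := hΛ.isZLattice
  set m := Module.finrank ℤ Λ + 1 with hm
  have h := ZLattice.summable_norm_pow_inv Λ (2 * m) (by omega)
  refine Summable.of_norm_bounded_eventually (h.mul_left (m.factorial / t ^ m)) ?_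
  rw [Filter.eventually_cofinite]
  refine (finite_singleton (0 : Λ)).subset fun v hv => ?_
  by_contra h0
  apply hv
  have hv0 : (0 : ℝ) < ‖(v : E)‖ := norm_pos_iff.2 (by simpa using h0)
  have h1 := Real.pow_div_factorial_le_exp (t * ‖(v : E)‖ ^ 2) (by positivity) m
  rw [Real.norm_of_nonneg (Real.exp_pos _).le, neg_mul, Real.exp_neg]
  have h2 : (0 : ℝ) < (t * ‖(v : E)‖ ^ 2) ^ m / m.factorial := by positivity
  refine (inv_anti₀ h2 h1).trans_eq ?_
  rw [inv_div, mul_pow, ← pow_mul, inv_pow]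
  change _ = _ * (‖(v : E)‖ ^ (2 * m))⁻¹
  field_simp

theorem summable_exp_add [FiniteDimensional ℝ E] {t : ℝ} (ht : 0 < t) (z : E) :
    Summable fun v : Λ => Real.exp (-t * ‖(v : E) + z‖ ^ 2) := by
  refine Summable.of_nonneg_of_le (fun _ => (Real.exp_pos _).le) (fun v => ?_)
    ((hΛ.summable_exp (half_pos ht)).mul_left (Real.exp (t * ‖z‖ ^ 2)))
  rw [← Real.exp_add]
  refine Real.exp_le_exp.2 ?_
  have h1 := norm_sub_le ((v : E) + z) z
  rw [add_sub_cancel_right] at h1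
  nlinarith [sq_nonneg (‖(v : E) + z‖ - ‖z‖), norm_nonneg (v : E),
    mul_self_le_mul_self (norm_nonneg _) h1]

end SelfDual

theorem exists_const_hasSum_theta [FiniteDimensional ℝ E] {Λ : Submodule ℤ E} (hΛ : SelfDual Λ) :
    ∃ C : ℝ, ∀ τ : ℂ, 0 < τ.im → ∀ z : E,
      (C : ℂ) * (-I * τ) ^ (Module.finrank ℝ E / 2 : ℂ) *
        ∑' v : Λ, cexp (Real.pi * I * τ * (‖(v : E)‖ ^ 2 : ℝ) + 2 * Real.pi * I * (⟪(v : E), z⟫ : ℝ)) =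
      ∑' v : Λ, cexp (Real.pi * I * (-1 / τ) * (‖(v : E) + z‖ ^ 2 : ℝ)) := by
  have := hΛ.discreteTopology
  have := hΛ.isZLattice
  have := ZLattice.module_free ℝ Λ
  have := ZLattice.module_finite ℝ Λ
  borelize E
  set ι := Module.Free.ChooseBasisIndex ℤ Λ
  let b₀ : Module.Basis ι ℤ Λ := Module.Free.chooseBasis ℤ Λ
  let b : Module.Basis ι ℝ E := b₀.ofZLatticeBasis ℝ Λ
  let φ : (ι → ℝ) ≃L[ℝ] E := b.equivFunL.symm
  have hφ : ∀ x, φ x = ∑ i, x i • (b₀ i : E) := by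
    intro x
    change b.equivFun.symm x = _
    rw [Module.Basis.equivFun_symm_apply]
    simp [b]
  let e : (ι → ℤ) ≃ Λ := b₀.equivFun.symm.toEquiv
  have he : ∀ m, ((e m : Λ) : E) = φ fun i => (m i : ℝ) := by
    intro m
    change ((b₀.equivFun.symm m : Λ) : E) = _
    rw [Module.Basis.equivFun_symm_apply, hφ]
    simp [Int.cast_smul_eq_zsmul]
  let ν : (ι → ℤ) → E := fun n => (InnerProductSpace.toDual ℝ E).symm
    ((∑ i, (n i : ℝ) • (ContinuousLinearMap.proj i : (ι → ℝ) →L[ℝ] ℝ)).comp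
      (φ.symm : E →L[ℝ] (ι → ℝ)))
  have hν : ∀ n y, ⟪ν n, φ y⟫ = ∑ i, n i * y i := by
    intro n y
    simp only [ν, InnerProductSpace.toDual_symm_apply]
    simp
  have hνmem : ∀ n, ν n ∈ Λ := by
    intro n
    refine (hΛ _).2 fun v hv => ⟨∑ i, n i * (e.symm ⟨v, hv⟩) i, ?_⟩
    have : v = φ fun i => ((e.symm ⟨v, hv⟩) i : ℝ) := by rw [← he]; simp
    conv_lhs => rw [this]
    rw [hν]
    push_cast
    rfl
  have hφs : ∀ i, φ (Pi.single i 1) = b₀ i := by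
    intro i
    rw [hφ, Finset.sum_eq_single i]
    · simp
    · intro j _ hj
      simp [hj]
    · simp
  let νe : (ι → ℤ) ≃ Λ := Equiv.ofBijective (fun n => ⟨ν n, hνmem n⟩) (by
    constructor
    · intro n n' h
      have h' : ν n = ν n' := congrArg Subtype.val h
      funext i
      have h1 := hν n (Pi.single i 1)
      rw [h', hν] at h1
      simp [Pi.single_apply] at h1
      exact h1.symm
    · intro v
      have : ∀ i, ∃ k : ℤ, ⟪(v : E), (b₀ i : E)⟫ = (k : ℝ) := fun i =>
        hΛ.inner_int v.2 (b₀ i).2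
      choose n hn using this
      refine ⟨n, Subtype.ext ?_⟩
      refine ext_inner_right ℝ fun y => ?_
      rw [← φ.apply_symm_apply y]
      change ⟪ν n, _⟫ = _
      rw [hν, hφ, inner_sum]
      refine Finset.sum_congr rfl fun i _ => ?_
      rw [real_inner_smul_right, hn]
      ring)
  have hνe : ∀ n, ((νe n : Λ) : E) = ν n := fun n => rfl
  let μ' : Measure E := Measure.map φ volume
  have hμ' : μ'.IsAddHaarMeasure := ContinuousLinearEquiv.isAddHaarMeasure_map φ volume
  let C : NNReal := μ'.addHaarScalarFactor volume
  have hμC : μ' = C • (volume : Measure E) := Measure.isAddLeftInvariant_eq_smul μ' volume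
  have hφe : MeasurableEmbedding φ := φ.toHomeomorph.measurableEmbedding
  have hfi : ∀ g : E → ℂ, ∫ y, g (φ y) = C * ∫ x, g x := by
    intro g
    rw [← hφe.integral_map]
    change ∫ y, g y ∂μ' = _
    rw [hμC, integral_smul_nnreal_measure]
    rfl
  refine ⟨C, fun τ hτ z => ?_⟩
  have hτ0 : τ ≠ 0 := by rintro rfl; simp at hτ
  set B : ℂ := Real.pi * I / τ with hB
  have hBre : 0 < B.re := by
    rw [hB, mul_div_assoc, re_ofReal_mul, div_re]
    have : 0 < normSq τ := normSq_pos.2 hτ0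
    simp
    positivity
  set h : (ι → ℝ) → ℂ := fun x => cexp (-B * (‖φ x‖ : ℂ) ^ 2) with hh
  have hnorm : ∀ x, ‖h x‖ = Real.exp (-B.re * ‖φ x‖ ^ 2) := by
    intro x
    rw [hh]
    dsimp only
    rw [norm_exp, ← ofReal_pow, re_mul_ofReal, neg_re]
  have hc : Continuous h := by fun_prop
  have hfih : Integrable h := by
    have h1 := GaussianFourier.integrable_cexp_neg_mul_sq_norm_add (V := E) hBre 0 0
    simp only [inner_zero_left, ofReal_zero, mul_zero, add_zero] at h1
    have h2 : Integrable (fun v : E => cexp (-B * (‖v‖ : ℂ) ^ 2)) μ' := by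
      rw [hμC]
      exact h1.smul_measure_nnreal
    exact hφe.integrable_map_iff.1 h2
  have hf : ∀ n : ι → ℤ, ∫ y : ι → ℝ,
      cexp (-(2 * Real.pi * I * ((∑ i, n i * y i : ℝ) : ℂ))) * h y =
      C * (-I * τ) ^ (Module.finrank ℝ E / 2 : ℂ) * cexp (Real.pi * I * τ * (‖ν n‖ ^ 2 : ℝ)) := by
    intro n
    have h1 := GaussianFourier.integral_cexp_neg_mul_sq_norm_add (V := E) hBre (-2 * Real.pi * I) (ν n)
    have h2 := hfi fun v => cexp (-B * (‖v‖ : ℂ) ^ 2 + -2 * Real.pi * I * (⟪ν n, v⟫ : ℝ))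
    rw [h1] at h2
    have e1 : (Real.pi : ℂ) / B = -I * τ := by
      rw [hB]
      have := Real.pi_ne_zero
      field_simp
      simp
    have e2 : (-2 * Real.pi * I) ^ 2 * (‖ν n‖ : ℂ) ^ 2 / (4 * B) =
        Real.pi * I * τ * (‖ν n‖ ^ 2 : ℝ) := by
      rw [hB]
      have := Real.pi_ne_zero
      field_simp
      push_cast
      linear_combination (-4 * (‖ν n‖ : ℂ) ^ 2 * 0) * I_sq
    rw [e1, e2] at h2
    rw [mul_assoc (C : ℂ), ← h2]
    congr 1
    funext y
    rw [hν, hh, ← Complex.exp_add]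
    congr 1
    push_cast
    ring
  have key := hasSum_poisson hc hfih ?_ ?_ (φ.symm z)
  · simp_rw [hf] at key
    have h1 := key.tsum_eq
    rw [← e.tsum_eq (fun v : Λ => cexp (Real.pi * I * (-1 / τ) * (‖(v : E) + z‖ ^ 2 : ℝ))),
      ← νe.tsum_eq, ← tsum_mul_left]
    refine Eq.trans ?_ (h1.trans ?_)
    · refine tsum_congr fun n => ?_
      rw [hνe, Complex.exp_add]
      have := hν n (φ.symm z)
      rw [φ.apply_symm_apply] at this
      rw [this]
      ring
    · refine tsum_congr fun m => ?_
      simp only [hh, he, map_add, φ.apply_symm_apply]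
      rw [add_comm z]
      congr 1
      rw [hB]
      push_cast
      ring
  · intro R
    obtain ⟨K, hK⟩ : ∃ K, ∀ x : ι → ℝ, ‖x‖ ≤ R → ‖φ x‖ ≤ K := by
      refine ⟨‖(φ : (ι → ℝ) →L[ℝ] E)‖ * R, fun x hx => ?_⟩
      exact ((φ : (ι → ℝ) →L[ℝ] E).le_opNorm x).trans
        (mul_le_mul_of_nonneg_left hx (norm_nonneg _))
    refine ⟨fun m => Real.exp (B.re * K ^ 2) * Real.exp (-(B.re / 2) * ‖((e m : Λ) : E)‖ ^ 2), ?_,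
      fun m x hx => ?_⟩
    · exact ((e.summable_iff (f := fun v : Λ => Real.exp (-(B.re / 2) * ‖(v : E)‖ ^ 2))).2
        (hΛ.summable_exp (half_pos hBre))).mul_left _
    · dsimp only
      rw [hnorm, ← Real.exp_add, map_add, ← he]
      refine Real.exp_le_exp.2 ?_
      have h1 := norm_sub_le (φ x + (e m : E)) (φ x)
      rw [add_sub_cancel_left] at h1
      have h2 := hK x hx
      have h3 : ‖φ x‖ ^ 2 ≤ K ^ 2 := by gcongr
      nlinarith [sq_nonneg (‖φ x + (e m : E)‖ - ‖φ x‖), norm_nonneg (e m : E),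
        mul_self_le_mul_self (norm_nonneg _) h1]
  · simp_rw [hf]
    refine Summable.mul_left _ ?_
    refine (νe.summable_iff (f := fun v : Λ => cexp (Real.pi * I * τ * (‖(v : E)‖ ^ 2 : ℝ)))).2 ?_
    refine Summable.of_norm ?_
    refine (hΛ.summable_exp (mul_pos Real.pi_pos hτ)).congr fun v => ?_
    rw [norm_exp]
    congr 1
    rw [re_mul_ofReal]
    simp

/-- The inversion formula for the theta series of a self-dual lattice. -/
theorem theta_inversion [FiniteDimensional ℝ E] {Λ : Submodule ℤ E} (hΛ : SelfDual Λ)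
    {τ : ℂ} (hτ : 0 < τ.im) (z : E) :
    ∑' v : Λ, cexp (Real.pi * I * (-1 / τ) * (‖(v : E) + z‖ ^ 2 : ℝ)) =
      ((-I * τ) ^ (1 / 2 : ℂ)) ^ Module.finrank ℝ E *
        ∑' v : Λ, cexp (Real.pi * I * τ * (‖(v : E)‖ ^ 2 : ℝ) +
          2 * Real.pi * I * (⟪(v : E), z⟫ : ℝ)) := by
  obtain ⟨C, hC⟩ := exists_const_hasSum_theta hΛ
  have hC1 : C = 1 := by
    have h := hC I (by simp) 0
    have e1 : ∀ v : Λ, cexp (Real.pi * I * I * (‖(v : E)‖ ^ 2 : ℝ)) =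
        (Real.exp (-Real.pi * ‖(v : E)‖ ^ 2) : ℝ) := by
      intro v
      rw [mul_assoc (Real.pi : ℂ), I_mul_I]
      push_cast
      congr 1
      ring
    have e2 : (-1 : ℂ) / I = I := by simp
    simp only [e2, inner_zero_right, ofReal_zero, mul_zero, add_zero, e1, neg_mul, I_mul_I, neg_neg,
      one_cpow, mul_one, ← ofReal_tsum] at h
    have hs := hΛ.summable_exp Real.pi_pos
    simp only [neg_mul] at hs
    have hpos : 0 < ∑' v : Λ, Real.exp (-(Real.pi * ‖(v : E)‖ ^ 2)) :=
      hs.tsum_pos (fun _ => (Real.exp_pos _).le) 0 (Real.exp_pos _)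
    have h' : C * ∑' v : Λ, Real.exp (-(Real.pi * ‖(v : E)‖ ^ 2)) =
      ∑' v : Λ, Real.exp (-(Real.pi * ‖(v : E)‖ ^ 2)) := by exact_mod_cast h
    exact (mul_eq_right₀ hpos.ne').1 h'
  rw [← hC τ hτ z, hC1, ← cpow_nat_mul]
  simp [div_eq_mul_inv]

end Theta

section ExpSum
open Complex Filter Topology

variable {κ : Type*} {a : κ → ℂ} {w : κ → ℝ}

/-- The series `∑ a_v exp (π i w_v τ)`. -/
def expSum (a : κ → ℂ) (w : κ → ℝ) (τ : ℂ) : ℂ :=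
  ∑' v, a v * cexp (Real.pi * I * τ * (w v : ℝ))

theorem norm_expSum_term_le (ha : ∀ v, ‖a v‖ ≤ 1) (hw : ∀ v, 0 ≤ w v) {δ : ℝ} {τ : ℂ}
    (hτ : δ ≤ τ.im) (v : κ) :
    ‖a v * cexp (Real.pi * I * τ * (w v : ℝ))‖ ≤ Real.exp (-(Real.pi * δ) * w v) := by
  rw [norm_mul, norm_exp, re_mul_ofReal]
  have h1 : (Real.pi * I * τ).re = -(Real.pi * τ.im) := by simp
  rw [h1]
  refine (mul_le_of_le_one_left (Real.exp_pos _).le (ha v)).trans (Real.exp_le_exp.2 ?_)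
  have := mul_le_mul_of_nonneg_left hτ Real.pi_pos.le
  exact mul_le_mul_of_nonneg_right (neg_le_neg this) (hw v)

theorem differentiableOn_expSum (ha : ∀ v, ‖a v‖ ≤ 1) (hw : ∀ v, 0 ≤ w v)
    (hs : ∀ t : ℝ, 0 < t → Summable fun v => Real.exp (-t * w v)) :
    DifferentiableOn ℂ (expSum a w) {τ | 0 < τ.im} := by
  intro τ hτ
  have hτ' : (0 : ℝ) < τ.im := hτ
  have hU : IsOpen {z : ℂ | τ.im / 2 < z.im} := isOpen_lt continuous_const continuous_im
  have h := differentiableOn_tsum_of_summable_norm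
    (F := fun v z => a v * cexp (Real.pi * I * z * (w v : ℝ)))
    (hs (Real.pi * (τ.im / 2)) (by positivity))
    (fun v => by fun_prop) hU
    (fun v z hz => norm_expSum_term_le ha hw (le_of_lt hz) v)
  exact (h.differentiableAt (hU.mem_nhds (half_lt_self hτ'))).differentiableWithinAt

theorem tendsto_expSum (ha : ∀ v, ‖a v‖ ≤ 1) (hw : ∀ v, 0 ≤ w v)
    (hs : ∀ t : ℝ, 0 < t → Summable fun v => Real.exp (-t * w v)) :
    Tendsto (expSum a w) (comap im atTop) (𝓝 (∑' v, if w v = 0 then a v else 0)) := by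
  have h1 : ∀ᶠ τ : ℂ in comap im atTop, 1 ≤ τ.im := tendsto_comap.eventually_ge_atTop 1
  refine tendsto_tsum_of_dominated_convergence (hs (Real.pi * 1) (by simp [Real.pi_pos])) ?_ ?_
  · intro v
    by_cases h0 : w v = 0
    · simp [h0, tendsto_const_nhds]
    · rw [if_neg h0]
      have hpos : 0 < w v := lt_of_le_of_ne (hw v) (Ne.symm h0)
      refine squeeze_zero_norm' (a := fun τ : ℂ => Real.exp (-(Real.pi * τ.im) * w v)) ?_ ?_
      · exact Eventually.of_forall fun τ => norm_expSum_term_le ha hw le_rfl v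
      · have : Tendsto (fun x : ℝ => Real.exp (-(Real.pi * x) * w v)) atTop (𝓝 0) := by
          refine Real.tendsto_exp_atBot.comp ?_
          have h2 : Tendsto (fun x : ℝ => (Real.pi * w v) * x) atTop atTop :=
            tendsto_id.const_mul_atTop (by positivity)
          refine (tendsto_neg_atTop_atBot.comp h2).congr fun x => ?_
          simp only [Function.comp]
          ring
        exact this.comp tendsto_comap
  · filter_upwards [h1] with τ hτ v
    exact norm_expSum_term_le ha hw hτ v

end ExpSum

section Char
open Complex Filter Topology

variable {E : Type*} [NormedAddCommGroup E] [InnerProductSpace ℝ E]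

/-- Characteristic vectors of a self-dual lattice. -/
def IsChar (Λ : Submodule ℤ E) (c : E) : Prop :=
  c ∈ Λ ∧ ∀ v ∈ Λ, ∃ k : ℤ, ⟪c, v⟫ - ⟪v, v⟫ = 2 * (k : ℝ)

/-- The theta series of a lattice. -/
def theta3 (Λ : Submodule ℤ E) : ℂ → ℂ := expSum (fun _ : Λ => 1) fun v => ‖(v : E)‖ ^ 2

/-- The theta series of a lattice, twisted by the character attached to `c`. -/
def theta4 (Λ : Submodule ℤ E) (c : E) : ℂ → ℂ :=
  expSum (fun v : Λ => cexp (Real.pi * I * (⟪c, (v : E)⟫ : ℝ))) fun v => ‖(v : E)‖ ^ 2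

/-- The theta series of the translate of a lattice by `c / 2`. -/
def theta2 (Λ : Submodule ℤ E) (c : E) : ℂ → ℂ :=
  expSum (fun _ : Λ => 1) fun v => ‖(v : E) + (1 / 2 : ℝ) • c‖ ^ 2

/-- The automorphy factor of weight one half. -/
def halfFactor (τ : ℂ) : ℂ := (-I * τ) ^ (1 / 2 : ℂ)

theorem halfFactor_sq (τ : ℂ) : halfFactor τ ^ 2 = -I * τ := by
  rw [halfFactor, ← cpow_nat_mul]
  simp

theorem halfFactor_mul {τ : ℂ} (hτ : 0 < τ.im) : halfFactor (-1 / τ) * halfFactor τ = 1 := by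
  have hτ0 : τ ≠ 0 := by rintro rfl; simp at hτ
  have h1 : -I * (-1 / τ) = (-I * τ)⁻¹ := by
    rw [mul_inv, inv_neg, inv_I]
    ring
  rw [halfFactor, halfFactor, h1, inv_cpow, inv_mul_cancel₀]
  · rw [Ne, cpow_eq_zero_iff]
    simp [hτ0]
  · intro h
    have h2 : 0 < (-I * τ).re := by simpa using hτ
    have := abs_arg_lt_pi_div_two_iff.2 (Or.inl h2)
    rw [h, abs_of_pos Real.pi_pos] at this
    linarith [Real.pi_pos]

theorem im_neg_one_div_pos {τ : ℂ} (hτ : 0 < τ.im) : 0 < (-1 / τ).im := by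
  have hτ0 : τ ≠ 0 := by rintro rfl; simp at hτ
  have : 0 < normSq τ := normSq_pos.2 hτ0
  rw [neg_div, one_div, neg_im, inv_im, neg_div, neg_neg]
  exact div_pos hτ this

theorem exp_pi_I_eq_of_sub {x y : ℝ} (h : ∃ k : ℤ, x - y = 2 * (k : ℝ)) :
    cexp (Real.pi * I * (x : ℝ)) = cexp (Real.pi * I * (y : ℝ)) := by
  obtain ⟨k, hk⟩ := h
  rw [exp_eq_exp_iff_exists_int]
  refine ⟨k, ?_⟩
  have : x = y + 2 * k := by linarith
  rw [this]
  push_cast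
  ring

variable {Λ : Submodule ℤ E} {c : E}

theorem norm_twist_le (c : E) (v : Λ) :
    ‖cexp (Real.pi * I * (⟪c, (v : E)⟫ : ℝ))‖ ≤ 1 := by
  rw [mul_assoc, mul_comm I, ← mul_assoc, ← ofReal_mul, norm_exp_ofReal_mul_I]

variable [FiniteDimensional ℝ E]

theorem SelfDual.theta3_S (hΛ : SelfDual Λ) {τ : ℂ} (hτ : 0 < τ.im) :
    theta3 Λ (-1 / τ) = halfFactor τ ^ Module.finrank ℝ E * theta3 Λ τ := by
  have := theta_inversion hΛ hτ 0
  simpa [theta3, expSum, halfFactor] using this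

theorem SelfDual.theta2_S (hΛ : SelfDual Λ) (c : E) {τ : ℂ} (hτ : 0 < τ.im) :
    theta2 Λ c (-1 / τ) = halfFactor τ ^ Module.finrank ℝ E * theta4 Λ c τ := by
  simp only [theta2, theta4, expSum, halfFactor, one_mul]
  rw [theta_inversion hΛ hτ]
  congr 1
  refine tsum_congr fun v => ?_
  rw [← Complex.exp_add, real_inner_smul_right, real_inner_comm]
  congr 1
  push_cast
  ring

theorem SelfDual.theta4_S (hΛ : SelfDual Λ) (c : E) {τ : ℂ} (hτ : 0 < τ.im) :
    theta4 Λ c (-1 / τ) = halfFactor τ ^ Module.finrank ℝ E * theta2 Λ c τ := by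
  have hτ0 : τ ≠ 0 := by rintro rfl; simp at hτ
  have h := hΛ.theta2_S c (im_neg_one_div_pos hτ)
  have h1 : -1 / (-1 / τ) = τ := by field_simp
  rw [h1] at h
  rw [h, ← mul_assoc, ← mul_pow, mul_comm (halfFactor τ), halfFactor_mul hτ, one_pow, one_mul]

omit [FiniteDimensional ℝ E] in
theorem IsChar.theta3_T (hc : IsChar Λ c) (τ : ℂ) : theta3 Λ (τ + 1) = theta4 Λ c τ := by
  simp only [theta3, theta4, expSum, one_mul]
  refine tsum_congr fun v => ?_
  rw [exp_pi_I_eq_of_sub (hc.2 v v.2), ← Complex.exp_add, real_inner_self_eq_norm_sq]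
  congr 1
  ring

omit [FiniteDimensional ℝ E] in
theorem IsChar.theta4_T (hc : IsChar Λ c) (hΛ : SelfDual Λ) (τ : ℂ) :
    theta4 Λ c (τ + 1) = theta3 Λ τ := by
  simp only [theta3, theta4, expSum, one_mul]
  refine tsum_congr fun v => ?_
  rw [exp_pi_I_eq_of_sub (hc.2 v v.2), ← Complex.exp_add, real_inner_self_eq_norm_sq,
    exp_eq_exp_iff_exists_int]
  obtain ⟨k, hk⟩ := hΛ.norm_sq_int v.2
  refine ⟨k, ?_⟩
  rw [hk]
  push_cast
  ring

omit [FiniteDimensional ℝ E] in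
theorem IsChar.theta2_T (hc : IsChar Λ c) (hΛ : SelfDual Λ) (τ : ℂ) :
    theta2 Λ c (τ + 1) = cexp (Real.pi * I * (‖c‖ ^ 2 / 4 : ℝ)) * theta2 Λ c τ := by
  simp only [theta2, expSum, one_mul]
  rw [← tsum_mul_left]
  refine tsum_congr fun v => ?_
  rw [← Complex.exp_add, exp_eq_exp_iff_exists_int]
  obtain ⟨k, hk⟩ := hc.2 v v.2
  obtain ⟨j, hj⟩ := hΛ.norm_sq_int v.2
  refine ⟨j + k, ?_⟩
  have h : ‖(v : E) + (1 / 2 : ℝ) • c‖ ^ 2 = ‖c‖ ^ 2 / 4 + 2 * (j + k) := by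
    rw [norm_add_sq_real, norm_smul, real_inner_smul_right, real_inner_comm, mul_pow, hj]
    rw [real_inner_self_eq_norm_sq, hj] at hk
    norm_num
    linarith
  have h' := congrArg (fun x : ℝ => (x : ℂ)) h
  push_cast at h' ⊢
  linear_combination (Real.pi * I) * h'

theorem SelfDual.differentiableOn_theta3 (hΛ : SelfDual Λ) :
    DifferentiableOn ℂ (theta3 Λ) {τ | 0 < τ.im} :=
  differentiableOn_expSum (by simp) (fun _ => by positivity) fun _ => hΛ.summable_exp

theorem SelfDual.differentiableOn_theta4 (hΛ : SelfDual Λ) (c : E) :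
    DifferentiableOn ℂ (theta4 Λ c) {τ | 0 < τ.im} :=
  differentiableOn_expSum (norm_twist_le c) (fun _ => by positivity) fun _ => hΛ.summable_exp

theorem SelfDual.differentiableOn_theta2 (hΛ : SelfDual Λ) (c : E) :
    DifferentiableOn ℂ (theta2 Λ c) {τ | 0 < τ.im} :=
  differentiableOn_expSum (by simp) (fun _ => by positivity) fun _ ht => hΛ.summable_exp_add ht _

theorem SelfDual.tendsto_theta3 (hΛ : SelfDual Λ) :
    Tendsto (theta3 Λ) (comap im atTop) (𝓝 1) := by
  have h := tendsto_expSum (a := fun _ : Λ => 1) (w := fun v => ‖(v : E)‖ ^ 2) (by simp)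
    (fun _ => by positivity) fun _ => hΛ.summable_exp
  rw [tsum_eq_single 0 fun v hv => by simp [hv]] at h
  simpa [theta3] using h

theorem SelfDual.tendsto_theta4 (hΛ : SelfDual Λ) (c : E) :
    Tendsto (theta4 Λ c) (comap im atTop) (𝓝 1) := by
  have h := tendsto_expSum (a := fun v : Λ => cexp (Real.pi * I * (⟪c, (v : E)⟫ : ℝ)))
    (w := fun v => ‖(v : E)‖ ^ 2) (norm_twist_le c)
    (fun _ => by positivity) fun _ => hΛ.summable_exp
  rw [tsum_eq_single 0 fun v hv => by simp [hv]] at h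
  simpa [theta4] using h

theorem SelfDual.theta2_I_ne_zero (hΛ : SelfDual Λ) (c : E) : theta2 Λ c I ≠ 0 := by
  have e1 : theta2 Λ c I =
      (∑' v : Λ, Real.exp (-Real.pi * ‖(v : E) + (1 / 2 : ℝ) • c‖ ^ 2) : ℝ) := by
    rw [theta2, expSum, ofReal_tsum]
    refine tsum_congr fun v => ?_
    rw [one_mul, mul_assoc (Real.pi : ℂ), I_mul_I]
    push_cast
    congr 1
    ring
  rw [e1, ofReal_ne_zero]
  exact ((hΛ.summable_exp_add Real.pi_pos _).tsum_pos (fun _ => (Real.exp_pos _).le) 0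
    (Real.exp_pos _)).ne'

theorem SelfDual.theta4_I_ne_zero (hΛ : SelfDual Λ) (c : E) : theta4 Λ c I ≠ 0 := by
  intro h
  have h1 := hΛ.theta2_S c (τ := I) (by simp)
  rw [h, mul_zero] at h1
  refine hΛ.theta2_I_ne_zero c ?_
  rw [← h1]
  congr 1
  simp

theorem SelfDual.theta3_I_ne_zero (hΛ : SelfDual Λ) : theta3 Λ I ≠ 0 := by
  simpa [theta2, theta3] using hΛ.theta2_I_ne_zero 0

end Char

section Modular
open Complex Filter Topology UpperHalfPlane ModularForm CuspForm MatrixGroups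

theorem exists_cuspForm {f : ℂ → ℂ} {k : ℤ} (hd : DifferentiableOn ℂ f {τ | 0 < τ.im})
    (hS : ∀ τ : ℂ, 0 < τ.im → f (-1 / τ) = τ ^ k * f τ)
    (hT : ∀ τ : ℂ, 0 < τ.im → f (τ + 1) = f τ)
    (h0 : Tendsto f (comap Complex.im atTop) (𝓝 0)) :
    ∃ F : CuspForm 𝒮ℒ k, ∀ τ : ℍ, F τ = f τ := by
  have hS' : (fun τ : ℍ => f τ) ∣[k] ModularGroup.S = fun τ : ℍ => f τ := by
    ext z
    rw [SL_slash_apply, UpperHalfPlane.modular_S_smul]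
    have h1 : denom ModularGroup.S z = z := by
      rw [ModularGroup.denom_apply]
      simp [ModularGroup.S]
    have h2 : (UpperHalfPlane.mk (-(z : ℂ))⁻¹ z.im_inv_neg_coe_pos : ℂ) = -1 / (z : ℂ) := by
      change (-(z : ℂ))⁻¹ = _
      rw [inv_neg, neg_div, one_div]
    rw [h1, h2, hS z z.2, mul_comm, ← mul_assoc, ← zpow_add₀ z.ne_zero]
    simp
  have hT' : (fun τ : ℍ => f τ) ∣[k] ModularGroup.T = fun τ : ℍ => f τ := by
    ext z
    rw [SL_slash_apply, UpperHalfPlane.modular_T_smul]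
    have h1 : denom ModularGroup.T z = 1 := by
      rw [ModularGroup.denom_apply]
      simp [ModularGroup.T]
    have h2 : (((1 : ℝ) +ᵥ z : ℍ) : ℂ) = (z : ℂ) + 1 := by
      rw [UpperHalfPlane.coe_vadd]
      push_cast
      ring
    rw [h1, h2, hT z z.2]
    simp
  refine ⟨⟨⟨fun τ => f τ, ?_⟩, ?_, ?_⟩, fun τ => rfl⟩
  · rintro A ⟨A, rfl⟩
    exact SlashInvariantForm.slash_action_generators_SL2Z hS' hT' A
  · rw [UpperHalfPlane.mdifferentiable_iff]
    refine hd.congr fun z hz => ?_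
    have := ofComplex_apply_of_im_pos hz
    simp only [Function.comp]
    change f _ = f _
    rw [this]
  · intro c hc
    rw [Subgroup.IsArithmetic.isCusp_iff_isCusp_SL2Z] at hc
    rw [OnePoint.isZeroAt_iff_forall_SL2Z hc]
    intro γ _
    change UpperHalfPlane.IsZeroAtImInfty ((fun τ : ℍ => f τ) ∣[k] γ)
    rw [SlashInvariantForm.slash_action_generators_SL2Z hS' hT']
    refine h0.comp (tendsto_comap_iff.2 ?_)
    exact tendsto_comap

theorem eq_zero_of_weight_zero {f : ℂ → ℂ} (hd : DifferentiableOn ℂ f {τ | 0 < τ.im})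
    (hS : ∀ τ : ℂ, 0 < τ.im → f (-1 / τ) = f τ)
    (hT : ∀ τ : ℂ, 0 < τ.im → f (τ + 1) = f τ)
    (h0 : Tendsto f (comap Complex.im atTop) (𝓝 0)) (τ : ℂ) (hτ : 0 < τ.im) : f τ = 0 := by
  obtain ⟨F, hF⟩ := exists_cuspForm (k := 0) hd (by simpa using hS) hT h0
  have h := rank_zero_iff_forall_zero.1 (CuspForm.rank_eq_zero_of_weight_lt_twelve
    (k := 0) (by norm_num)) F
  have h1 := hF ⟨τ, hτ⟩
  rw [h] at h1
  exact h1.symm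

/-- The lattice of integers in the real line. -/
def intLattice : Submodule ℤ ℝ := AddSubgroup.toIntSubmodule (Int.castAddHom ℝ).range

theorem mem_intLattice {x : ℝ} : x ∈ intLattice ↔ ∃ k : ℤ, (k : ℝ) = x := Iff.rfl

theorem selfDual_intLattice : SelfDual intLattice := by
  intro x
  constructor
  · rintro ⟨k, rfl⟩ v ⟨j, rfl⟩
    exact ⟨k * j, by simp [mul_comm]⟩
  · intro h
    obtain ⟨k, hk⟩ := h 1 ⟨1, by simp⟩
    exact ⟨k, by simpa using hk.symm⟩

theorem isChar_intLattice : IsChar intLattice 1 := by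
  refine ⟨⟨1, by simp⟩, ?_⟩
  rintro v ⟨j, rfl⟩
  obtain ⟨k, hk⟩ := Int.even_mul_succ_self (j - 1)
  refine ⟨-k, ?_⟩
  have : ((j - 1) * (j - 1 + 1) : ℝ) = k + k := by exact_mod_cast hk
  simp
  linarith

theorem thetas_ne_zero {τ : ℂ} (hτ : 0 < τ.im) :
    theta2 intLattice 1 τ ≠ 0 ∧ theta3 intLattice τ ≠ 0 ∧ theta4 intLattice 1 τ ≠ 0 := by
  have hZ := selfDual_intLattice
  have hc := isChar_intLattice
  let f : ℂ → ℂ := fun τ => (theta2 intLattice 1 τ * theta3 intLattice τ * theta4 intLattice 1 τ) ^ 8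
  have hd : DifferentiableOn ℂ f {τ | 0 < τ.im} :=
    (((hZ.differentiableOn_theta2 1).mul hZ.differentiableOn_theta3).mul
      (hZ.differentiableOn_theta4 1)).pow 8
  have hS : ∀ τ : ℂ, 0 < τ.im → f (-1 / τ) = τ ^ (12 : ℤ) * f τ := by
    intro τ hτ
    simp only [f]
    rw [hZ.theta2_S 1 hτ, hZ.theta3_S hτ, hZ.theta4_S 1 hτ, Module.finrank_self, pow_one]
    have h1 : halfFactor τ ^ 24 = τ ^ 12 := by
      rw [show 24 = 2 * 12 by norm_num, pow_mul, halfFactor_sq, mul_pow]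
      have h2 : (-Complex.I) ^ 12 = 1 := by
        rw [neg_pow, show 12 = 4 * 3 by norm_num, pow_mul Complex.I, I_pow_four]
        norm_num
      rw [h2, one_mul]
    calc _ = halfFactor τ ^ 24 *
          (theta2 intLattice 1 τ * theta3 intLattice τ * theta4 intLattice 1 τ) ^ 8 := by ring
      _ = _ := by rw [h1]; rfl
  have hT : ∀ τ : ℂ, 0 < τ.im → f (τ + 1) = f τ := by
    intro τ hτ
    simp only [f]
    rw [hc.theta2_T hZ, hc.theta3_T, hc.theta4_T hZ]
    have h1 : cexp (Real.pi * Complex.I * (‖(1 : ℝ)‖ ^ 2 / 4 : ℝ)) ^ 8 = 1 := by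
      rw [← Complex.exp_nat_mul, ← exp_two_pi_mul_I]
      congr 1
      simp
      ring
    calc _ = cexp (Real.pi * Complex.I * (‖(1 : ℝ)‖ ^ 2 / 4 : ℝ)) ^ 8 *
          (theta2 intLattice 1 τ * theta3 intLattice τ * theta4 intLattice 1 τ) ^ 8 := by ring
      _ = _ := by rw [h1, one_mul]
  have hne : ∀ v : intLattice, ‖(v : ℝ) + (1 / 2 : ℝ) • 1‖ ^ 2 ≠ 0 := by
    rintro ⟨v, ⟨j, rfl⟩⟩ h
    have h1 : (j : ℝ) + 1 / 2 = 0 := by simpa using h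
    have h2 : (2 * j + 1 : ℝ) = 0 := by linarith
    have h3 : 2 * j + 1 = 0 := by exact_mod_cast h2
    omega
  have h2 : Tendsto (theta2 intLattice 1) (comap Complex.im atTop) (𝓝 0) := by
    have h := tendsto_expSum (a := fun _ : intLattice => 1)
      (w := fun v => ‖(v : ℝ) + (1 / 2 : ℝ) • 1‖ ^ 2) (by simp)
      (fun _ => by positivity) fun _ ht => hZ.summable_exp_add ht _
    simp only [hne, if_false, tsum_zero] at h
    exact h
  have h0 : Tendsto f (comap Complex.im atTop) (𝓝 0) := by
    have := ((h2.mul hZ.tendsto_theta3).mul (hZ.tendsto_theta4 1)).pow 8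
    simpa using this
  obtain ⟨F, hF⟩ := exists_cuspForm hd hS hT h0
  obtain ⟨c, hcF⟩ := CuspForm.exists_smul_discriminant_of_weight_eq_twelve F
  have key : ∀ τ : ℍ, f τ = c * ModularForm.discriminant τ := by
    intro τ
    rw [← hF, ← hcF]
    rfl
  have hc0 : c ≠ 0 := by
    rintro rfl
    have := key UpperHalfPlane.I
    rw [zero_mul] at this
    have h3 := pow_ne_zero 8 (mul_ne_zero (mul_ne_zero (hZ.theta2_I_ne_zero 1)
      hZ.theta3_I_ne_zero) (hZ.theta4_I_ne_zero 1))
    exact h3 this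
  have hfin : f τ ≠ 0 := by
    rw [key ⟨τ, hτ⟩]
    exact mul_ne_zero hc0 (discriminant_ne_zero _)
  have h3 := ne_zero_pow (by norm_num) hfin
  exact ⟨left_ne_zero_of_mul (left_ne_zero_of_mul h3), right_ne_zero_of_mul (left_ne_zero_of_mul h3),
    right_ne_zero_of_mul h3⟩

end Modular

section Elkies
open Complex Filter Topology Module

variable {E : Type*} [NormedAddCommGroup E] [InnerProductSpace ℝ E]

/-- The theta series of a lattice, divided by that of `ℤ^n`. -/
def ratio3 (Λ : Submodule ℤ E) (τ : ℂ) : ℂ := theta3 Λ τ / theta3 intLattice τ ^ finrank ℝ E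

/-- The twisted theta series of a lattice, divided by that of `ℤ^n`. -/
def ratio4 (Λ : Submodule ℤ E) (c : E) (τ : ℂ) : ℂ :=
  theta4 Λ c τ / theta4 intLattice 1 τ ^ finrank ℝ E

/-- The theta series of a translated lattice, divided by that of a translate of `ℤ^n`. -/
def ratio2 (Λ : Submodule ℤ E) (c : E) (τ : ℂ) : ℂ :=
  theta2 Λ c τ / theta2 intLattice 1 τ ^ finrank ℝ E

theorem halfFactor_ne_zero {τ : ℂ} (hτ : 0 < τ.im) : halfFactor τ ≠ 0 :=
  right_ne_zero_of_mul (by rw [halfFactor_mul hτ]; exact one_ne_zero)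

variable {Λ : Submodule ℤ E} {c : E}

theorem IsChar.ratio3_T (hc : IsChar Λ c) (τ : ℂ) : ratio3 Λ (τ + 1) = ratio4 Λ c τ := by
  rw [ratio3, ratio4, hc.theta3_T, isChar_intLattice.theta3_T]

theorem IsChar.ratio4_T (hc : IsChar Λ c) (hΛ : SelfDual Λ) (τ : ℂ) :
    ratio4 Λ c (τ + 1) = ratio3 Λ τ := by
  rw [ratio3, ratio4, hc.theta4_T hΛ, isChar_intLattice.theta4_T selfDual_intLattice]

theorem IsChar.ratio2_T (hc : IsChar Λ c) (hΛ : SelfDual Λ) (τ : ℂ) :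
    ratio2 Λ c (τ + 1) =
      cexp (Real.pi * I * ((‖c‖ ^ 2 - finrank ℝ E) / 4 : ℝ)) * ratio2 Λ c τ := by
  have h : cexp (Real.pi * I * (‖c‖ ^ 2 / 4 : ℝ)) =
      cexp (Real.pi * I * ((‖c‖ ^ 2 - finrank ℝ E) / 4 : ℝ)) *
        cexp (Real.pi * I * (‖(1 : ℝ)‖ ^ 2 / 4 : ℝ)) ^ finrank ℝ E := by
    rw [← Complex.exp_nat_mul, ← Complex.exp_add]
    congr 1
    rw [norm_one]
    push_cast
    ring
  rw [ratio2, ratio2, hc.theta2_T hΛ, isChar_intLattice.theta2_T selfDual_intLattice, mul_pow, h,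
    mul_assoc, mul_div_assoc, mul_div_mul_left]
  exact pow_ne_zero _ (Complex.exp_ne_zero _)

variable [FiniteDimensional ℝ E]

theorem SelfDual.ratio3_S (hΛ : SelfDual Λ) {τ : ℂ} (hτ : 0 < τ.im) :
    ratio3 Λ (-1 / τ) = ratio3 Λ τ := by
  rw [ratio3, ratio3, hΛ.theta3_S hτ, selfDual_intLattice.theta3_S hτ, finrank_self, pow_one,
    mul_pow, mul_div_mul_left]
  exact pow_ne_zero _ (halfFactor_ne_zero hτ)

theorem SelfDual.ratio2_S (hΛ : SelfDual Λ) (c : E) {τ : ℂ} (hτ : 0 < τ.im) :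
    ratio2 Λ c (-1 / τ) = ratio4 Λ c τ := by
  rw [ratio2, ratio4, hΛ.theta2_S c hτ, selfDual_intLattice.theta2_S 1 hτ, finrank_self, pow_one,
    mul_pow, mul_div_mul_left]
  exact pow_ne_zero _ (halfFactor_ne_zero hτ)

theorem SelfDual.ratio4_S (hΛ : SelfDual Λ) (c : E) {τ : ℂ} (hτ : 0 < τ.im) :
    ratio4 Λ c (-1 / τ) = ratio2 Λ c τ := by
  rw [ratio2, ratio4, hΛ.theta4_S c hτ, selfDual_intLattice.theta4_S 1 hτ, finrank_self, pow_one,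
    mul_pow, mul_div_mul_left]
  exact pow_ne_zero _ (halfFactor_ne_zero hτ)

theorem IsChar.ratio2_add_one (hc : IsChar Λ c) (hΛ : SelfDual Λ) {τ : ℂ} (hτ : 0 < τ.im) :
    ratio2 Λ c (τ + 1) = ratio2 Λ c τ := by
  set σ := τ + 1 with hσ
  have hσi : 0 < σ.im := by simpa [hσ] using hτ
  have hτ0 : τ ≠ 0 := by rintro rfl; simp at hτ
  have hσ0 : σ ≠ 0 := by intro h; simp [h] at hσi
  have h2 : -1 / σ + 1 = τ / σ := by rw [hσ] at hσ0 ⊢; field_simp; ring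
  have h3 : -1 / (-1 / σ + 1) = -1 / τ - 1 := by
    rw [h2, hσ]; rw [hσ] at hσ0; field_simp; ring
  have hi : 0 < (-1 / σ + 1).im := by
    simpa using im_neg_one_div_pos hσi
  calc ratio2 Λ c σ = ratio4 Λ c (-1 / σ) := (hΛ.ratio4_S c hσi).symm
    _ = ratio3 Λ (-1 / σ + 1) := (hc.ratio3_T _).symm
    _ = ratio3 Λ (-1 / τ - 1) := by rw [← h3, hΛ.ratio3_S hi]
    _ = ratio4 Λ c (-1 / τ) := by rw [← hc.ratio4_T hΛ, sub_add_cancel]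
    _ = ratio2 Λ c τ := hΛ.ratio4_S c hτ

/-- Van der Blij's lemma. -/
theorem IsChar.norm_sq_eq (hc : IsChar Λ c) (hΛ : SelfDual Λ) :
    ∃ k : ℤ, ‖c‖ ^ 2 = finrank ℝ E + 8 * (k : ℝ) := by
  have h := hc.ratio2_add_one hΛ (τ := I) (by simp)
  rw [hc.ratio2_T hΛ] at h
  have h0 : ratio2 Λ c I ≠ 0 := div_ne_zero (hΛ.theta2_I_ne_zero c)
    (pow_ne_zero _ (selfDual_intLattice.theta2_I_ne_zero 1))
  have h1 := (mul_eq_right₀ h0).1 h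
  obtain ⟨k, hk⟩ := Complex.exp_eq_one_iff.1 h1
  refine ⟨k, ?_⟩
  have h2 : ((Real.pi : ℂ) * I) * (((‖c‖ ^ 2 - finrank ℝ E) / 4 : ℝ) : ℂ) =
      (Real.pi * I) * ((2 * k : ℝ) : ℂ) := by
    rw [hk]; push_cast; ring
  have h3 := mul_left_cancel₀ (mul_ne_zero (ofReal_ne_zero.2 Real.pi_ne_zero) I_ne_zero) h2
  have h4 : (‖c‖ ^ 2 - finrank ℝ E) / 4 = 2 * k := by exact_mod_cast h3
  linarith

theorem SelfDual.tendsto_theta2_shift (hΛ : SelfDual Λ) (c : E) {m : ℝ}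
    (hm : ∀ v ∈ Λ, m ≤ ‖v + (1 / 2 : ℝ) • c‖ ^ 2) :
    Tendsto (fun τ => theta2 Λ c τ * cexp (-(Real.pi * I * τ * m))) (comap im atTop)
      (𝓝 (∑' v : Λ, if ‖(v : E) + (1 / 2 : ℝ) • c‖ ^ 2 = m then 1 else 0)) := by
  have h := tendsto_expSum (a := fun _ : Λ => 1)
    (w := fun v => ‖(v : E) + (1 / 2 : ℝ) • c‖ ^ 2 - m) (by simp)
    (fun v => sub_nonneg.2 (hm v v.2)) fun t ht => by
      refine ((hΛ.summable_exp_add ht ((1 / 2 : ℝ) • c)).mul_left (Real.exp (t * m))).congr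
        fun v => ?_
      rw [← Real.exp_add]
      congr 1
      ring
  simp only [sub_eq_zero] at h
  refine h.congr fun τ => ?_
  rw [theta2, expSum, expSum, ← tsum_mul_right]
  refine tsum_congr fun v => ?_
  rw [one_mul, one_mul, ← Complex.exp_add]
  congr 1
  push_cast
  ring

theorem tsum_indicator_ne_zero {κ : Type*} {w : κ → ℝ}
    (hs : Summable fun v => Real.exp (-1 * w v)) (v₀ : κ) (hv₀ : w v₀ = 0) :
    (∑' v, if w v = 0 then (1 : ℂ) else 0) ≠ 0 := by
  have h1 : (∑' v, if w v = 0 then (1 : ℂ) else 0) =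
      (∑' v, if w v = 0 then (1 : ℝ) else 0 : ℝ) := by
    rw [ofReal_tsum]
    refine tsum_congr fun v => ?_
    split_ifs <;> simp
  rw [h1, ofReal_ne_zero]
  refine (Summable.tsum_pos ?_ (fun v => ?_) v₀ (by simp [hv₀])).ne'
  · refine Summable.of_nonneg_of_le (fun v => ?_) (fun v => ?_) hs
    · split_ifs <;> norm_num
    · split_ifs with h
      · simp [h]
      · exact (Real.exp_pos _).le
  · split_ifs <;> norm_num

theorem differentiableOn_ratio2 (hΛ : SelfDual Λ) (c : E) :
    DifferentiableOn ℂ (ratio2 Λ c) {τ | 0 < τ.im} :=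
  (hΛ.differentiableOn_theta2 c).div ((selfDual_intLattice.differentiableOn_theta2 1).pow _)
    fun _ hτ => pow_ne_zero _ (thetas_ne_zero hτ).1

theorem differentiableOn_ratio3 (hΛ : SelfDual Λ) :
    DifferentiableOn ℂ (ratio3 Λ) {τ | 0 < τ.im} :=
  hΛ.differentiableOn_theta3.div (selfDual_intLattice.differentiableOn_theta3.pow _)
    fun _ hτ => pow_ne_zero _ (thetas_ne_zero hτ).2.1

theorem differentiableOn_ratio4 (hΛ : SelfDual Λ) (c : E) :
    DifferentiableOn ℂ (ratio4 Λ c) {τ | 0 < τ.im} :=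
  (hΛ.differentiableOn_theta4 c).div ((selfDual_intLattice.differentiableOn_theta4 1).pow _)
    fun _ hτ => pow_ne_zero _ (thetas_ne_zero hτ).2.2

theorem SelfDual.tendsto_ratio3 (hΛ : SelfDual Λ) :
    Tendsto (ratio3 Λ) (comap im atTop) (𝓝 1) := by
  simpa using! hΛ.tendsto_theta3.div (selfDual_intLattice.tendsto_theta3.pow (finrank ℝ E))
    (by simp)

theorem SelfDual.tendsto_ratio4 (hΛ : SelfDual Λ) (c : E) :
    Tendsto (ratio4 Λ c) (comap im atTop) (𝓝 1) := by
  simpa using! (hΛ.tendsto_theta4 c).div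
    ((selfDual_intLattice.tendsto_theta4 1).pow (finrank ℝ E)) (by simp)

theorem SelfDual.exists_tendsto_ratio2 (hΛ : SelfDual Λ)
    (hm : ∀ v ∈ Λ, (finrank ℝ E : ℝ) / 4 ≤ ‖v + (1 / 2 : ℝ) • c‖ ^ 2) :
    ∃ r, Tendsto (ratio2 Λ c) (comap im atTop) (𝓝 r) := by
  have h1 := hΛ.tendsto_theta2_shift c hm
  have hZ : ∀ v ∈ intLattice, (1 / 4 : ℝ) ≤ ‖v + (1 / 2 : ℝ) • 1‖ ^ 2 := by
    rintro v ⟨j, rfl⟩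
    have : (0 : ℤ) ≤ j * (j + 1) := by
      rcases le_or_gt 0 j with h | h
      · positivity
      · exact mul_nonneg_of_nonpos_of_nonpos h.le (by omega)
    have : (0 : ℝ) ≤ j * (j + 1) := by exact_mod_cast this
    simp
    nlinarith
  have h2 := selfDual_intLattice.tendsto_theta2_shift 1 hZ
  have h3 : (∑' v : intLattice, if ‖(v : ℝ) + (1 / 2 : ℝ) • 1‖ ^ 2 = 1 / 4 then (1 : ℂ) else 0) ≠ 0 := by
    have h := tsum_indicator_ne_zero (w := fun v : intLattice => ‖(v : ℝ) + (1 / 2 : ℝ) • 1‖ ^ 2 - 1 / 4)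
      ?_ 0 ?_
    · simpa only [sub_eq_zero] using h
    · refine ((selfDual_intLattice.summable_exp_add one_pos ((1 / 2 : ℝ) • 1)).mul_left
        (Real.exp (1 / 4))).congr fun v => ?_
      rw [← Real.exp_add]
      congr 1
      ring
    · simp
      norm_num
  refine ⟨_, (h1.div (h2.pow (finrank ℝ E)) (pow_ne_zero _ h3)).congr fun τ => ?_⟩
  rw [Pi.div_apply, mul_pow, ← Complex.exp_nat_mul, ratio2]
  have e : (finrank ℝ E : ℂ) * -(Real.pi * I * τ * ((1 / 4 : ℝ) : ℂ)) =
      -(Real.pi * I * τ * ((finrank ℝ E / 4 : ℝ) : ℂ)) := by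
    push_cast
    ring
  rw [e, mul_div_mul_right _ _ (Complex.exp_ne_zero _)]

/-- If every characteristic vector of a self-dual lattice is at least as long as in `ℤ^n`,
then the theta series is that of `ℤ^n`. -/
theorem IsChar.theta3_eq (hc : IsChar Λ c) (hΛ : SelfDual Λ)
    (hm : ∀ v ∈ Λ, (finrank ℝ E : ℝ) / 4 ≤ ‖v + (1 / 2 : ℝ) • c‖ ^ 2) {τ : ℂ} (hτ : 0 < τ.im) :
    theta3 Λ τ = theta3 intLattice τ ^ finrank ℝ E := by
  suffices h : ∀ τ : ℂ, 0 < τ.im → ratio3 Λ τ = 1 by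
    have := h τ hτ
    rwa [ratio3, div_eq_one_iff_eq (pow_ne_zero _ (thetas_ne_zero hτ).2.1)] at this
  obtain ⟨r, hr⟩ := hΛ.exists_tendsto_ratio2 hm
  have hd2 := (differentiableOn_ratio2 hΛ c).sub_const 1
  have hd3 := (differentiableOn_ratio3 hΛ).sub_const 1
  have hd4 := (differentiableOn_ratio4 hΛ c).sub_const 1
  have h0 : ∀ τ : ℂ, 0 < τ.im → (ratio2 Λ c τ - 1) * ((ratio3 Λ τ - 1) * (ratio4 Λ c τ - 1)) = 0 := by
    refine eq_zero_of_weight_zero (hd2.mul (hd3.mul hd4)) ?_ ?_ ?_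
    · intro τ hτ
      simp only [hΛ.ratio2_S c hτ, hΛ.ratio3_S hτ, hΛ.ratio4_S c hτ]
      ring
    · intro τ hτ
      simp only [hc.ratio2_add_one hΛ hτ, hc.ratio3_T, hc.ratio4_T hΛ]
      ring
    · simpa using! (hr.sub_const 1).mul ((hΛ.tendsto_ratio3.sub_const 1).mul
        ((hΛ.tendsto_ratio4 c).sub_const 1))
  have hU : IsOpen {τ : ℂ | 0 < τ.im} := isOpen_lt continuous_const continuous_im
  have hconn : IsPreconnected {τ : ℂ | 0 < τ.im} := (convex_halfSpace_im_gt 0).isPreconnected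
  have h34 : (∀ τ : ℂ, 0 < τ.im → ratio4 Λ c τ = 1) → ∀ τ : ℂ, 0 < τ.im → ratio3 Λ τ = 1 := by
    intro h τ hτ
    rw [← hc.ratio4_T hΛ]
    exact h _ (by simpa using hτ)
  rcases AnalyticOnNhd.eq_zero_or_eq_zero_of_mul_eq_zero (hd2.analyticOnNhd hU)
    ((hd3.mul hd4).analyticOnNhd hU) h0 hconn with h | h
  · refine h34 fun τ hτ => ?_
    rw [← hΛ.ratio2_S c hτ]
    exact sub_eq_zero.1 (h _ (im_neg_one_div_pos hτ))
  rcases AnalyticOnNhd.eq_zero_or_eq_zero_of_mul_eq_zero (hd3.analyticOnNhd hU)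
    (hd4.analyticOnNhd hU) h hconn with h | h
  · exact fun τ hτ => sub_eq_zero.1 (h τ hτ)
  · exact h34 fun τ hτ => sub_eq_zero.1 (h τ hτ)

end Elkies

section UnitVectors
open Complex Filter Topology Module

variable {E : Type*} [NormedAddCommGroup E] [InnerProductSpace ℝ E]

/-- The vectors of norm one in a lattice. -/
def unitVectors (Λ : Submodule ℤ E) : Set E := {u | u ∈ Λ ∧ ‖u‖ = 1}

variable {Λ : Submodule ℤ E} {c : E} [FiniteDimensional ℝ E]

theorem SelfDual.finite_unitVectors (hΛ : SelfDual Λ) : (unitVectors Λ).Finite := by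
  have h := (hΛ.summable_exp one_pos).tendsto_cofinite_zero.eventually_lt_const
    (Real.exp_pos (-1))
  refine (Set.Finite.image (fun v : Λ => (v : E)) h).subset ?_
  rintro u ⟨hu, hu1⟩
  exact ⟨⟨u, hu⟩, by simp [hu1], rfl⟩

theorem SelfDual.tendsto_theta3_sub_one (hΛ : SelfDual Λ) :
    Tendsto (fun τ => (theta3 Λ τ - 1) * cexp (-(Real.pi * I * τ))) (comap im atTop)
      (𝓝 ((unitVectors Λ).ncard : ℂ)) := by
  have h := tendsto_expSum (a := fun _ : ({0}ᶜ : Set Λ) => 1)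
    (w := fun v => ‖((v : Λ) : E)‖ ^ 2 - 1) (by simp)
    (fun v => sub_nonneg.2 (hΛ.one_le_norm_sq v.1.2 fun h => v.2 (Subtype.ext h))) fun t ht => by
      refine (((hΛ.summable_exp ht).subtype _).mul_left (Real.exp t)).congr fun v => ?_
      rw [Function.comp_apply, ← Real.exp_add]
      congr 1
      ring
  have e : (∑' v : ({0}ᶜ : Set Λ), if ‖((v : Λ) : E)‖ ^ 2 - 1 = 0 then (1 : ℂ) else 0) =
      (unitVectors Λ).ncard := by
    classical
    have hinj : Function.Injective fun v : Λ => (v : E) := Subtype.val_injective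
    have himg : (fun v : Λ => (v : E)) '' {v : Λ | ‖(v : E)‖ = 1} = unitVectors Λ := by
      ext u
      constructor
      · rintro ⟨v, hv, rfl⟩
        exact ⟨v.2, hv⟩
      · rintro ⟨hu, hu1⟩
        exact ⟨⟨u, hu⟩, hu1, rfl⟩
    have hfin : {v : Λ | ‖(v : E)‖ = 1}.Finite :=
      Set.Finite.of_finite_image (himg ▸ hΛ.finite_unitVectors) hinj.injOn
    rw [tsum_subtype ({0}ᶜ : Set Λ) fun v => if ‖(v : E)‖ ^ 2 - 1 = 0 then (1 : ℂ) else 0,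
      tsum_eq_sum (s := hfin.toFinset), ← himg, Set.ncard_image_of_injective _ hinj,
      Set.ncard_eq_toFinset_card _ hfin, Finset.card_eq_sum_ones, Nat.cast_sum]
    · refine Finset.sum_congr rfl fun v hv => ?_
      have hv1 : ‖(v : E)‖ = 1 := by simpa using hv
      have hv0 : v ∈ ({0}ᶜ : Set Λ) := by
        rintro rfl
        simp at hv1
      rw [Set.indicator_of_mem hv0, if_pos (by rw [hv1]; norm_num), Nat.cast_one]
    · intro v hv
      have hv1 : ‖(v : E)‖ ≠ 1 := by simpa using hv
      rw [Set.indicator_apply, if_neg (c := _ = _), ite_self]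
      intro h0
      refine hv1 ?_
      rwa [sub_eq_zero, pow_eq_one_iff_of_nonneg (norm_nonneg _) two_ne_zero] at h0
  rw [e] at h
  refine h.congr' ?_
  filter_upwards [tendsto_comap.eventually_gt_atTop 0] with τ hτ
  have hs : Summable fun v : Λ => (1 : ℂ) * cexp (Real.pi * I * τ * (‖(v : E)‖ ^ 2 : ℝ)) :=
    Summable.of_norm_bounded (hΛ.summable_exp (mul_pos Real.pi_pos hτ)) fun v =>
      norm_expSum_term_le (a := fun _ => 1) (w := fun v : Λ => ‖(v : E)‖ ^ 2) (by simp)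
        (fun _ => by positivity) le_rfl v
  rw [theta3, expSum, expSum, ← hs.tsum_subtype_add_tsum_subtype_compl {0}]
  rw [tsum_singleton (0 : Λ) fun v : Λ => (1 : ℂ) * cexp (Real.pi * I * τ * (‖(v : E)‖ ^ 2 : ℝ)),
    show (1 : ℂ) * cexp (Real.pi * I * τ * (‖((0 : Λ) : E)‖ ^ 2 : ℝ)) = 1 by simp,
    add_sub_cancel_left, ← tsum_mul_right]
  refine tsum_congr fun v => ?_
  rw [one_mul, one_mul, ← Complex.exp_add]
  congr 1
  push_cast
  ring

theorem unitVectors_intLattice : unitVectors intLattice = {1, -1} := by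
  ext x
  simp only [unitVectors, mem_intLattice, Set.mem_ofPred_eq, Set.mem_insert_iff,
    Set.mem_singleton_iff, Real.norm_eq_abs]
  constructor
  · rintro ⟨-, h⟩
    exact eq_or_eq_neg_of_abs_eq h
  · rintro (rfl | rfl)
    · exact ⟨⟨1, by simp⟩, by simp⟩
    · exact ⟨⟨-1, by simp⟩, by simp⟩

/-- If every characteristic vector of a self-dual lattice is at least as long as in `ℤ^n`,
then the lattice has `2 n` vectors of norm one. -/
theorem IsChar.ncard_unitVectors (hc : IsChar Λ c) (hΛ : SelfDual Λ)
    (hm : ∀ v ∈ Λ, (finrank ℝ E : ℝ) / 4 ≤ ‖v + (1 / 2 : ℝ) • c‖ ^ 2) :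
    (unitVectors Λ).ncard = 2 * finrank ℝ E := by
  have h1 := hΛ.tendsto_theta3_sub_one
  have h2 := selfDual_intLattice.tendsto_theta3_sub_one
  rw [unitVectors_intLattice, Set.ncard_pair (by norm_num)] at h2
  have h3 : Tendsto (fun τ => ∑ k ∈ Finset.range (finrank ℝ E), theta3 intLattice τ ^ k)
      (comap im atTop) (𝓝 (∑ k ∈ Finset.range (finrank ℝ E), 1 ^ k)) :=
    tendsto_finsetSum _ fun k _ => selfDual_intLattice.tendsto_theta3.pow k
  have h4 : Tendsto (fun τ => (theta3 Λ τ - 1) * cexp (-(Real.pi * I * τ))) (comap im atTop)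
      (𝓝 ((∑ k ∈ Finset.range (finrank ℝ E), 1 ^ k) * ((2 : ℕ) : ℂ))) := by
    refine (h3.mul h2).congr' ?_
    filter_upwards [tendsto_comap.eventually_gt_atTop 0] with τ hτ
    rw [hc.theta3_eq hΛ hm hτ, ← mul_assoc, geom_sum_mul]
  have : (comap im atTop).NeBot := atTop_neBot.comap_of_surj im_surjective
  have h5 := tendsto_nhds_unique h1 h4
  simp only [one_pow, Finset.sum_const, Finset.card_range, nsmul_eq_mul, mul_one] at h5
  rw [mul_comm]
  exact_mod_cast h5

omit [FiniteDimensional ℝ E] in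
theorem unitVectors_inner (hΛ : ∀ u ∈ Λ, ∀ v ∈ Λ, ∃ k : ℤ, ⟪u, v⟫ = (k : ℝ)) {u v : E}
    (hu : u ∈ unitVectors Λ) (hv : v ∈ unitVectors Λ) (h : u ≠ v) (h' : u ≠ -v) : ⟪u, v⟫ = 0 := by
  obtain ⟨k, hk⟩ := hΛ u hu.1 v hv.1
  have h1 := real_inner_le_norm u v
  have h2 := neg_le_of_abs_le (abs_real_inner_le_norm u v)
  rw [hu.2, hv.2, one_mul] at h1 h2
  have h3 : ⟪u, v⟫ ≠ 1 := fun e => h ((inner_eq_one_iff_of_norm_eq_one (𝕜 := ℝ) hu.2 hv.2).1 e)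
  have h4 : ⟪u, v⟫ ≠ -1 := fun e => h' ((inner_eq_one_iff_of_norm_eq_one (𝕜 := ℝ) hu.2
    (by rw [norm_neg, hv.2])).1 (by rw [inner_neg_right, e, neg_neg]))
  rw [hk] at h1 h2 h3 h4 ⊢
  norm_cast at h1 h3
  have h2' : (-1 : ℤ) ≤ k := by exact_mod_cast h2
  have h4' : k ≠ -1 := by exact_mod_cast h4
  have : k = 0 := by omega
  simp [this]

omit [FiniteDimensional ℝ E] in
/-- The vectors of norm one in an integral lattice form an orthonormal family, up to sign. -/
theorem exists_orthonormal_unitVectors (hΛ : ∀ u ∈ Λ, ∀ v ∈ Λ, ∃ k : ℤ, ⟪u, v⟫ = (k : ℝ)) :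
    ∃ S : Set E, Orthonormal ℝ ((↑) : S → E) ∧ unitVectors Λ = S ∪ Neg.neg '' S ∧
      Disjoint S (Neg.neg '' S) := by
  have hneg : ∀ u ∈ unitVectors Λ, -u ∈ unitVectors Λ := fun u hu =>
    ⟨Λ.neg_mem hu.1, by rw [norm_neg, hu.2]⟩
  have hne : ∀ u ∈ unitVectors Λ, u ≠ -u := fun u hu h => by
    have h1 : ⟪u, u⟫ = ⟪u, -u⟫ := congrArg (inner ℝ u) h
    rw [inner_neg_right, real_inner_self_eq_norm_sq, hu.2] at h1
    norm_num at h1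
  set S : Set E := {u | u ∈ unitVectors Λ ∧ WellOrderingRel u (-u)} with hS
  have hdisj : ∀ u ∈ S, ∀ v ∈ S, u ≠ -v := by
    rintro u hu v hv rfl
    have h1 := hu.2
    rw [neg_neg] at h1
    exact asymm_of WellOrderingRel h1 hv.2
  refine ⟨S, ⟨fun u => u.2.1.2, fun u v huv => ?_⟩, ?_, ?_⟩
  · exact unitVectors_inner hΛ u.2.1 v.2.1 (fun h => huv (Subtype.ext h)) (hdisj _ u.2 _ v.2)
  · ext u
    constructor
    · intro hu
      rcases trichotomous_of WellOrderingRel u (-u) with h | h | h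
      · exact Or.inl ⟨hu, h⟩
      · exact absurd h (hne u hu)
      · exact Or.inr ⟨-u, ⟨hneg u hu, by rwa [neg_neg]⟩, neg_neg u⟩
    · rintro (h | ⟨v, hv, rfl⟩)
      · exact h.1
      · exact hneg v hv.1
  · rw [Set.disjoint_left]
    rintro _ hu ⟨v, hv, rfl⟩
    exact hdisj _ hu v hv rfl

/-- If every characteristic vector of a self-dual lattice is at least as long as in `ℤ^n`,
then the lattice is generated by vectors of norm one. -/
theorem IsChar.le_span_unitVectors (hc : IsChar Λ c) (hΛ : SelfDual Λ)
    (hm : ∀ v ∈ Λ, (finrank ℝ E : ℝ) / 4 ≤ ‖v + (1 / 2 : ℝ) • c‖ ^ 2) :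
    Λ ≤ Submodule.span ℤ (unitVectors Λ) := by
  obtain ⟨S, hon, hunion, hdisj⟩ := exists_orthonormal_unitVectors fun _ hu _ hv =>
    hΛ.inner_int hu hv
  have hS : S ⊆ unitVectors Λ := hunion ▸ Set.subset_union_left
  have hfin : S.Finite := hΛ.finite_unitVectors.subset hS
  have hcard : S.ncard = finrank ℝ E := by
    have h := hc.ncard_unitVectors hΛ hm
    rw [hunion, Set.ncard_union_eq hdisj hfin (hfin.image _),
      Set.ncard_image_of_injective _ neg_injective] at h
    omega
  have := hfin.fintype
  let b : OrthonormalBasis S ℝ E := OrthonormalBasis.mk hon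
    (hon.linearIndependent.span_eq_top_of_card_eq_finrank'
      (by rw [← hcard, Set.ncard_eq_toFinset_card', Set.toFinset_card])).ge
  have hb : ∀ i, b i = i := by simp [b]
  intro v hv
  rw [← b.sum_repr v]
  refine Submodule.sum_mem _ fun i _ => ?_
  obtain ⟨k, hk⟩ := hΛ.inner_int (hS i.2).1 hv
  rw [b.repr_apply_apply, hb, hk, Int.cast_smul_eq_zsmul]
  exact Submodule.smul_mem _ _ (Submodule.subset_span (hS i.2))

end UnitVectors

section Gluing
open Module

variable {E F : Type*} [NormedAddCommGroup E] [InnerProductSpace ℝ E]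
  [NormedAddCommGroup F] [InnerProductSpace ℝ F]

/-- `w` represents the nontrivial class of the discriminant group of the bimodular lattice `Λ`. -/
structure IsGlueVector (Λ : Submodule ℤ E) (w : E) : Prop where
  inner_int : ∀ u ∈ Λ, ∀ v ∈ Λ, ∃ k : ℤ, ⟪u, v⟫ = (k : ℝ)
  inner_glue_int : ∀ v ∈ Λ, ∃ k : ℤ, ⟪w, v⟫ = (k : ℝ)
  dual_cases : ∀ x, (∀ v ∈ Λ, ∃ k : ℤ, ⟪x, v⟫ = (k : ℝ)) → x ∈ Λ ∨ x - w ∈ Λ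
  two_smul_mem : (2 : ℤ) • w ∈ Λ
  inner_self : ∃ k : ℤ, ⟪w, w⟫ = k + 1 / 2

namespace IsGlueVector

variable {Λ : Submodule ℤ E} {w : E} (h : IsGlueVector Λ w)
include h

theorem inner_coset_int {x v : E} (hx : x - w ∈ Λ) (hv : v ∈ Λ) : ∃ k : ℤ, ⟪x, v⟫ = (k : ℝ) := by
  obtain ⟨k, hk⟩ := h.inner_int _ hx v hv
  obtain ⟨l, hl⟩ := h.inner_glue_int v hv
  refine ⟨k + l, ?_⟩
  rw [inner_sub_left] at hk
  push_cast
  linarith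

theorem inner_coset_coset {x y : E} (hx : x - w ∈ Λ) (hy : y - w ∈ Λ) :
    ∃ k : ℤ, ⟪x, y⟫ = k + 1 / 2 := by
  obtain ⟨k, hk⟩ := h.inner_coset_int hx hy
  obtain ⟨l, hl⟩ := h.inner_glue_int _ hx
  obtain ⟨m, hm⟩ := h.inner_self
  refine ⟨k + l + m, ?_⟩
  rw [inner_sub_right] at hk hl
  rw [real_inner_comm] at hl
  push_cast
  linarith

theorem notMem : w ∉ Λ := fun hw => by
  obtain ⟨k, hk⟩ := h.inner_int w hw w hw
  obtain ⟨m, hm⟩ := h.inner_self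
  rw [hk] at hm
  have : ((2 * k : ℤ) : ℝ) = (2 * m + 1 : ℤ) := by push_cast; linarith
  have : 2 * k = 2 * m + 1 := by exact_mod_cast this
  omega

end IsGlueVector

/-- Two bimodular lattices glued along the nontrivial classes of their discriminant groups. -/
def glue (Λ : Submodule ℤ E) (w : E) (h : (2 : ℤ) • w ∈ Λ) (M : Submodule ℤ F) (z : F)
    (h' : (2 : ℤ) • z ∈ M) : Submodule ℤ (WithLp 2 (E × F)) where
  carrier := {p | (p.fst ∈ Λ ∧ p.snd ∈ M) ∨ (p.fst - w ∈ Λ ∧ p.snd - z ∈ M)}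
  zero_mem' := Or.inl ⟨by simp, by simp⟩
  add_mem' := by
    rintro p q (⟨h1, h2⟩ | ⟨h1, h2⟩) (⟨h3, h4⟩ | ⟨h3, h4⟩)
    · exact Or.inl ⟨Λ.add_mem h1 h3, M.add_mem h2 h4⟩
    · right
      simpa only [WithLp.add_fst, WithLp.add_snd, add_sub_assoc] using
        And.intro (Λ.add_mem h1 h3) (M.add_mem h2 h4)
    · right
      simpa only [WithLp.add_fst, WithLp.add_snd, add_sub_right_comm] using
        And.intro (Λ.add_mem h1 h3) (M.add_mem h2 h4)
    · left
      have e1 : p.fst + q.fst = (p.fst - w) + (q.fst - w) + (2 : ℤ) • w := by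
        rw [two_smul]; abel
      have e2 : p.snd + q.snd = (p.snd - z) + (q.snd - z) + (2 : ℤ) • z := by
        rw [two_smul]; abel
      rw [WithLp.add_fst, WithLp.add_snd, e1, e2]
      exact ⟨Λ.add_mem (Λ.add_mem h1 h3) h, M.add_mem (M.add_mem h2 h4) h'⟩
  smul_mem' := by
    rintro k p (⟨h1, h2⟩ | ⟨h1, h2⟩)
    · exact Or.inl ⟨Λ.smul_mem k h1, M.smul_mem k h2⟩
    · rcases Int.even_or_odd' k with ⟨j, rfl | rfl⟩
      · left
        have e1 : (2 * j) • p.fst = (2 * j) • (p.fst - w) + j • ((2 : ℤ) • w) := by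
          rw [smul_sub, smul_smul, mul_comm j]; abel
        have e2 : (2 * j) • p.snd = (2 * j) • (p.snd - z) + j • ((2 : ℤ) • z) := by
          rw [smul_sub, smul_smul, mul_comm j]; abel
        rw [WithLp.smul_fst, WithLp.smul_snd, e1, e2]
        exact ⟨Λ.add_mem (Λ.smul_mem _ h1) (Λ.smul_mem _ h),
          M.add_mem (M.smul_mem _ h2) (M.smul_mem _ h')⟩
      · right
        have e1 : (2 * j + 1) • p.fst - w = (2 * j + 1) • (p.fst - w) + j • ((2 : ℤ) • w) := by
          rw [smul_sub, smul_smul, mul_comm j, add_smul _ _ w, one_smul]; abel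
        have e2 : (2 * j + 1) • p.snd - z = (2 * j + 1) • (p.snd - z) + j • ((2 : ℤ) • z) := by
          rw [smul_sub, smul_smul, mul_comm j, add_smul _ _ z, one_smul]; abel
        rw [WithLp.smul_fst, WithLp.smul_snd, e1, e2]
        exact ⟨Λ.add_mem (Λ.smul_mem _ h1) (Λ.smul_mem _ h),
          M.add_mem (M.smul_mem _ h2) (M.smul_mem _ h')⟩

variable {Λ : Submodule ℤ E} {w : E} {M : Submodule ℤ F} {z : F}

theorem IsGlueVector.selfDual_glue (h : IsGlueVector Λ w) (h' : IsGlueVector M z) :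
    SelfDual (glue Λ w h.two_smul_mem M z h'.two_smul_mem) := by
  intro x
  constructor
  · rintro hx v hv
    rw [WithLp.prod_inner_apply]
    change ∃ k : ℤ, ⟪x.fst, v.fst⟫ + ⟪x.snd, v.snd⟫ = (k : ℝ)
    rcases hx with ⟨h1, h2⟩ | ⟨h1, h2⟩ <;> rcases hv with ⟨h3, h4⟩ | ⟨h3, h4⟩
    · obtain ⟨k, hk⟩ := h.inner_int _ h1 _ h3
      obtain ⟨l, hl⟩ := h'.inner_int _ h2 _ h4
      exact ⟨k + l, by push_cast; linarith⟩
    · obtain ⟨k, hk⟩ := h.inner_coset_int h3 h1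
      obtain ⟨l, hl⟩ := h'.inner_coset_int h4 h2
      rw [real_inner_comm] at hk hl
      exact ⟨k + l, by push_cast; linarith⟩
    · obtain ⟨k, hk⟩ := h.inner_coset_int h1 h3
      obtain ⟨l, hl⟩ := h'.inner_coset_int h2 h4
      exact ⟨k + l, by push_cast; linarith⟩
    · obtain ⟨k, hk⟩ := h.inner_coset_coset h1 h3
      obtain ⟨l, hl⟩ := h'.inner_coset_coset h2 h4
      exact ⟨k + l + 1, by push_cast; linarith⟩
  · intro hx
    have h1 := h.dual_cases x.fst fun v hv => by
      simpa using hx (WithLp.toLp 2 (v, 0)) (Or.inl ⟨hv, M.zero_mem⟩)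
    have h2 := h'.dual_cases x.snd fun v hv => by
      simpa using hx (WithLp.toLp 2 (0, v)) (Or.inl ⟨Λ.zero_mem, hv⟩)
    obtain ⟨k, hk⟩ := hx (WithLp.toLp 2 (w, z)) (Or.inr ⟨by simp, by simp⟩)
    rw [WithLp.prod_inner_apply] at hk
    have hno : ∀ a b c : ℤ, (a : ℝ) + (b + 1 / 2) ≠ c := by
      intro a b c e
      have : ((2 * a + 2 * b + 1 : ℤ) : ℝ) = (2 * c : ℤ) := by push_cast; linarith
      have : 2 * a + 2 * b + 1 = 2 * c := by exact_mod_cast this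
      omega
    rcases h1 with h1 | h1 <;> rcases h2 with h2 | h2
    · exact Or.inl ⟨h1, h2⟩
    · obtain ⟨a, ha⟩ := h.inner_coset_int (x := w) (by simp) h1
      obtain ⟨b, hb⟩ := h'.inner_coset_coset h2 (y := z) (by simp)
      rw [real_inner_comm] at ha
      refine absurd ?_ (hno a b k)
      rw [← ha, ← hb]
      exact hk
    · obtain ⟨a, ha⟩ := h'.inner_coset_int (x := z) (by simp) h2
      obtain ⟨b, hb⟩ := h.inner_coset_coset h1 (y := w) (by simp)
      rw [real_inner_comm] at ha
      refine absurd ?_ (hno a b k)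
      rw [← ha, ← hb, add_comm]
      exact hk
    · exact Or.inr ⟨h1, h2⟩

/-- A characteristic covector of `Λ` and one of `M` whose pairings with the glue vectors have the
right parity form a characteristic vector of the glued lattice. -/
theorem IsGlueVector.isChar_glue (h : IsGlueVector Λ w) (h' : IsGlueVector M z) {ξ : E} {η : F}
    (hξ : ∀ v ∈ Λ, ∃ k : ℤ, ⟪ξ, v⟫ - ⟪v, v⟫ = 2 * (k : ℝ))
    (hη : ∀ v ∈ M, ∃ k : ℤ, ⟪η, v⟫ - ⟪v, v⟫ = 2 * (k : ℝ))
    (hwz : ∃ k : ℤ, ⟪ξ, w⟫ - ⟪w, w⟫ + (⟪η, z⟫ - ⟪z, z⟫) = 2 * (k : ℝ)) :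
    IsChar (glue Λ w h.two_smul_mem M z h'.two_smul_mem) (WithLp.toLp 2 (ξ, η)) := by
  have key : ∀ p ∈ glue Λ w h.two_smul_mem M z h'.two_smul_mem,
      ∃ k : ℤ, ⟪WithLp.toLp 2 (ξ, η), p⟫ - ⟪p, p⟫ = 2 * (k : ℝ) := by
    rintro p (⟨h1, h2⟩ | ⟨h1, h2⟩)
    · obtain ⟨k, hk⟩ := hξ _ h1
      obtain ⟨l, hl⟩ := hη _ h2
      refine ⟨k + l, ?_⟩
      simp only [WithLp.prod_inner_apply]
      change ⟪ξ, p.fst⟫ + ⟪η, p.snd⟫ - (⟪p.fst, p.fst⟫ + ⟪p.snd, p.snd⟫) = _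
      push_cast
      linarith
    · obtain ⟨k, hk⟩ := hξ _ h1
      obtain ⟨l, hl⟩ := hη _ h2
      obtain ⟨m, hm⟩ := hwz
      obtain ⟨i, hi⟩ := h.inner_glue_int _ h1
      obtain ⟨j, hj⟩ := h'.inner_glue_int _ h2
      refine ⟨k + l + m - i - j, ?_⟩
      simp only [WithLp.prod_inner_apply]
      change ⟪ξ, p.fst⟫ + ⟪η, p.snd⟫ - (⟪p.fst, p.fst⟫ + ⟪p.snd, p.snd⟫) = _
      simp only [inner_sub_left, inner_sub_right, real_inner_comm w, real_inner_comm z] at hk hl hi hj hm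
      push_cast
      linarith
  refine ⟨(h.selfDual_glue h' _).2 fun p hp => ?_, key⟩
  obtain ⟨k, hk⟩ := key p hp
  obtain ⟨l, hl⟩ := (h.selfDual_glue h').inner_int hp hp
  exact ⟨2 * k + l, by push_cast; linarith⟩

end Gluing

section Bimodular
open Module

/-- The rank one lattice generated by a vector of square two. -/
def rootLattice : Submodule ℤ ℝ := Submodule.span ℤ {√2}

theorem mem_rootLattice {x : ℝ} : x ∈ rootLattice ↔ ∃ k : ℤ, k * √2 = x := by
  simp [rootLattice, Submodule.mem_span_singleton]

theorem isGlueVector_rootLattice : IsGlueVector rootLattice (√2 / 2) := by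
  have h2 : √2 * √2 = 2 := Real.mul_self_sqrt zero_le_two
  refine ⟨fun u hu v hv => ?_, fun v hv => ?_, fun x hx => ?_, ?_, ⟨0, ?_⟩⟩
  · obtain ⟨k, rfl⟩ := mem_rootLattice.1 hu
    obtain ⟨l, rfl⟩ := mem_rootLattice.1 hv
    refine ⟨2 * k * l, ?_⟩
    simp only [RCLike.inner_apply, conj_trivial]
    push_cast
    linear_combination (k * l : ℝ) * h2
  · obtain ⟨l, rfl⟩ := mem_rootLattice.1 hv
    refine ⟨l, ?_⟩
    simp only [RCLike.inner_apply, conj_trivial]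
    linear_combination (l / 2 : ℝ) * h2
  · obtain ⟨k, hk⟩ := hx (√2) (Submodule.mem_span_singleton_self _)
    simp only [RCLike.inner_apply, conj_trivial] at hk
    rw [mem_rootLattice, mem_rootLattice]
    rcases Int.even_or_odd' k with ⟨j, rfl | rfl⟩
    · left
      refine ⟨j, ?_⟩
      push_cast at hk
      linear_combination (-√2 / 2) * hk + (x / 2) * h2
    · right
      refine ⟨j, ?_⟩
      push_cast at hk
      linear_combination (-√2 / 2) * hk + (x / 2) * h2
  · rw [mem_rootLattice]
    exact ⟨1, by simp; ring⟩
  · simp only [RCLike.inner_apply, conj_trivial]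
    push_cast
    linear_combination (1 / 4 : ℝ) * h2

theorem finrank_withLp_prod {E F : Type*} [NormedAddCommGroup E] [InnerProductSpace ℝ E]
    [NormedAddCommGroup F] [InnerProductSpace ℝ F] [FiniteDimensional ℝ E]
    [FiniteDimensional ℝ F] : finrank ℝ (WithLp 2 (E × F)) = finrank ℝ E + finrank ℝ F := by
  rw [(WithLp.linearEquiv 2 ℝ (E × F)).finrank_eq, finrank_prod]

variable {E : Type*} [NormedAddCommGroup E] [InnerProductSpace ℝ E]
  {Λ : Submodule ℤ E} {w : E}

namespace IsGlueVector

variable (h : IsGlueVector Λ w)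
include h

theorem mem_of_char {ξ : E} (hξ : ∀ v ∈ Λ, ∃ k : ℤ, ⟪ξ, v⟫ - ⟪v, v⟫ = 2 * (k : ℝ)) : ξ ∈ Λ := by
  have hd : ∀ v ∈ Λ, ∃ k : ℤ, ⟪ξ, v⟫ = (k : ℝ) := fun v hv => by
    obtain ⟨k, hk⟩ := hξ v hv
    obtain ⟨l, hl⟩ := h.inner_int v hv v hv
    exact ⟨2 * k + l, by push_cast; linarith⟩
  refine (h.dual_cases ξ hd).resolve_right fun h1 => ?_
  obtain ⟨k, hk⟩ := hξ _ h.two_smul_mem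
  obtain ⟨l, hl⟩ := h.inner_coset_coset h1 (y := w) (by simp)
  obtain ⟨m, hm⟩ := h.inner_self
  rw [two_smul] at hk
  simp only [inner_add_left, inner_add_right] at hk
  have : ((2 * k : ℤ) : ℝ) = (2 * l + 1 - 4 * m - 2 : ℤ) := by push_cast; linarith
  have : 2 * k = 2 * l + 1 - 4 * m - 2 := by exact_mod_cast this
  omega

theorem char_add_two_smul {ξ : E} (hξ : ∀ v ∈ Λ, ∃ k : ℤ, ⟪ξ, v⟫ - ⟪v, v⟫ = 2 * (k : ℝ)) {x : E}
    (hx : x ∈ Λ ∨ x - w ∈ Λ) :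
    ∀ v ∈ Λ, ∃ k : ℤ, ⟪ξ + (2 : ℝ) • x, v⟫ - ⟪v, v⟫ = 2 * (k : ℝ) := by
  intro v hv
  obtain ⟨k, hk⟩ := hξ v hv
  obtain ⟨l, hl⟩ := hx.elim (fun hx => h.inner_int x hx v hv) fun hx => h.inner_coset_int hx hv
  refine ⟨k + l, ?_⟩
  rw [inner_add_left, real_inner_smul_left]
  push_cast
  linarith

variable [FiniteDimensional ℝ E]

theorem char_inner_self {ξ : E} (hξ : ∀ v ∈ Λ, ∃ k : ℤ, ⟪ξ, v⟫ - ⟪v, v⟫ = 2 * (k : ℝ)) :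
    (∃ k : ℤ, ⟪ξ, ξ⟫ = finrank ℝ E + 1 + 8 * (k : ℝ)) ∨
      ∃ k : ℤ, ⟪ξ, ξ⟫ = finrank ℝ E - 1 + 8 * (k : ℝ) := by
  have h2 : √2 * √2 = 2 := Real.mul_self_sqrt zero_le_two
  have h' := isGlueVector_rootLattice
  have key : ∀ j : ℤ, (∃ k : ℤ, ⟪ξ, w⟫ - ⟪w, w⟫ + (j - 1 / 2) = 2 * (k : ℝ)) →
      ∃ k : ℤ, ⟪ξ, ξ⟫ + 2 * j ^ 2 = finrank ℝ E + 1 + 8 * (k : ℝ) := by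
    intro j hj
    have hc := h.isChar_glue h' (η := j * √2) hξ (fun v hv => by
      obtain ⟨l, rfl⟩ := mem_rootLattice.1 hv
      refine ⟨j * l - l ^ 2, ?_⟩
      simp only [RCLike.inner_apply, conj_trivial]
      push_cast
      linear_combination (j * l - l ^ 2 : ℝ) * h2) (by
      obtain ⟨k, hk⟩ := hj
      refine ⟨k, ?_⟩
      rw [← hk]
      simp only [RCLike.inner_apply, conj_trivial]
      linear_combination (j / 2 - 1 / 4 : ℝ) * h2)
    obtain ⟨k, hk⟩ := hc.norm_sq_eq (h.selfDual_glue h')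
    refine ⟨k, ?_⟩
    rw [← real_inner_self_eq_norm_sq, WithLp.prod_inner_apply, finrank_withLp_prod,
      finrank_self] at hk
    simp only [RCLike.inner_apply, conj_trivial] at hk
    push_cast at hk
    linear_combination hk - (j ^ 2 : ℝ) * h2
  obtain ⟨a, ha⟩ := h.inner_glue_int _ (h.mem_of_char hξ)
  obtain ⟨m, hm⟩ := h.inner_self
  rw [real_inner_comm] at ha
  rw [ha, hm] at key
  rcases Int.even_or_odd' (a - m) with ⟨b, hb | hb⟩
  · right
    obtain ⟨k, hk⟩ := key 1 ⟨b, by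
      have : (a : ℝ) - m = 2 * b := by exact_mod_cast hb
      push_cast
      linarith⟩
    exact ⟨k, by push_cast at hk; linarith⟩
  · left
    obtain ⟨k, hk⟩ := key 0 ⟨b, by
      have : (a : ℝ) - m = 2 * b + 1 := by exact_mod_cast hb
      push_cast
      linarith⟩
    exact ⟨k, by push_cast at hk; linarith⟩

/-- If no pair of characteristic covectors of a bimodular lattice is shorter than for the diagonal
lattice, then gluing the lattice to itself yields a lattice generated by unit vectors. -/
theorem glue_self_le_span {ξ : E} (hξ : ∀ v ∈ Λ, ∃ k : ℤ, ⟪ξ, v⟫ - ⟪v, v⟫ = 2 * (k : ℝ))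
    (hmin : ∀ x y : E, (∀ v ∈ Λ, ∃ k : ℤ, ⟪x, v⟫ - ⟪v, v⟫ = 2 * (k : ℝ)) →
      (∀ v ∈ Λ, ∃ k : ℤ, ⟪y, v⟫ - ⟪v, v⟫ = 2 * (k : ℝ)) →
      (∃ k : ℤ, ⟪x, x⟫ = finrank ℝ E + 1 + 8 * (k : ℝ)) →
      (∃ k : ℤ, ⟪y, y⟫ = finrank ℝ E - 1 + 8 * (k : ℝ)) → 2 * finrank ℝ E ≤ ⟪x, x⟫ + ⟪y, y⟫) :
    glue Λ w h.two_smul_mem Λ w h.two_smul_mem ≤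
      Submodule.span ℤ (unitVectors (glue Λ w h.two_smul_mem Λ w h.two_smul_mem)) := by
  have hsd := h.selfDual_glue h
  have hc := h.isChar_glue h hξ (h.char_add_two_smul hξ (x := w) (by simp)) (by
    obtain ⟨a, ha⟩ := h.inner_glue_int _ (h.mem_of_char hξ)
    rw [real_inner_comm] at ha
    refine ⟨a, ?_⟩
    rw [inner_add_left, real_inner_smul_left, ha]
    ring)
  refine hc.le_span_unitVectors hsd fun v hv => ?_
  have hc2 : IsChar (glue Λ w h.two_smul_mem Λ w h.two_smul_mem)
      (WithLp.toLp 2 (ξ, ξ + (2 : ℝ) • w) + (2 : ℤ) • v) := by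
    refine ⟨add_mem hc.1 (Submodule.smul_mem _ _ hv), fun u hu => ?_⟩
    obtain ⟨k, hk⟩ := hc.2 u hu
    obtain ⟨l, hl⟩ := hsd.inner_int hv hu
    refine ⟨k + l, ?_⟩
    rw [two_smul ℤ v, inner_add_left, inner_add_left]
    push_cast
    linarith
  set χ := WithLp.toLp 2 (ξ, ξ + (2 : ℝ) • w) with hχ
  obtain ⟨k, hk⟩ := hc2.norm_sq_eq hsd
  have e : ‖v + (1 / 2 : ℝ) • χ‖ ^ 2 = ‖χ + (2 : ℤ) • v‖ ^ 2 / 4 := by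
    have : χ + (2 : ℤ) • v = (2 : ℝ) • (v + (1 / 2 : ℝ) • χ) := by
      rw [smul_add, smul_smul, two_smul ℤ, two_smul ℝ v]
      norm_num
      abel
    rw [this, norm_smul, mul_pow]
    norm_num
  have hv1 : v.fst ∈ Λ ∨ v.fst - w ∈ Λ := hv.imp And.left And.left
  have hv2 : v.snd ∈ Λ ∨ v.snd - w ∈ Λ := hv.imp And.right And.right
  have h1 := h.char_add_two_smul hξ hv1
  have h2 := h.char_add_two_smul (h.char_add_two_smul hξ (x := w) (by simp)) hv2
  have e2 : ‖χ + (2 : ℤ) • v‖ ^ 2 = ⟪ξ + (2 : ℝ) • v.fst, ξ + (2 : ℝ) • v.fst⟫ +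
      ⟪ξ + (2 : ℝ) • w + (2 : ℝ) • v.snd, ξ + (2 : ℝ) • w + (2 : ℝ) • v.snd⟫ := by
    rw [← real_inner_self_eq_norm_sq, WithLp.prod_inner_apply, two_smul ℤ, two_smul ℝ v.fst,
      two_smul ℝ v.snd]
    rfl
  rw [e, e2, finrank_withLp_prod]
  rw [e2, finrank_withLp_prod] at hk
  push_cast at hk ⊢
  set x := ξ + (2 : ℝ) • v.fst
  set y := ξ + (2 : ℝ) • w + (2 : ℝ) • v.snd
  have hno : ∀ a b c : ℤ, ∀ s : ℤ, s = 1 ∨ s = -1 → ∀ N : ℝ,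
      N + s + 8 * a + (N + s + 8 * b) ≠ N + N + 8 * c := by
    intro a b c s hs N e
    have : ((2 * s + 8 * a + 8 * b : ℤ) : ℝ) = (8 * c : ℤ) := by push_cast; linarith
    have : 2 * s + 8 * a + 8 * b = 8 * c := by exact_mod_cast this
    omega
  rcases h.char_inner_self h1 with ha | ha <;> rcases h.char_inner_self h2 with hb | hb
  · obtain ⟨a, ha⟩ := ha
    obtain ⟨b, hb⟩ := hb
    refine absurd ?_ (hno a b k 1 (by simp) (finrank ℝ E))
    push_cast
    linarith
  · linarith [hmin x y h1 h2 ha hb]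
  · linarith [hmin y x h2 h1 hb ha]
  · obtain ⟨a, ha⟩ := ha
    obtain ⟨b, hb⟩ := hb
    refine absurd ?_ (hno a b k (-1) (by simp) (finrank ℝ E))
    push_cast
    linarith

end IsGlueVector

end Bimodular

section Splitting
open Module

variable {E : Type*} [NormedAddCommGroup E] [InnerProductSpace ℝ E]
  {Λ : Submodule ℤ E} {w : E}

namespace IsGlueVector

variable (h : IsGlueVector Λ w)
include h

theorem half_le_inner_self {x : E} (hx : x - w ∈ Λ) : 1 / 2 ≤ ⟪x, x⟫ := by
  obtain ⟨k, hk⟩ := h.inner_coset_coset hx hx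
  have h0 : 0 ≤ ⟪x, x⟫ := real_inner_self_nonneg
  have : -1 < k := by
    have : ((-1 : ℤ) : ℝ) < k := by push_cast; linarith
    exact_mod_cast this
  have : (0 : ℝ) ≤ k := by exact_mod_cast (by omega : 0 ≤ k)
  linarith

theorem unitVectors_glue {p : WithLp 2 (E × E)}
    (hp : p ∈ unitVectors (glue Λ w h.two_smul_mem Λ w h.two_smul_mem)) :
    p.fst ∈ unitVectors Λ ∨ p.fst = 0 ∨ (p.fst - w ∈ Λ ∧ ⟪p.fst, p.fst⟫ = 1 / 2) := by
  have h1 : ⟪p.fst, p.fst⟫ + ⟪p.snd, p.snd⟫ = 1 := by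
    have := WithLp.prod_inner_apply (𝕜 := ℝ) p p
    rw [real_inner_self_eq_norm_sq, hp.2] at this
    exact this.symm.trans (one_pow 2)
  rcases hp.1 with ⟨h2, h3⟩ | ⟨h2, h3⟩
  · obtain ⟨k, hk⟩ := h.inner_int _ h2 _ h2
    obtain ⟨l, hl⟩ := h.inner_int _ h3 _ h3
    have hk0 : 0 ≤ ⟪p.fst, p.fst⟫ := real_inner_self_nonneg
    have hl0 : 0 ≤ ⟪p.snd, p.snd⟫ := real_inner_self_nonneg
    rw [hk, hl] at h1
    rw [hk] at hk0
    rw [hl] at hl0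
    norm_cast at h1 hk0 hl0
    rcases (by omega : k = 0 ∨ k = 1) with rfl | rfl
    · right; left
      rw [← inner_self_eq_zero (𝕜 := ℝ), hk, Int.cast_zero]
    · left
      refine ⟨h2, ?_⟩
      rw [real_inner_self_eq_norm_sq, Int.cast_one] at hk
      exact (pow_eq_one_iff_of_nonneg (norm_nonneg _) two_ne_zero).1 hk
  · right; right
    have h4 := h.half_le_inner_self h2
    have h5 := h.half_le_inner_self h3
    exact ⟨h2, by linarith⟩

theorem inner_eq_zero_of_half {x u : E} (hx : x - w ∈ Λ) (hx2 : ⟪x, x⟫ = 1 / 2)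
    (hu : u ∈ unitVectors Λ) : ⟪u, x⟫ = 0 := by
  obtain ⟨k, hk⟩ := h.inner_coset_int hx hu.1
  rw [real_inner_comm] at hk
  have h1 := real_inner_mul_inner_self_le u x
  rw [real_inner_self_eq_norm_sq u, hu.2, hx2, hk] at h1
  have h2 : k * k < 1 := by
    have : ((k * k : ℤ) : ℝ) < (1 : ℤ) := by push_cast; linarith
    exact_mod_cast this
  have : k = 0 := by nlinarith
  rw [hk, this, Int.cast_zero]

theorem eq_or_eq_neg_of_half {x y : E} (hx : x - w ∈ Λ) (hx2 : ⟪x, x⟫ = 1 / 2)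
    (hy : y - w ∈ Λ) (hy2 : ⟪y, y⟫ = 1 / 2) : y = x ∨ y = -x := by
  obtain ⟨k, hk⟩ := h.inner_coset_coset hx hy
  have h1 := real_inner_mul_inner_self_le x y
  rw [hx2, hy2, hk] at h1
  have h2 : k * (k + 1) < 1 := by
    have : ((k * (k + 1) : ℤ) : ℝ) < (1 : ℤ) := by push_cast; linarith
    exact_mod_cast this
  have h3 : k = 0 ∨ k = -1 := by
    have : k < 1 := by nlinarith
    have : -2 < k := by nlinarith
    omega
  rcases h3 with rfl | rfl
  · left
    rw [← sub_eq_zero, ← inner_self_eq_zero (𝕜 := ℝ)]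
    simp only [inner_sub_left, inner_sub_right, real_inner_comm x y, hk, hx2, hy2]
    norm_num
  · right
    rw [← sub_eq_zero, sub_neg_eq_add, ← inner_self_eq_zero (𝕜 := ℝ)]
    simp only [inner_add_left, inner_add_right, real_inner_comm x y, hk, hx2, hy2]
    norm_num

theorem exists_half (hs : glue Λ w h.two_smul_mem Λ w h.two_smul_mem ≤
    Submodule.span ℤ (unitVectors (glue Λ w h.two_smul_mem Λ w h.two_smul_mem))) :
    ∃ x, x - w ∈ Λ ∧ ⟪x, x⟫ = 1 / 2 ∧ Λ ≤ Submodule.span ℤ (insert x (unitVectors Λ)) := by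
  have hfst : ∀ N : Submodule ℤ E,
      (∀ p ∈ unitVectors (glue Λ w h.two_smul_mem Λ w h.two_smul_mem), p.fst ∈ N) →
      ∀ p ∈ glue Λ w h.two_smul_mem Λ w h.two_smul_mem, p.fst ∈ N := by
    intro N hN p hp
    refine Submodule.span_induction (p := fun q _ => q.fst ∈ N) hN N.zero_mem
      (fun _ _ _ _ => N.add_mem) (fun k _ _ => N.smul_mem k) (hs hp)
  have hex : ∃ x, x - w ∈ Λ ∧ ⟪x, x⟫ = 1 / 2 := by
    by_contra hcon
    refine h.notMem (hfst Λ (fun p hp => ?_) (WithLp.toLp 2 (w, w)) (Or.inr ⟨by simp, by simp⟩))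
    rcases h.unitVectors_glue hp with h1 | h1 | h1
    · exact h1.1
    · rw [h1]
      exact Λ.zero_mem
    · exact absurd ⟨_, h1⟩ hcon
  obtain ⟨x, hx, hx2⟩ := hex
  refine ⟨x, hx, hx2, fun v hv => hfst _ (fun p hp => ?_) (WithLp.toLp 2 (v, 0))
    (Or.inl ⟨hv, Λ.zero_mem⟩)⟩
  rcases h.unitVectors_glue hp with h1 | h1 | ⟨h1, h2⟩
  · exact Submodule.subset_span (Set.mem_insert_of_mem _ h1)
  · rw [h1]
    exact Submodule.zero_mem _
  · have hxs : x ∈ Submodule.span ℤ (insert x (unitVectors Λ)) :=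
      Submodule.subset_span (Set.mem_insert _ _)
    rcases h.eq_or_eq_neg_of_half hx hx2 h1 h2 with h3 | h3
    · rwa [h3]
    · rw [h3]
      exact neg_mem hxs

/-- If gluing a bimodular lattice to itself yields a lattice generated by unit vectors, then the
bimodular lattice is diagonal. -/
theorem exists_diagonal_basis [FiniteDimensional ℝ E] (htop : Submodule.span ℝ (Λ : Set E) = ⊤)
    (hs : glue Λ w h.two_smul_mem Λ w h.two_smul_mem ≤
      Submodule.span ℤ (unitVectors (glue Λ w h.two_smul_mem Λ w h.two_smul_mem)))
    {n : ℕ} (hn : finrank ℝ E = n) :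
    0 < n ∧ ∃ b : Fin n → E, (∀ i, b i ∈ Λ) ∧ (∀ x ∈ Λ, x ∈ Submodule.span ℤ (Set.range b)) ∧
      ∀ i j, ⟪b i, b j⟫ = if i = j then (if (i : ℕ) = n - 1 then 2 else 1) else 0 := by
  classical
  obtain ⟨x, hx, hx2, hxs⟩ := h.exists_half hs
  obtain ⟨S, hon, hunion, -⟩ := exists_orthonormal_unitVectors h.inner_int
  have hS : S ⊆ unitVectors Λ := hunion ▸ Set.subset_union_left
  have hxu : ∀ u ∈ unitVectors Λ, ⟪x, u⟫ = 0 := fun u hu => by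
    rw [real_inner_comm, h.inner_eq_zero_of_half hx hx2 hu]
  have hspanS : Submodule.span ℤ (unitVectors Λ) = Submodule.span ℤ S := by
    refine le_antisymm (Submodule.span_le.2 ?_) (Submodule.span_mono hS)
    rw [hunion]
    rintro u (hu | ⟨v, hv, rfl⟩)
    · exact Submodule.subset_span hu
    · exact neg_mem (Submodule.subset_span hv)
  let f : Option S → E := fun o => o.elim ((2 : ℝ) • x) (↑)
  have hf : ∀ i j, ⟪f i, f j⟫ = if i = j then (if i = none then 2 else 1) else 0 := by
    rintro (_ | u) (_ | v)
    · simp only [f, Option.elim_none, real_inner_smul_left, real_inner_smul_right, hx2]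
      norm_num
    · simp [f, real_inner_smul_left, hxu v (hS v.2)]
    · simp [f, real_inner_smul_right, h.inner_eq_zero_of_half hx hx2 (hS u.2)]
    · have := orthonormal_iff_ite.1 hon u v
      simpa [f] using this
  have hfmem : ∀ i, f i ∈ Λ := by
    rintro (_ | u)
    · have : (2 : ℝ) • x = (2 : ℤ) • (x - w) + (2 : ℤ) • w := by
        rw [two_smul, two_smul, two_smul]; abel
      change (2 : ℝ) • x ∈ Λ
      rw [this]
      exact Λ.add_mem (Λ.smul_mem _ hx) h.two_smul_mem
    · exact (hS u.2).1
  have hfspan : ∀ v ∈ Λ, v ∈ Submodule.span ℤ (Set.range f) := by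
    intro v hv
    obtain ⟨k, y, hy, rfl⟩ := Submodule.mem_span_insert.1 (hxs hv)
    have hxy : ⟪x, y⟫ = 0 := by
      refine Submodule.span_induction (p := fun y _ => ⟪x, y⟫ = 0) hxu (inner_zero_right _)
        (fun a b _ _ ha hb => ?_) (fun k a _ ha => ?_) hy
      · rw [inner_add_right, ha, hb, add_zero]
      · rw [← Int.cast_smul_eq_zsmul ℝ, real_inner_smul_right, ha, mul_zero]
    obtain ⟨l, hl⟩ := h.inner_coset_int hx hv
    rw [inner_add_right, hxy, ← Int.cast_smul_eq_zsmul ℝ, real_inner_smul_right, hx2] at hl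
    have hkl : k = l * 2 := by
      have : (k : ℝ) = (l * 2 : ℤ) := by push_cast; linarith
      exact_mod_cast this
    refine Submodule.add_mem _ ?_ ?_
    · rw [hkl, mul_smul]
      refine Submodule.smul_mem _ _ (Submodule.subset_span ⟨none, ?_⟩)
      simp only [f, Option.elim_none, two_smul]
    · rw [hspanS] at hy
      refine Submodule.span_mono ?_ hy
      exact fun u hu => ⟨some ⟨u, hu⟩, rfl⟩
  have hli : LinearIndependent ℝ f := linearIndependent_of_ne_zero_of_inner_eq_zero
    (fun i h0 => by
      have := hf i i
      rw [h0, inner_zero_left, if_pos rfl] at this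
      split_ifs at this <;> norm_num at this)
    (fun i j hij => (hf i j).trans (if_neg hij))
  have hftop : ⊤ ≤ Submodule.span ℝ (Set.range f) := by
    rw [← htop, Submodule.span_le]
    exact fun v hv => Submodule.span_le_restrictScalars ℤ ℝ _ (hfspan v hv)
  have := hli.finite
  have := Fintype.ofFinite (Option S)
  have hcard : Fintype.card (Option S) = n := by
    rw [← hn, finrank_eq_card_basis (Basis.mk hli hftop)]
  have hn0 : 0 < n := hcard ▸ Fintype.card_pos
  let e₀ : Option S ≃ Fin n := Fintype.equivFinOfCardEq hcard
  let e : Option S ≃ Fin n := e₀.trans (Equiv.swap (e₀ none) ⟨n - 1, by omega⟩)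
  have he : ∀ i : Fin n, e.symm i = none ↔ (i : ℕ) = n - 1 := by
    intro i
    rw [Equiv.symm_apply_eq, Fin.ext_iff]
    simp [e]
  refine ⟨hn0, f ∘ e.symm, fun i => hfmem _, fun v hv => ?_, fun i j => ?_⟩
  · rw [Set.range_comp, e.symm.range_eq_univ, Set.image_univ]
    exact hfspan v hv
  · simp only [Function.comp_apply, hf, he, e.symm.injective.eq_iff]

end IsGlueVector

end Splitting

section Main
open Module

variable {n : ℕ} {L : Set (EuclideanSpace ℝ (Fin n))}

/-- A lattice in `ℝ^n` as a `ℤ`-submodule. -/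
def IsLattice.toSubmodule (h : IsLattice L) : Submodule ℤ (EuclideanSpace ℝ (Fin n)) :=
  AddSubgroup.toIntSubmodule
    { carrier := L
      zero_mem' := h.1.1
      add_mem' := fun {x y} hx hy => h.1.2.1 x hx y hy
      neg_mem' := fun {x} hx => h.1.2.2 x hx }

theorem IsLattice.mem_toSubmodule (h : IsLattice L) {x : EuclideanSpace ℝ (Fin n)} :
    x ∈ h.toSubmodule ↔ x ∈ L := Iff.rfl

theorem IsLattice.exists_basis (h : IsLattice L) :
    ∃ b : Basis (Fin n) ℝ (EuclideanSpace ℝ (Fin n)), (∀ i, b i ∈ L) ∧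
      ∀ x ∈ L, ∃ c : Fin n → ℤ, x = ∑ i, (c i : ℝ) • b i := by
  obtain ⟨b, hb, -, hc⟩ := h.2.1
  have hs : ⊤ ≤ Submodule.span ℝ (Set.range b) := by
    rw [← h.2.2.1, Submodule.span_le]
    intro x hx
    obtain ⟨c, rfl⟩ := hc x hx
    exact Submodule.sum_mem _ fun i _ => Submodule.smul_mem _ _ (Submodule.subset_span ⟨i, rfl⟩)
  let B := basisOfTopLeSpanOfCardEqFinrank b hs (by simp)
  have hB : ⇑B = b := coe_basisOfTopLeSpanOfCardEqFinrank ..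
  exact ⟨B, by rwa [hB], by rwa [hB]⟩

theorem exists_inner_eq (f : EuclideanSpace ℝ (Fin n) →ₗ[ℝ] ℝ) :
    ∃ y : EuclideanSpace ℝ (Fin n), ∀ x, ⟪y, x⟫ = f x :=
  ⟨(InnerProductSpace.toDual ℝ _).symm (LinearMap.toContinuousLinearMap f), fun x => by simp⟩

theorem IsLattice.mem_of_dual (h : IsLattice L) {x : EuclideanSpace ℝ (Fin n)}
    (hx : ∀ y ∈ dualSet L, ∃ k : ℤ, ⟪x, y⟫ = (k : ℝ)) : x ∈ L := by
  obtain ⟨b, hb, hc⟩ := h.exists_basis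
  have hcoord : ∀ i, ∃ k : ℤ, b.repr x i = k := by
    intro i
    obtain ⟨y, hy⟩ := exists_inner_eq (b.coord i)
    obtain ⟨k, hk⟩ := hx y fun v hv => by
      obtain ⟨c, rfl⟩ := hc v hv
      refine ⟨c i, ?_⟩
      rw [hy, Basis.coord_apply, ← b.equivFun_apply, ← b.equivFun_symm_apply,
        LinearEquiv.apply_symm_apply]
    exact ⟨k, by rw [← hk, real_inner_comm, hy, Basis.coord_apply]⟩
  rw [← h.mem_toSubmodule, ← b.sum_repr x]
  refine Submodule.sum_mem _ fun i _ => ?_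
  obtain ⟨k, hk⟩ := hcoord i
  rw [hk, Int.cast_smul_eq_zsmul]
  exact Submodule.smul_mem _ _ (hb i)

theorem IsLattice.char_of_basis (h : IsLattice L) {ι : Type*} {b : ι → EuclideanSpace ℝ (Fin n)}
    (hb : ∀ i, b i ∈ L) (hs : ∀ x ∈ L, x ∈ Submodule.span ℤ (Set.range b))
    {ξ : EuclideanSpace ℝ (Fin n)}
    (hξ : ∀ i, ∃ k : ℤ, ⟪ξ, b i⟫ - ⟪b i, b i⟫ = 2 * (k : ℝ)) : ξ ∈ CharSet L := by
  have key : ∀ v ∈ L, ∃ k : ℤ, ⟪ξ, v⟫ - ⟪v, v⟫ = 2 * (k : ℝ) := by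
    intro v hv
    refine (Submodule.span_induction (p := fun v _ => v ∈ L ∧
      ∃ k : ℤ, ⟪ξ, v⟫ - ⟪v, v⟫ = 2 * (k : ℝ)) ?_ ⟨h.1.1, 0, by simp⟩ ?_ ?_ (hs v hv)).2
    · rintro _ ⟨i, rfl⟩
      exact ⟨hb i, hξ i⟩
    · rintro x y - - ⟨hx, k, hk⟩ ⟨hy, l, hl⟩
      obtain ⟨m, hm⟩ := h.2.2.2 x hx y hy
      refine ⟨h.1.2.1 x hx y hy, k + l - m, ?_⟩
      simp only [inner_add_left, inner_add_right, real_inner_comm x y]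
      push_cast
      linarith
    · rintro a x - ⟨hx, k, hk⟩
      obtain ⟨m, hm⟩ := h.2.2.2 x hx x hx
      obtain ⟨j, hj⟩ := even_iff_two_dvd.1 (Int.even_mul_succ_self (a - 1))
      refine ⟨h.toSubmodule.smul_mem a hx, a * k - j * m, ?_⟩
      have hj' : ((a : ℝ) - 1) * (a - 1 + 1) = 2 * j := by exact_mod_cast hj
      rw [← Int.cast_smul_eq_zsmul ℝ, real_inner_smul_right, real_inner_smul_right,
        real_inner_smul_left]
      push_cast
      rw [hm] at hk ⊢
      linear_combination (a : ℝ) * hk - (m : ℝ) * hj'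
  refine ⟨fun v hv => ?_, key⟩
  obtain ⟨k, hk⟩ := key v hv
  obtain ⟨l, hl⟩ := h.2.2.2 v hv v hv
  exact ⟨2 * k + l, by push_cast; linarith⟩

theorem mem_span_range_iff_exists_sum {b : Fin n → EuclideanSpace ℝ (Fin n)}
    {x : EuclideanSpace ℝ (Fin n)} :
    x ∈ Submodule.span ℤ (Set.range b) ↔ ∃ c : Fin n → ℤ, x = ∑ i, (c i : ℝ) • b i := by
  simp only [Submodule.mem_span_range_iff_exists_fun, Int.cast_smul_eq_zsmul, eq_comm]

theorem IsLattice.charSet_nonempty (h : IsLattice L) : (CharSet L).Nonempty := by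
  obtain ⟨b, hb, hc⟩ := h.exists_basis
  obtain ⟨y, hy⟩ := exists_inner_eq (b.constr ℝ fun i => ⟪b i, b i⟫)
  exact ⟨y, h.char_of_basis hb (fun x hx => mem_span_range_iff_exists_sum.2 (hc x hx)) fun i =>
    ⟨0, by rw [hy, b.constr_basis]; simp⟩⟩

theorem IsBimodular.exists_isGlueVector (hL : IsBimodular L) :
    ∃ w, IsGlueVector hL.1.toSubmodule w := by
  obtain ⟨w, ⟨hw, hwL⟩, hd⟩ := hL.2
  have hww : (2 : ℤ) • w ∈ hL.1.toSubmodule := by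
    refine (hd _ fun v hv => ?_).resolve_right fun h => hwL ?_
    · obtain ⟨k, hk⟩ := hw v hv
      exact ⟨2 * k, by rw [two_smul, inner_add_left, hk]; push_cast; ring⟩
    · rwa [two_smul, add_sub_cancel_right] at h
  refine ⟨w, hL.1.2.2.2, hw, hd, hww, ?_⟩
  obtain ⟨m, hm⟩ := hw _ hww
  rw [two_smul, inner_add_right] at hm
  rcases Int.even_or_odd' m with ⟨k, rfl | rfl⟩
  · refine absurd (hL.1.mem_of_dual fun y hy => ?_) hwL
    rcases hd y hy with h | h
    · exact hw y h
    · obtain ⟨l, hl⟩ := hw _ h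
      rw [inner_sub_right] at hl
      exact ⟨l + k, by push_cast at hm ⊢; linarith⟩
  · exact ⟨k, by push_cast at hm; linarith⟩

theorem bddBelow_defectSign (L : Set (EuclideanSpace ℝ (Fin n))) (ε : ℤ) :
    BddBelow ((fun ξ => (⟪ξ, ξ⟫ - (n : ℝ)) / 4) '' CharSign L ε) := by
  refine ⟨-(n : ℝ) / 4, ?_⟩
  rintro _ ⟨ξ, -, rfl⟩
  have : 0 ≤ ⟪ξ, ξ⟫ := real_inner_self_nonneg
  change _ ≤ (⟪ξ, ξ⟫ - (n : ℝ)) / 4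
  linarith

theorem defectSign_le {ε : ℤ} {ξ : EuclideanSpace ℝ (Fin n)} (hξ : ξ ∈ CharSign L ε) :
    defectSign L ε ≤ (⟪ξ, ξ⟫ - n) / 4 :=
  csInf_le (bddBelow_defectSign L ε) ⟨ξ, hξ, rfl⟩

theorem IsBimodular.exists_diagonal_basis (hL : IsBimodular L)
    (hd : defectSign L 1 + defectSign L (-1) = 0) :
    0 < n ∧ ∃ b : Fin n → EuclideanSpace ℝ (Fin n), (∀ i, b i ∈ L) ∧
      (∀ x ∈ L, x ∈ Submodule.span ℤ (Set.range b)) ∧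
      ∀ i j, ⟪b i, b j⟫ = if i = j then (if (i : ℕ) = n - 1 then 2 else 1) else 0 := by
  obtain ⟨w, hw⟩ := hL.exists_isGlueVector
  obtain ⟨ξ, hξ⟩ := hL.1.charSet_nonempty
  refine hw.exists_diagonal_basis hL.1.2.2.1 (hw.glue_self_le_span hξ.2 ?_) (by simp)
  have hdual : ∀ x : EuclideanSpace ℝ (Fin n),
      (∀ v ∈ hL.1.toSubmodule, ∃ k : ℤ, ⟪x, v⟫ - ⟪v, v⟫ = 2 * (k : ℝ)) → x ∈ CharSet L :=
    fun x hx => ⟨fun v hv => hw.inner_int x (hw.mem_of_char hx) v hv, hx⟩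
  rw [finrank_euclideanSpace_fin]
  rintro x y hx hy ⟨k, hk⟩ ⟨l, hl⟩
  have h1 : defectSign L 1 ≤ _ := defectSign_le (ξ := x) ⟨hdual x hx, k, by rw [hk]; push_cast; ring⟩
  have h2 : defectSign L (-1) ≤ _ :=
    defectSign_le (ξ := y) ⟨hdual y hy, l, by rw [hl]; push_cast; ring⟩
  linarith

theorem linearIndependent_of_diagonal {b : Fin n → EuclideanSpace ℝ (Fin n)}
    (hg : ∀ i j, ⟪b i, b j⟫ = if i = j then (if (i : ℕ) = n - 1 then 2 else 1) else 0) :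
    LinearIndependent ℝ b :=
  linearIndependent_of_ne_zero_of_inner_eq_zero
    (fun i h0 => by
      have := hg i i
      rw [h0, inner_zero_left, if_pos rfl] at this
      split_ifs at this <;> norm_num at this)
    (fun i j hij => (hg i j).trans (if_neg hij))

theorem defectSign_eq_of_isLeast {ε : ℤ} {ξ : EuclideanSpace ℝ (Fin n)} (hξ : ξ ∈ CharSign L ε)
    (hmin : ∀ η ∈ CharSign L ε, ⟪ξ, ξ⟫ ≤ ⟪η, η⟫) : defectSign L ε = (⟪ξ, ξ⟫ - n) / 4 := by
  refine IsLeast.csInf_eq ⟨⟨ξ, hξ, rfl⟩, ?_⟩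
  rintro _ ⟨η, hη, rfl⟩
  have := hmin η hη
  change _ ≤ (⟪η, η⟫ - (n : ℝ)) / 4
  linarith

theorem le_inner_self_of_diagonal (hn : 0 < n) {b : Fin n → EuclideanSpace ℝ (Fin n)}
    (hb : ∀ i, b i ∈ L)
    (hg : ∀ i j, ⟪b i, b j⟫ = if i = j then (if (i : ℕ) = n - 1 then 2 else 1) else 0)
    {η : EuclideanSpace ℝ (Fin n)} (hη : η ∈ CharSet L) : (n : ℝ) - 1 ≤ ⟪η, η⟫ := by
  obtain ⟨m, rfl⟩ : ∃ m, n = m + 1 := ⟨n - 1, by omega⟩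
  have hon : Orthonormal ℝ fun i : Fin m => b i.castSucc := by
    rw [orthonormal_iff_ite]
    intro i j
    rw [hg]
    refine if_congr Fin.castSucc_inj (if_neg ?_) rfl
    have := i.2
    simp only [Fin.val_castSucc]
    omega
  have h1 := hon.sum_inner_products_le (s := Finset.univ) η
  rw [← real_inner_self_eq_norm_sq] at h1
  refine le_trans ?_ h1
  have h2 : ∀ i : Fin m, (1 : ℝ) ≤ ‖⟪b i.castSucc, η⟫‖ ^ 2 := by
    intro i
    obtain ⟨k, hk⟩ := hη.2 _ (hb i.castSucc)
    have h3 : ⟪b i.castSucc, b i.castSucc⟫ = (1 : ℝ) := by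
      have := orthonormal_iff_ite.1 hon i i
      rwa [if_pos rfl] at this
    rw [h3, real_inner_comm] at hk
    have h4 : ⟪b i.castSucc, η⟫ = ((2 * k + 1 : ℤ) : ℝ) := by push_cast; linarith
    rw [h4, Real.norm_eq_abs, sq_abs]
    have : 1 ≤ (2 * k + 1) ^ 2 := by
      have : (2 * k + 1) ≠ 0 := by omega
      have : 0 < (2 * k + 1) ^ 2 := by positivity
      omega
    exact_mod_cast this
  calc ((m + 1 : ℕ) : ℝ) - 1 = ∑ _i : Fin m, (1 : ℝ) := by simp
    _ ≤ _ := Finset.sum_le_sum fun i _ => h2 i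

theorem defectSign_of_diagonal (hL : IsLattice L) (hn : 0 < n)
    {b : Fin n → EuclideanSpace ℝ (Fin n)} (hb : ∀ i, b i ∈ L)
    (hs : ∀ x ∈ L, x ∈ Submodule.span ℤ (Set.range b))
    (hg : ∀ i j, ⟪b i, b j⟫ = if i = j then (if (i : ℕ) = n - 1 then 2 else 1) else 0) :
    defectSign L 1 = 1 / 4 ∧ defectSign L (-1) = -(1 / 4) := by
  let l : Fin n := ⟨n - 1, by omega⟩
  have hl : ∀ i : Fin n, (i : ℕ) = n - 1 ↔ i = l := fun i => by rw [Fin.ext_iff]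
  obtain ⟨ξ, hξ⟩ : ∃ ξ, ξ = ∑ i, b i := ⟨_, rfl⟩
  have h1 : ∀ i, ⟪ξ, b i⟫ = ⟪b i, b i⟫ := by
    intro i
    rw [hξ, sum_inner, Finset.sum_eq_single i (fun j _ hj => by rw [hg, if_neg hj]) (by simp)]
  have hll : ⟪b l, b l⟫ = 2 := by rw [hg, if_pos rfl, if_pos rfl]
  have hξl : ⟪ξ, b l⟫ = 2 := by rw [h1, hll]
  have hξξ : ⟪ξ, ξ⟫ = n + 1 := by
    have : ⟪ξ, ξ⟫ = ∑ i, ⟪ξ, b i⟫ := by rw [← inner_sum, ← hξ]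
    rw [this]
    simp only [h1, hg, hl, if_true]
    have : ∀ i : Fin n, (if i = l then (2 : ℝ) else 1) = 1 + if i = l then 1 else 0 := by
      intro i; split_ifs <;> norm_num
    simp [this, Finset.sum_add_distrib]
  have hξc : ξ ∈ CharSet L := hL.char_of_basis hb hs fun i => ⟨0, by rw [h1]; simp⟩
  have hξc' : ξ - b l ∈ CharSet L := hL.char_of_basis hb hs fun i => by
    rw [inner_sub_left, h1, hg l i]
    split_ifs with h h'
    · exact ⟨-1, by push_cast; ring⟩
    · exact absurd rfl h'
    · exact ⟨0, by simp⟩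
  have hξξ' : ⟪ξ - b l, ξ - b l⟫ = (n : ℝ) - 1 := by
    simp only [inner_sub_left, inner_sub_right, real_inner_comm ξ (b l), hξξ, hξl, hll]
    ring
  constructor
  · rw [defectSign_eq_of_isLeast (ξ := ξ) ⟨hξc, 0, by rw [hξξ]; simp⟩, hξξ]
    · ring
    · rintro η ⟨hη, k, hk⟩
      have h2 := le_inner_self_of_diagonal hn hb hg hη
      rw [hk] at h2
      push_cast at h2 hk
      have : -1 < k := by
        have : ((-1 : ℤ) : ℝ) < k := by push_cast; linarith
        exact_mod_cast this
      have : (0 : ℝ) ≤ k := by exact_mod_cast (by omega : 0 ≤ k)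
      rw [hξξ]
      linarith
  · rw [defectSign_eq_of_isLeast (ξ := ξ - b l) ⟨hξc', 0, by rw [hξξ']; simp; ring⟩, hξξ']
    · ring
    · rintro η ⟨hη, -⟩
      rw [hξξ']
      exact le_inner_self_of_diagonal hn hb hg hη

end Main

/-- a bimodular lattice `L` with `d_+(L) + d_−(L) = 0` is diagonal, and in
particular `d_+(L) = 1/4` and `d_−(L) = −1/4`. -/
theorem stmt8 {n : ℕ} (L : Set (EuclideanSpace ℝ (Fin n))) (hL : IsBimodular L)
    (hd : defectSign L 1 + defectSign L (-1) = 0) :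
    IsDiagonal L ∧ defectSign L 1 = 1 / 4 ∧ defectSign L (-1) = -(1 / 4) := by
  obtain ⟨hn, b, hb, hs, hg⟩ := hL.exists_diagonal_basis hd
  exact ⟨⟨b, hb, (linearIndependent_of_diagonal hg).restrict_scalars' ℤ, fun x hx =>
    mem_span_range_iff_exists_sum.1 (hs x hx), hg⟩, defectSign_of_diagonal hL.1 hn hb hs hg⟩

end
end

section
/- Let L ⊂ ℝ^n be a bimodular lattice of rank n and let D = (L × L) ∪ ((L' \ L) × (L' \ L)) ⊂ ℝ^{2n} be the double of L (the unimodular overlattice of L ⊕ L). Then the defect of the unimodular lattice D satisfies d(D) = d_+(L) + d_−(L). -/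
open scoped RealInnerProductSpace

noncomputable section

section GaussSum
open Complex Filter Topology

lemma tendsto_jacobiTheta₂_vertical (z s : ℝ) :
    Tendsto (fun T : ℝ => jacobiTheta₂ z (s + T * I)) atTop (𝓝 1) := by
  have him (T : ℝ) : ((s : ℂ) + T * I).im = T := by simp
  have hb := summable_pow_mul_jacobiTheta₂_term_bound 0 one_pos 0
  have key := tendsto_tsum_of_dominated_convergence (𝓕 := atTop)
    (f := fun (T : ℝ) (n : ℤ) => jacobiTheta₂_term n z (s + T * I))
    (g := fun n : ℤ => if n = 0 then (1 : ℂ) else 0) hb ?_ ?_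
  · simpa [jacobiTheta₂] using key
  · intro n
    by_cases hn : n = 0
    · simp [hn, jacobiTheta₂_term]
    · simp only [hn, if_false]
      rw [tendsto_zero_iff_norm_tendsto_zero]
      simp only [norm_jacobiTheta₂_term, him, ofReal_im, mul_zero, sub_zero]
      refine Real.tendsto_exp_atBot.comp ?_
      refine Tendsto.const_mul_atTop_of_neg ?_ tendsto_id
      have : (0 : ℝ) < (n : ℝ) ^ 2 := by positivity
      nlinarith [Real.pi_pos]
  · filter_upwards [eventually_ge_atTop 1] with T hT n
    have := norm_jacobiTheta₂_term_le (S := 0) one_pos (z := z) (τ := s + T * I) (by simp)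
      (by rw [him]; exact hT) n
    simpa using this

lemma jacobiTheta₂_add_nat_of_even {m : ℕ} (hm : Even m) (z τ : ℂ) :
    jacobiTheta₂ z (τ + m) = jacobiTheta₂ z τ := by
  obtain ⟨r, rfl⟩ := hm
  induction r with
  | zero => simp
  | succ r ih =>
    rw [← ih, ← jacobiTheta₂_add_right z (τ + ((r + r : ℕ) : ℂ))]
    congr 1
    push_cast
    ring

lemma jacobiTheta₂_eq_sum_residues {m : ℕ} [NeZero m] (hm : Even m) {T : ℝ} (hT : 0 < T) :
    jacobiTheta₂ 0 (1 / m + I / (m ^ 2 * T)) =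
      (T : ℂ) ^ (1 / 2 : ℂ) * ∑ k : Fin m,
        cexp (Real.pi * I * (k : ℕ) ^ 2 / m) * jacobiTheta₂ ((k : ℕ) / m : ℝ) (T * I) := by
  have hm0 : (m : ℂ) ≠ 0 := NeZero.ne _
  have hT0 : (T : ℂ) ≠ 0 := by exact_mod_cast hT.ne'
  have him : 0 < ((1 : ℂ) / m + I / (m ^ 2 * T)).im := by
    have : ((1 : ℂ) / m + I / (m ^ 2 * T)) =
        ((1 / m : ℝ) : ℂ) + ((1 / (m ^ 2 * T) : ℝ) : ℂ) * I := by
      push_cast; ring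
    rw [this]
    have hmr : (0 : ℝ) < m := by exact_mod_cast Nat.pos_of_ne_zero (NeZero.ne m)
    simp only [add_im, ofReal_im, mul_im, ofReal_re, I_im, I_re, mul_one, mul_zero, add_zero,
      zero_add]
    positivity
  have hs := (summable_jacobiTheta₂_term_iff 0 _).mpr him
  have hterm (j : ℤ) (k : Fin m) :
      jacobiTheta₂_term ((Int.divModEquiv m).symm (j, k)) 0 (1 / m + I / (m ^ 2 * T)) =
      cexp (Real.pi * I * (k : ℕ) ^ 2 / m) * cexp (- Real.pi * (k : ℕ) ^ 2 / (m ^ 2 * T)) *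
        jacobiTheta₂_term j ((k : ℕ) * I / (m * T)) (I / T) := by
    obtain ⟨r, hr⟩ := hm
    simp only [jacobiTheta₂_term, Int.divModEquiv, Equiv.coe_fn_symm_mk, ← Complex.exp_add]
    rw [Complex.exp_eq_exp_iff_exists_int]
    refine ⟨j * k + r * j ^ 2, ?_⟩
    have hr' : (r : ℂ) = m / 2 := by rw [hr]; push_cast; ring
    push_cast
    rw [hr']
    field_simp
    ring_nf
    simp only [I_sq]
    ring
  rw [jacobiTheta₂, ← (Int.divModEquiv m).symm.tsum_eq,
    ← (Equiv.prodComm (Fin m) ℤ).tsum_eq, Summable.tsum_prod, tsum_fintype, Finset.mul_sum]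
  · refine Finset.sum_congr rfl fun k _ => ?_
    simp only [Equiv.prodComm_apply, Prod.swap_prod_mk, hterm, tsum_mul_left]
    rw [← jacobiTheta₂, jacobiTheta₂_functional_equation]
    have e1 : -I * (I / T) = ((T⁻¹ : ℝ) : ℂ) := by
      push_cast; field_simp; simp
    have e2 : (-1 : ℂ) / (I / T) = T * I := by
      field_simp; simp
    have e3 : ((k : ℕ) : ℂ) * I / (m * T) / (I / T) = (((k : ℕ) / m : ℝ) : ℂ) := by
      push_cast; field_simp
    have e4 : (1 : ℂ) / ((T⁻¹ : ℝ) : ℂ) ^ (1 / 2 : ℂ) = (T : ℂ) ^ (1 / 2 : ℂ) := by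
      rw [show (1 / 2 : ℂ) = ((1 / 2 : ℝ) : ℂ) by push_cast; rfl, ← ofReal_cpow (by positivity),
        ← ofReal_cpow hT.le, Real.inv_rpow hT.le]
      simp
    have e5 : -(Real.pi : ℂ) * I * (((k : ℕ) : ℂ) * I / (m * T)) ^ 2 / (I / T) =
        -(- Real.pi * (k : ℕ) ^ 2 / (m ^ 2 * T)) := by
      field_simp; simp
    rw [e1, e2, e3, e4, e5, Complex.exp_neg]
    field_simp [Complex.exp_ne_zero]
  · exact (Equiv.prodComm (Fin m) ℤ).summable_iff.mpr ((Int.divModEquiv m).symm.summable_iff.mpr hs)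

/-- The value of the quadratic Gauss sum `∑_{k mod m} exp(πik²/m)` for even `m`. -/
theorem sum_exp_pi_mul_sq_div {m : ℕ} [NeZero m] (hm : Even m) :
    ∑ k : Fin m, cexp (Real.pi * I * (k : ℕ) ^ 2 / m) =
      (√m : ℝ) * cexp (Real.pi * I / 4) := by
  have hm0 : (m : ℂ) ≠ 0 := NeZero.ne _
  have hmr : (0 : ℝ) < m := by exact_mod_cast Nat.pos_of_ne_zero (NeZero.ne m)
  have lim1 : Tendsto (fun T : ℝ => ∑ k : Fin m,
      cexp (Real.pi * I * (k : ℕ) ^ 2 / m) * jacobiTheta₂ ((k : ℕ) / m : ℝ) (T * I)) atTop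
      (𝓝 (∑ k : Fin m, cexp (Real.pi * I * (k : ℕ) ^ 2 / m))) := by
    refine tendsto_finsetSum _ fun k _ => ?_
    simpa using (tendsto_jacobiTheta₂_vertical ((k : ℕ) / m : ℝ) 0).const_mul
      (cexp (Real.pi * I * (k : ℕ) ^ 2 / m))
  have eq (T : ℝ) (hT : 0 < T) : ∑ k : Fin m,
      cexp (Real.pi * I * (k : ℕ) ^ 2 / m) * jacobiTheta₂ ((k : ℕ) / m : ℝ) (T * I) =
      1 / (-I * (1 / m + I / (m ^ 2 * T))) ^ (1 / 2 : ℂ) *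
        (1 / (1 / (1 + I / (m * T))) ^ (1 / 2 : ℂ)) * jacobiTheta₂ (0 : ℝ) ((-1 / m : ℝ) + T * I) := by
    have hT0 : (T : ℂ) ≠ 0 := by exact_mod_cast hT.ne'
    have hne : (m : ℂ) * T + I ≠ 0 := by
      intro h
      have := congrArg im h
      simp at this
    have hTs : (T : ℂ) ^ (1 / 2 : ℂ) ≠ 0 := by simp [cpow_eq_zero_iff, hT0]
    have h1 := jacobiTheta₂_eq_sum_residues hm hT
    rw [jacobiTheta₂_functional_equation] at h1
    have e1 : (-1 : ℂ) / (1 / m + I / (m ^ 2 * T)) + m = -1 / ((-1 / m : ℝ) + T * I) := by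
      have hne' : (m : ℂ) * T * I - 1 ≠ 0 := by
        intro h
        have := congrArg re h
        simp at this
      push_cast
      rw [show (1 : ℂ) / m + I / (m ^ 2 * T) = (m * T + I) / (m ^ 2 * T) by field_simp,
        show (-1 : ℂ) / m + T * I = (m * T * I - 1) / m by field_simp; ring]
      rw [show (m : ℂ) * T * I - 1 = I * (m * T + I) by ring_nf; simp; ring] at *
      field_simp
      ring_nf
      simp
    have hA : jacobiTheta₂ 0 (-1 / (1 / m + I / (m ^ 2 * T))) =
        (T : ℂ) ^ (1 / 2 : ℂ) * (1 / (1 / (1 + I / (m * T))) ^ (1 / 2 : ℂ)) *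
          jacobiTheta₂ (0 : ℝ) ((-1 / m : ℝ) + T * I) := by
      rw [← jacobiTheta₂_add_nat_of_even hm, e1, jacobiTheta₂_functional_equation]
      have e2 : (-1 : ℂ) / (-1 / ((-1 / m : ℝ) + T * I)) = (-1 / m : ℝ) + T * I := by
        field_simp
      have e3 : -I * (-1 / ((-1 / m : ℝ) + T * I)) = ((T⁻¹ : ℝ) : ℂ) * (1 / (1 + I / (m * T))) := by
        have : ((-1 / m : ℝ) : ℂ) + T * I = I * T * (1 + I / (m * T)) := by
          push_cast
          field_simp
          ring_nf
          simp
          ring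
        rw [this]
        push_cast
        field_simp [I_ne_zero]
      have hne2 : (1 : ℂ) / (1 + I / (m * T)) ≠ 0 := by
        rw [show (1 : ℂ) + I / (m * T) = (m * T + I) / (m * T) by field_simp]
        simp [hne, hm0, hT0]
      have e4 : (((T⁻¹ : ℝ) : ℂ) * (1 / (1 + I / (m * T)))) ^ (1 / 2 : ℂ) =
          1 / (T : ℂ) ^ (1 / 2 : ℂ) * (1 / (1 + I / (m * T))) ^ (1 / 2 : ℂ) := by
        rw [cpow_def_of_ne_zero (mul_ne_zero (by simp [hT0]) hne2), cpow_def_of_ne_zero hne2,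
          cpow_def_of_ne_zero hT0, log_ofReal_mul (by positivity) hne2, one_div (cexp _),
          ← Complex.exp_neg, ← Complex.exp_add, Real.log_inv, ofReal_neg, ← ofReal_log hT.le]
        ring_nf
      rw [e2, e3, e4]
      simp [mul_comm]
    rw [zero_div, hA] at h1
    apply mul_left_cancel₀ hTs
    rw [← h1]
    simp
    ring
  have hinv (c : ℂ) : Tendsto (fun T : ℝ => I / (c * T)) atTop (𝓝 0) := by
    have : Tendsto (fun T : ℝ => (I / c) * ((T⁻¹ : ℝ) : ℂ)) atTop (𝓝 ((I / c) * ((0 : ℝ) : ℂ))) :=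
      ((continuous_ofReal.tendsto _).comp tendsto_inv_atTop_zero).const_mul _
    simp only [ofReal_zero, mul_zero] at this
    refine this.congr fun T => ?_
    push_cast
    rw [← div_eq_mul_inv, div_div]
  have lim2 : Tendsto (fun T : ℝ => 1 / (-I * (1 / m + I / (m ^ 2 * T))) ^ (1 / 2 : ℂ) *
      (1 / (1 / (1 + I / (m * T))) ^ (1 / 2 : ℂ)) * jacobiTheta₂ (0 : ℝ) ((-1 / m : ℝ) + T * I))
      atTop (𝓝 (1 / (-I * (1 / m + 0)) ^ (1 / 2 : ℂ) * (1 / (1 / (1 + 0)) ^ (1 / 2 : ℂ)) * 1)) := by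
    have hslit : -I * ((1 : ℂ) / m + 0) ∈ slitPlane := by
      right
      have : -I * ((1 : ℂ) / m + 0) = ((-(1 / m) : ℝ) : ℂ) * I := by push_cast; ring
      rw [this]
      simpa using NeZero.ne m
    refine Tendsto.mul (Tendsto.mul ?_ ?_) (tendsto_jacobiTheta₂_vertical 0 _)
    · refine Tendsto.div tendsto_const_nhds ?_ ?_
      · exact Tendsto.cpow ((tendsto_const_nhds.add (hinv _)).const_mul _) tendsto_const_nhds hslit
      · simp [cpow_eq_zero_iff, NeZero.ne m]
    · refine Tendsto.div tendsto_const_nhds ?_ (by simp)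
      refine Tendsto.cpow (tendsto_const_nhds.div (tendsto_const_nhds.add (hinv _)) (by simp))
        tendsto_const_nhds (by simp)
  have lim3 := lim2.congr' (by
    filter_upwards [eventually_gt_atTop 0] with T hT using (eq T hT).symm)
  rw [tendsto_nhds_unique lim1 lim3]
  have hne : -I * ((1 : ℂ) / m) ≠ 0 := by simp [hm0]
  simp only [add_zero, div_one, one_cpow, mul_one]
  rw [show -I * ((1 : ℂ) / m) = (((m : ℝ)⁻¹ : ℝ) : ℂ) * (-I) by push_cast; ring,
    cpow_def_of_ne_zero (by simp [hm0]), log_ofReal_mul (by positivity) (by simp), log_neg_I,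
    one_div (cexp _), ← Complex.exp_neg, Real.sqrt_eq_rpow, ofReal_cpow hmr.le,
    cpow_def_of_ne_zero (by simp [hm0]), ← ofReal_log hmr.le, ← Complex.exp_add, Real.log_inv]
  congr 1
  push_cast
  ring

end GaussSum

section Lattice

variable {n : ℕ} {L : Set (EuclideanSpace ℝ (Fin n))}

lemma dualSet_add {x y : EuclideanSpace ℝ (Fin n)} (hx : x ∈ dualSet L) (hy : y ∈ dualSet L) :
    x + y ∈ dualSet L := by
  intro v hv
  obtain ⟨a, ha⟩ := hx v hv
  obtain ⟨b, hb⟩ := hy v hv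
  exact ⟨a + b, by rw [inner_add_left, ha, hb]; push_cast; rfl⟩

lemma dualSet_neg {x : EuclideanSpace ℝ (Fin n)} (hx : x ∈ dualSet L) : -x ∈ dualSet L := by
  intro v hv
  obtain ⟨a, ha⟩ := hx v hv
  exact ⟨-a, by rw [inner_neg_left, ha]; push_cast; rfl⟩

lemma dualSet_sub {x y : EuclideanSpace ℝ (Fin n)} (hx : x ∈ dualSet L) (hy : y ∈ dualSet L) :
    x - y ∈ dualSet L :=
  sub_eq_add_neg x y ▸ dualSet_add hx (dualSet_neg hy)

namespace IsLattice

lemma subset_dualSet (hL : IsLattice L) : L ⊆ dualSet L := fun v hv w hw => hL.2.2.2 v hv w hw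

lemma add_mem (hL : IsLattice L) {x y : EuclideanSpace ℝ (Fin n)} (hx : x ∈ L) (hy : y ∈ L) :
    x + y ∈ L := hL.1.2.1 x hx y hy

lemma neg_mem (hL : IsLattice L) {x : EuclideanSpace ℝ (Fin n)} (hx : x ∈ L) : -x ∈ L :=
  hL.1.2.2 x hx

lemma sub_mem (hL : IsLattice L) {x y : EuclideanSpace ℝ (Fin n)} (hx : x ∈ L) (hy : y ∈ L) :
    x - y ∈ L := sub_eq_add_neg x y ▸ hL.add_mem hx (hL.neg_mem hy)

/-- A lattice as an additive subgroup. -/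
def toAddSubgroup (hL : IsLattice L) : AddSubgroup (EuclideanSpace ℝ (Fin n)) where
  carrier := L
  zero_mem' := hL.1.1
  add_mem' := fun hx hy => hL.add_mem hx hy
  neg_mem' := fun hx => hL.neg_mem hx

lemma int_smul_mem (hL : IsLattice L) {x : EuclideanSpace ℝ (Fin n)} (hx : x ∈ L) (c : ℤ) :
    (c : ℝ) • x ∈ L := by
  rw [Int.cast_smul_eq_zsmul]
  exact hL.toAddSubgroup.zsmul_mem hx c

lemma sum_int_smul_mem (hL : IsLattice L) {ι : Type*} (s : Finset ι) (c : ι → ℤ)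
    {v : ι → EuclideanSpace ℝ (Fin n)} (hv : ∀ i, v i ∈ L) : ∑ i ∈ s, (c i : ℝ) • v i ∈ L :=
  hL.toAddSubgroup.sum_mem fun i _ => hL.int_smul_mem (hv i) (c i)

lemma exists_dual_basis (hL : IsLattice L) : ∃ b b' : Fin n → EuclideanSpace ℝ (Fin n),
    (∀ i, b i ∈ L) ∧ (∀ x ∈ L, ∃ c : Fin n → ℤ, x = ∑ i, (c i : ℝ) • b i) ∧
    (∀ i j, ⟪b' i, b j⟫ = if i = j then 1 else 0) ∧ ∀ x, x = ∑ i, ⟪b' i, x⟫ • b i := by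
  obtain ⟨-, ⟨b, hb, -, hspan⟩, htop, -⟩ := hL
  have hle : ⊤ ≤ Submodule.span ℝ (Set.range b) := by
    rw [← htop, Submodule.span_le]
    intro x hx
    obtain ⟨c, rfl⟩ := hspan x hx
    exact Submodule.sum_mem _ fun i _ =>
      Submodule.smul_mem _ _ (Submodule.subset_span (Set.mem_range_self i))
  let B := basisOfTopLeSpanOfCardEqFinrank b hle (by simp)
  have hB : ⇑B = b := coe_basisOfTopLeSpanOfCardEqFinrank b hle (by simp)
  have hcoord (i : Fin n) (x : EuclideanSpace ℝ (Fin n)) :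
      ⟪(InnerProductSpace.toDual ℝ _).symm (LinearMap.toContinuousLinearMap (B.coord i)), x⟫ =
        B.repr x i := by
    rw [InnerProductSpace.toDual_symm_apply]
    rfl
  refine ⟨b, fun i =>
    (InnerProductSpace.toDual ℝ _).symm (LinearMap.toContinuousLinearMap (B.coord i)), hb, hspan,
    fun i j => ?_, fun x => ?_⟩
  · rw [hcoord, ← hB, B.repr_self, Finsupp.single_apply]
    simp [eq_comm]
  · simp only [hcoord]
    rw [← hB]
    exact (B.sum_repr x).symm

/-- A lattice contains its double dual. -/
lemma mem_of_forall_dualSet (hL : IsLattice L) {x : EuclideanSpace ℝ (Fin n)}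
    (hx : ∀ y ∈ dualSet L, ∃ k : ℤ, ⟪x, y⟫ = k) : x ∈ L := by
  obtain ⟨b, b', hb, hspan, hdual, hrepr⟩ := hL.exists_dual_basis
  have hb' (i) : b' i ∈ dualSet L := by
    intro v hv
    obtain ⟨c, rfl⟩ := hspan v hv
    exact ⟨c i, by simp [inner_sum, inner_smul_right, hdual]⟩
  choose c hc using fun i => hx (b' i) (hb' i)
  rw [hrepr x]
  simp only [real_inner_comm, hc] at *
  exact hL.sum_int_smul_mem _ c hb

lemma charSet_nonempty_s10 (hL : IsLattice L) : (CharSet L).Nonempty := by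
  obtain ⟨b, b', hb, hspan, hdual, -⟩ := hL.exists_dual_basis
  choose q hq using fun i => hL.2.2.2 (b i) (hb i) (b i) (hb i)
  let ξ := ∑ i, (q i : ℝ) • b' i
  have hξb (i) : ⟪ξ, b i⟫ = q i := by simp [ξ, sum_inner, inner_smul_left, hdual]
  have hξ : ξ ∈ dualSet L := by
    intro v hv
    obtain ⟨c, rfl⟩ := hspan v hv
    exact ⟨∑ i, c i * q i, by simp [inner_sum, inner_smul_right, hξb]⟩
  let S : AddSubgroup (EuclideanSpace ℝ (Fin n)) :=
    { carrier := {v | v ∈ L ∧ ∃ k : ℤ, ⟪ξ, v⟫ - ⟪v, v⟫ = 2 * (k : ℝ)}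
      zero_mem' := ⟨hL.1.1, 0, by simp⟩
      add_mem' := by
        rintro u v ⟨hu, a, ha⟩ ⟨hv, c, hc⟩
        obtain ⟨d, hd⟩ := hL.2.2.2 u hu v hv
        refine ⟨hL.add_mem hu hv, a + c - d, ?_⟩
        rw [inner_add_right, real_inner_add_add_self, hd]
        push_cast
        linarith
      neg_mem' := by
        rintro u ⟨hu, a, ha⟩
        obtain ⟨d, hd⟩ := hL.2.2.2 u hu u hu
        refine ⟨hL.neg_mem hu, -a - d, ?_⟩
        rw [inner_neg_right, inner_neg_neg]
        push_cast
        linarith }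
  refine ⟨ξ, hξ, fun v hv => ?_⟩
  obtain ⟨c, rfl⟩ := hspan v hv
  have : ∑ i, (c i : ℝ) • b i ∈ S := S.sum_mem fun i _ => by
    rw [Int.cast_smul_eq_zsmul]
    exact S.zsmul_mem ⟨hb i, 0, by rw [hξb, hq]; simp⟩ _
  exact this.2

lemma exists_orthogonal_ne_zero (hL : IsLattice L) : ∀ k ≤ n,
    ∃ v : Fin k → EuclideanSpace ℝ (Fin n), (∀ i, v i ∈ L) ∧
      (∀ i j, i ≠ j → ⟪v i, v j⟫ = 0) ∧ ∀ i, v i ≠ 0 := by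
  intro k
  induction k with
  | zero => exact fun _ => ⟨Fin.elim0, fun i => i.elim0, fun i => i.elim0, fun i => i.elim0⟩
  | succ k ih =>
    intro hk
    obtain ⟨v, hv, horth, hne⟩ := ih (by omega)
    obtain ⟨x, hx, hxs⟩ : ∃ x ∈ L, x ∉ Submodule.span ℝ (Set.range v) := by
      by_contra! h
      have htop : Submodule.span ℝ (Set.range v) = ⊤ := by
        rw [eq_top_iff, ← hL.2.2.1, Submodule.span_le]
        exact h
      have := finrank_range_le_card (R := ℝ) v
      rw [Set.finrank, htop] at this
      simp at this
      omega
    choose q hq using fun i => hL.2.2.2 (v i) (hv i) (v i) (hv i)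
    choose r hr using fun i => hL.2.2.2 x hx (v i) (hv i)
    have hq0 (i) : (q i : ℝ) ≠ 0 := by
      rw [← hq]
      exact inner_self_ne_zero.mpr (hne i)
    let y := ((∏ i, q i : ℤ) : ℝ) • x -
      ∑ i, (((∏ j ∈ Finset.univ.erase i, q j) * r i : ℤ) : ℝ) • v i
    have hyv (j) : ⟪y, v j⟫ = 0 := by
      have (i) (_ : i ∈ Finset.univ) (hij : i ≠ j) :
          ((((∏ j ∈ Finset.univ.erase i, q j) * r i : ℤ) : ℝ) * ⟪v i, v j⟫) = 0 := by
        rw [horth i j hij, mul_zero]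
      simp only [y, inner_sub_left, sum_inner, real_inner_smul_left]
      rw [Finset.sum_eq_single j this (by simp), hr, hq,
        ← Finset.mul_prod_erase _ _ (Finset.mem_univ j)]
      push_cast
      ring
    have hy0 : y ≠ 0 := by
      intro h
      apply hxs
      rw [sub_eq_zero] at h
      have hP : ((∏ i, q i : ℤ) : ℝ) ≠ 0 := by
        push_cast
        exact Finset.prod_ne_zero_iff.mpr fun i _ => hq0 i
      rw [← Submodule.smul_mem_iff _ hP, h]
      exact Submodule.sum_mem _ fun i _ =>
        Submodule.smul_mem _ _ (Submodule.subset_span (Set.mem_range_self i))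
    refine ⟨Fin.cons y v, ?_, ?_, ?_⟩
    · refine Fin.cases ?_ hv
      exact hL.sub_mem (hL.int_smul_mem hx _) (hL.sum_int_smul_mem _ _ hv)
    · intro i j
      refine Fin.cases ?_ (fun i => ?_) i <;> refine Fin.cases ?_ (fun j => ?_) j
      · simp
      · intro _
        simpa using hyv j
      · intro _
        simpa [real_inner_comm] using hyv i
      · intro hij
        simpa using horth i j (by simpa using hij)
    · exact Fin.cases hy0 hne

/-- A lattice contains an orthogonal system of full rank consisting of vectors of even norm. -/
lemma exists_orthogonal_even (hL : IsLattice L) :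
    ∃ (v : Fin n → EuclideanSpace ℝ (Fin n)) (m : Fin n → ℕ), (∀ i, v i ∈ L) ∧
      (∀ i j, ⟪v i, v j⟫ = if i = j then (m i : ℝ) else 0) ∧ ∀ i, m i ≠ 0 ∧ Even (m i) := by
  obtain ⟨v, hv, horth, hne⟩ := hL.exists_orthogonal_ne_zero n le_rfl
  choose q hq using fun i => hL.2.2.2 (v i) (hv i) (v i) (hv i)
  have hq0 (i) : 0 < q i := by
    have := real_inner_self_pos.mpr (hne i)
    rw [hq] at this
    exact_mod_cast this
  refine ⟨fun i => v i + v i, fun i => 4 * (q i).toNat, fun i => hL.add_mem (hv i) (hv i),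
    fun i j => ?_, fun i => ⟨?_, by simp [Nat.even_mul]; left; decide⟩⟩
  · have hc : (((q i).toNat : ℕ) : ℝ) = q i := by
      exact_mod_cast congrArg (Int.cast : ℤ → ℝ) (Int.toNat_of_nonneg (hq0 i).le)
    simp only [inner_add_left, inner_add_right]
    split_ifs with h
    · subst h
      push_cast
      rw [hq, hc]
      ring
    · simp [horth i j h]
  · have := hq0 i
    change 4 * (q i).toNat ≠ 0
    omega

end IsLattice

namespace IsBimodular

lemma sub_mem_of_notMem (hL : IsBimodular L) {x y : EuclideanSpace ℝ (Fin n)}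
    (hx : x ∈ dualSet L) (hx' : x ∉ L) (hy : y ∈ dualSet L) (hy' : y ∉ L) : x - y ∈ L := by
  obtain ⟨hL, w, -, h⟩ := hL
  have := hL.sub_mem ((h x hx).resolve_left hx') ((h y hy).resolve_left hy')
  simpa using this

lemma inner_self_of_notMem (hL : IsBimodular L) {u : EuclideanSpace ℝ (Fin n)}
    (hu : u ∈ dualSet L) (hu' : u ∉ L) : ∃ k : ℤ, ⟪u, u⟫ = k + 1 / 2 := by
  have h2 : u + u ∈ L := by
    simpa using hL.sub_mem_of_notMem hu hu' (dualSet_neg hu)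
      (fun h => hu' (by simpa using hL.1.neg_mem h))
  obtain ⟨k, hk⟩ := hu _ h2
  rw [inner_add_right] at hk
  obtain ⟨j, rfl⟩ | ⟨j, rfl⟩ := k.even_or_odd
  · refine absurd (hL.1.mem_of_forall_dualSet fun y hy => ?_) hu'
    by_cases hyL : y ∈ L
    · exact hu y hyL
    · obtain ⟨i, hi⟩ := hu _ (hL.sub_mem_of_notMem hy hyL hu hu')
      rw [inner_sub_right] at hi
      refine ⟨i + j, ?_⟩
      push_cast at hk ⊢
      linarith
  · refine ⟨j, ?_⟩
    push_cast at hk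
    linarith

lemma charSet_inner_dual (hL : IsBimodular L) {ξ u : EuclideanSpace ℝ (Fin n)}
    (hξ : ξ ∈ CharSet L) (hu : u ∈ dualSet L) : ∃ k : ℤ, ⟪ξ, u⟫ = k := by
  by_cases hu' : u ∈ L
  · exact hξ.1 u hu'
  have h2 : u + u ∈ L := by
    simpa using hL.sub_mem_of_notMem hu hu' (dualSet_neg hu)
      (fun h => hu' (by simpa using hL.1.neg_mem h))
  obtain ⟨k, hk⟩ := hL.inner_self_of_notMem hu hu'
  obtain ⟨j, hj⟩ := hξ.2 _ h2
  simp only [inner_add_right, inner_add_left] at hj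
  exact ⟨2 * k + 1 + j, by push_cast; linarith⟩

lemma charSet_subset (hL : IsBimodular L) : CharSet L ⊆ L := fun _ hξ =>
  hL.1.mem_of_forall_dualSet fun _ hy => hL.charSet_inner_dual hξ hy

end IsBimodular

lemma exists_eq_add_two_smul {ξ η : EuclideanSpace ℝ (Fin n)}
    (hξ : ξ ∈ CharSet L) (hη : η ∈ CharSet L) : ∃ u ∈ dualSet L, ξ = η + (2 : ℝ) • u := by
  refine ⟨(1 / 2 : ℝ) • (ξ - η), fun v hv => ?_, by rw [smul_smul]; norm_num⟩
  obtain ⟨a, ha⟩ := hξ.2 v hv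
  obtain ⟨b, hb⟩ := hη.2 v hv
  refine ⟨a - b, ?_⟩
  rw [real_inner_smul_left, inner_sub_left]
  push_cast
  linarith

lemma add_two_smul_mem_charSet {η u : EuclideanSpace ℝ (Fin n)}
    (hη : η ∈ CharSet L) (hu : u ∈ dualSet L) : η + (2 : ℝ) • u ∈ CharSet L := by
  refine ⟨?_, fun v hv => ?_⟩
  · rw [two_smul]
    exact dualSet_add hη.1 (dualSet_add hu hu)
  · obtain ⟨a, ha⟩ := hη.2 v hv
    obtain ⟨b, hb⟩ := hu v hv
    refine ⟨a + b, ?_⟩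
    rw [inner_add_left, real_inner_smul_left]
    push_cast
    linarith

lemma inner_self_add_two_smul (η u : EuclideanSpace ℝ (Fin n)) :
    ⟪η + (2 : ℝ) • u, η + (2 : ℝ) • u⟫ = ⟪η, η⟫ + 4 * ⟪η, u⟫ + 4 * ⟪u, u⟫ := by
  rw [real_inner_add_add_self, real_inner_smul_left, real_inner_smul_right,
    real_inner_smul_right]
  ring

lemma inner_self_add_two_smul_of_mem {η u : EuclideanSpace ℝ (Fin n)} (hL : IsLattice L)
    (hη : η ∈ CharSet L) (hu : u ∈ L) :
    ∃ k : ℤ, ⟪η + (2 : ℝ) • u, η + (2 : ℝ) • u⟫ = ⟪η, η⟫ + 8 * k := by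
  obtain ⟨a, ha⟩ := hη.2 u hu
  obtain ⟨b, hb⟩ := hL.2.2.2 u hu u hu
  refine ⟨a + b, ?_⟩
  rw [inner_self_add_two_smul]
  push_cast
  linarith

lemma IsBimodular.inner_self_add_two_smul_of_notMem {η u : EuclideanSpace ℝ (Fin n)}
    (hL : IsBimodular L) (hη : η ∈ CharSet L) (hu : u ∈ dualSet L) (hu' : u ∉ L) :
    ∃ k : ℤ, ⟪η + (2 : ℝ) • u, η + (2 : ℝ) • u⟫ = ⟪η, η⟫ + 4 * k + 2 := by
  obtain ⟨a, ha⟩ := hL.charSet_inner_dual hη hu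
  obtain ⟨b, hb⟩ := hL.inner_self_of_notMem hu hu'
  refine ⟨a + b, ?_⟩
  rw [inner_self_add_two_smul]
  push_cast
  linarith

end Lattice

section VanDerBlij

open Complex

/-- `exp(πi⟪x, x⟫)`. -/
def expNorm {n : ℕ} (x : EuclideanSpace ℝ (Fin n)) : ℂ := cexp (Real.pi * I * (⟪x, x⟫ : ℝ))

lemma cexp_pi_mul_eq_of_sub_even {a b : ℝ} (h : ∃ k : ℤ, a - b = 2 * k) :
    cexp (Real.pi * I * a) = cexp (Real.pi * I * b) := by
  obtain ⟨k, hk⟩ := h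
  rw [Complex.exp_eq_exp_iff_exists_int]
  refine ⟨k, ?_⟩
  rw [show a = b + 2 * k by linarith]
  push_cast
  ring

lemma expNorm_add {n : ℕ} {x z : EuclideanSpace ℝ (Fin n)} (h : ∃ k : ℤ, ⟪x, z⟫ = k)
    (hz : ∃ k : ℤ, ⟪z, z⟫ = 2 * (k : ℝ)) : expNorm (x + z) = expNorm x := by
  obtain ⟨a, ha⟩ := h
  obtain ⟨b, hb⟩ := hz
  refine cexp_pi_mul_eq_of_sub_even ⟨a + b, ?_⟩
  rw [real_inner_add_add_self, ha, hb]
  push_cast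
  ring

lemma one_add_cexp_half_int (j : ℤ) : ∃ s : ℤ, (s = 1 ∨ s = -1) ∧
    1 + cexp (Real.pi * I * ((j + 1 / 2 : ℝ) : ℂ)) = (√2 : ℝ) * cexp (Real.pi * I * s / 4) := by
  have hs : ((√2 : ℝ) : ℂ) * (√2 : ℝ) = 2 := by
    rw [← ofReal_mul, Real.mul_self_sqrt (by norm_num)]
    norm_num
  obtain ⟨k, hk⟩ | ⟨k, hk⟩ := j.even_or_odd
  · refine ⟨1, Or.inl rfl, ?_⟩
    rw [cexp_pi_mul_eq_of_sub_even (b := 1 / 2) ⟨k, by rw [hk]; push_cast; ring⟩,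
      show (Real.pi * I * ((1 / 2 : ℝ) : ℂ)) = ((Real.pi / 2 : ℝ) : ℂ) * I by push_cast; ring,
      show (Real.pi * I * ((1 : ℤ) : ℂ) / 4) = ((Real.pi / 4 : ℝ) : ℂ) * I by push_cast; ring,
      exp_mul_I, exp_mul_I, ← ofReal_cos, ← ofReal_sin, ← ofReal_cos, ← ofReal_sin]
    simp only [Real.cos_pi_div_two, Real.sin_pi_div_two, Real.cos_pi_div_four,
      Real.sin_pi_div_four]
    push_cast
    linear_combination (-(1 + I) / 2) * hs
  · refine ⟨-1, Or.inr rfl, ?_⟩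
    rw [cexp_pi_mul_eq_of_sub_even (b := -(1 / 2)) ⟨k + 1, by rw [hk]; push_cast; ring⟩,
      show (Real.pi * I * ((-(1 / 2) : ℝ) : ℂ)) = ((-(Real.pi / 2) : ℝ) : ℂ) * I by
        push_cast; ring,
      show (Real.pi * I * ((-1 : ℤ) : ℂ) / 4) = ((-(Real.pi / 4) : ℝ) : ℂ) * I by push_cast; ring,
      exp_mul_I, exp_mul_I, ← ofReal_cos, ← ofReal_sin, ← ofReal_cos, ← ofReal_sin]
    simp only [Real.cos_neg, Real.sin_neg, Real.cos_pi_div_two, Real.sin_pi_div_two,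
      Real.cos_pi_div_four, Real.sin_pi_div_four]
    push_cast
    linear_combination (-(1 - I) / 2) * hs

/-- If shifting `f` by elements of a finite set `H` multiplies it by a character, then only the
points where the character is trivial on `H` contribute to the sum of `f`. -/
lemma sum_eq_sum_filter_of_shift {A : Type*} [AddCommGroup A] [Fintype A] (H : Finset A)
    (h0 : (0 : A) ∈ H) (hadd : ∀ h k, k ∈ H → (h + k ∈ H ↔ h ∈ H)) (f : A → ℂ) (χ : A → A → ℂ)
    (hf : ∀ x, ∀ h ∈ H, f (x + h) = f x * χ x h)
    (hχ : ∀ x, ∀ h ∈ H, ∀ k ∈ H, χ x (h + k) = χ x h * χ x k)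
    (P : A → Prop) [DecidablePred P] (hP : ∀ x, P x → ∀ h ∈ H, χ x h = 1)
    (hP' : ∀ x, ¬ P x → ∃ h ∈ H, χ x h ≠ 1) :
    ∑ x, f x = ∑ x with P x, f x := by
  classical
  have hsum (x : A) : ∑ h ∈ H, χ x h = if P x then (H.card : ℂ) else 0 := by
    split_ifs with h
    · rw [Finset.sum_congr rfl fun k hk => hP x h k hk]
      simp
    · obtain ⟨k, hk, hk1⟩ := hP' x h
      have : ∑ h ∈ H, χ x (h + k) = ∑ h ∈ H, χ x h :=
        Finset.sum_equiv (Equiv.addRight k) (fun h => by simp [hadd h k hk]) (fun h _ => rfl)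
      rw [Finset.sum_congr rfl fun h hh => hχ x h hh k hk, ← Finset.sum_mul] at this
      have h2 : (∑ h ∈ H, χ x h) * (χ x k - 1) = 0 := by linear_combination this
      exact (mul_eq_zero.mp h2).resolve_right (sub_ne_zero.mpr hk1)
  have hc : (H.card : ℂ) ≠ 0 := by exact_mod_cast (Finset.card_pos.mpr ⟨0, h0⟩).ne'
  apply mul_left_cancel₀ hc
  calc (H.card : ℂ) * ∑ x, f x = ∑ h ∈ H, ∑ x, f (x + h) := by
        have (h : A) : ∑ x, f (x + h) = ∑ x, f x :=
          Fintype.sum_equiv (Equiv.addRight h) _ _ fun _ => rfl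
        simp [this]
    _ = ∑ x, f x * ∑ h ∈ H, χ x h := by
        rw [Finset.sum_comm]
        refine Finset.sum_congr rfl fun x _ => ?_
        rw [Finset.mul_sum]
        exact Finset.sum_congr rfl fun h hh => hf x h hh
    _ = (H.card : ℂ) * ∑ x with P x, f x := by
        simp only [hsum, Finset.sum_filter, Finset.mul_sum]
        refine Finset.sum_congr rfl fun x _ => ?_
        split_ifs <;> ring

section Orthogonal

variable {n : ℕ} {L : Set (EuclideanSpace ℝ (Fin n))} (v : Fin n → EuclideanSpace ℝ (Fin n))
  (m : Fin n → ℕ)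

/-- Representatives, modulo the lattice spanned by the orthogonal system `v`, of its dual. -/
def dualRep (x : (i : Fin n) → Fin (m i)) : EuclideanSpace ℝ (Fin n) :=
  ∑ i, (((x i : ℕ) : ℝ) / m i) • v i

variable {v m}

lemma inner_dualRep (hvm : ∀ i j, ⟪v i, v j⟫ = if i = j then (m i : ℝ) else 0) (hm : ∀ i, m i ≠ 0)
    (x : (i : Fin n) → Fin (m i)) (j : Fin n) : ⟪dualRep v m x, v j⟫ = (x j : ℕ) := by
  have : (m j : ℝ) ≠ 0 := by exact_mod_cast hm j
  simp [dualRep, sum_inner, real_inner_smul_left, hvm, this]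

lemma inner_sum_smul (v : Fin n → EuclideanSpace ℝ (Fin n)) (l : Fin n → ℝ)
    (y : EuclideanSpace ℝ (Fin n)) :
    ⟪y, ∑ i, l i • v i⟫ = ∑ i, l i * ⟪y, v i⟫ := by
  simp [inner_sum, real_inner_smul_right]

lemma eq_sum_orthogonal (hvm : ∀ i j, ⟪v i, v j⟫ = if i = j then (m i : ℝ) else 0)
    (hm : ∀ i, m i ≠ 0) (y : EuclideanSpace ℝ (Fin n)) : y = ∑ i, (⟪y, v i⟫ / m i) • v i := by
  have hli : LinearIndependent ℝ v := by
    refine linearIndependent_of_ne_zero_of_inner_eq_zero (𝕜 := ℝ) (fun i h => hm i ?_)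
      fun i j hij => (hvm i j).trans (if_neg hij)
    have := hvm i i
    rw [h] at this
    simpa using this.symm
  have htop : Submodule.span ℝ (Set.range v) = ⊤ := hli.span_eq_top_of_card_eq_finrank' (by simp)
  rw [← sub_eq_zero, ← inner_self_eq_zero (𝕜 := ℝ)]
  set d := y - ∑ i, (⟪y, v i⟫ / m i) • v i with hd
  have hdv (j) : ⟪d, v j⟫ = 0 := by
    have : (m j : ℝ) ≠ 0 := by exact_mod_cast hm j
    simp [hd, inner_sub_left, sum_inner, real_inner_smul_left, hvm, this]
  have (z) (hz : z ∈ Submodule.span ℝ (Set.range v)) : ⟪d, z⟫ = 0 := by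
    induction hz using Submodule.span_induction with
    | mem x hx => obtain ⟨i, rfl⟩ := hx; exact hdv i
    | zero => simp
    | add x y _ _ hx hy => rw [inner_add_right, hx, hy, add_zero]
    | smul a x _ hx => rw [real_inner_smul_right, hx, mul_zero]
  exact this d (htop ▸ Submodule.mem_top)

lemma exists_dualRep (hvm : ∀ i j, ⟪v i, v j⟫ = if i = j then (m i : ℝ) else 0)
    (hm : ∀ i, m i ≠ 0) {y : EuclideanSpace ℝ (Fin n)} (hy : ∀ i, ∃ k : ℤ, ⟪y, v i⟫ = k) :
    ∃ (x : (i : Fin n) → Fin (m i)) (l : Fin n → ℤ),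
      dualRep v m x = y + ∑ i, (l i : ℝ) • v i := by
  choose c hc using hy
  have hpos (i) : (0 : ℤ) < m i := by have := hm i; omega
  refine ⟨fun i => ⟨(c i % m i).toNat, ?_⟩, fun i => -(c i / m i), ?_⟩
  · have := Int.emod_nonneg (c i) (hpos i).ne'
    have := Int.emod_lt_of_pos (c i) (hpos i)
    omega
  · conv_rhs => rw [eq_sum_orthogonal hvm hm y]
    rw [dualRep, ← Finset.sum_add_distrib]
    refine Finset.sum_congr rfl fun i _ => ?_
    rw [← add_smul, hc]
    congr 1
    have h1 : (((c i % m i).toNat : ℕ) : ℝ) = ((c i % m i : ℤ) : ℝ) := by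
      exact_mod_cast congrArg (Int.cast : ℤ → ℝ)
        (Int.toNat_of_nonneg (Int.emod_nonneg (c i) (hpos i).ne'))
    have h2 : ((c i % m i : ℤ) : ℝ) + m i * ((c i / m i : ℤ) : ℝ) = c i := by
      exact_mod_cast Int.emod_add_mul_ediv (c i) (m i)
    have h3 : (m i : ℝ) ≠ 0 := by exact_mod_cast hm i
    simp only [h1]
    field_simp
    push_cast
    linarith

lemma dualRep_add [∀ i, NeZero (m i)] (x y : (i : Fin n) → Fin (m i)) :
    ∃ l : Fin n → ℤ, dualRep v m (x + y) =
      dualRep v m x + dualRep v m y + ∑ i, (l i : ℝ) • v i := by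
  refine ⟨fun i => -((((x i : ℕ) + y i) / m i : ℕ) : ℤ), ?_⟩
  simp only [dualRep, ← Finset.sum_add_distrib, ← add_smul]
  refine Finset.sum_congr rfl fun i _ => ?_
  congr 1
  have h2 : ((((x i : ℕ) + y i) % m i : ℕ) : ℝ) + m i * ((((x i : ℕ) + y i) / m i : ℕ) : ℝ) =
      (x i : ℕ) + (y i : ℕ) := by
    exact_mod_cast Nat.mod_add_div ((x i : ℕ) + y i) (m i)
  have h3 : (m i : ℝ) ≠ 0 := by exact_mod_cast NeZero.ne (m i)
  rw [Pi.add_apply, Fin.val_add, Int.cast_neg, Int.cast_natCast]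
  field_simp
  linarith

lemma sum_expNorm_dualRep [∀ i, NeZero (m i)]
    (hvm : ∀ i j, ⟪v i, v j⟫ = if i = j then (m i : ℝ) else 0) (hm : ∀ i, Even (m i)) :
    ∑ x, expNorm (dualRep v m x) =
      ((∏ i, √(m i) : ℝ) : ℂ) * cexp (Real.pi * I * n / 4) := by
  have hterm (x : (i : Fin n) → Fin (m i)) :
      expNorm (dualRep v m x) = ∏ i, cexp (Real.pi * I * (x i : ℕ) ^ 2 / m i) := by
    rw [expNorm, ← Complex.exp_sum]
    congr 1
    have hself : ⟪dualRep v m x, dualRep v m x⟫ =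
        ∑ i, ((x i : ℕ) / m i : ℝ) * ⟪dualRep v m x, v i⟫ :=
      inner_sum_smul v _ _
    rw [hself]
    simp only [inner_dualRep hvm fun i => NeZero.ne (m i)]
    push_cast
    rw [Finset.mul_sum]
    exact Finset.sum_congr rfl fun i _ => by ring
  simp only [hterm]
  have := Finset.prod_univ_sum (fun i => (Finset.univ : Finset (Fin (m i))))
    (fun i (k : Fin (m i)) => cexp (Real.pi * I * (k : ℕ) ^ 2 / m i))
  rw [Fintype.piFinset_univ] at this
  rw [← this, Finset.prod_congr rfl fun i _ => sum_exp_pi_mul_sq_div (hm i),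
    Finset.prod_mul_distrib]
  push_cast
  congr 1
  rw [Finset.prod_const, Finset.card_univ, Fintype.card_fin, ← Complex.exp_nat_mul]
  congr 1
  ring

end Orthogonal

/-- The van der Blij congruence for bimodular lattices. -/
theorem IsBimodular.inner_self_charSet {n : ℕ} {L : Set (EuclideanSpace ℝ (Fin n))}
    (hL : IsBimodular L) {ξ : EuclideanSpace ℝ (Fin n)} (hξ : ξ ∈ CharSet L) :
    ∃ s : ℤ, (s = 1 ∨ s = -1) ∧ ∃ k : ℤ, ⟪ξ, ξ⟫ = (n : ℝ) + (s : ℝ) + 8 * (k : ℝ) := by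
  classical
  obtain ⟨v, m, hv, hvm, hm⟩ := hL.1.exists_orthogonal_even
  have : ∀ i, NeZero (m i) := fun i => ⟨(hm i).1⟩
  obtain ⟨w, ⟨hw, hw'⟩, -⟩ := hL.2
  let φ := dualRep v m
  let M : (Fin n → ℤ) → EuclideanSpace ℝ (Fin n) := fun l => ∑ i, (l i : ℝ) • v i
  have hML (l) : M l ∈ L := hL.1.sum_int_smul_mem _ l hv
  have hM {y : EuclideanSpace ℝ (Fin n)} (hy : ∀ i, ∃ k : ℤ, ⟪y, v i⟫ = k) (l) :
      ∃ k : ℤ, ⟪y, M l⟫ = k := by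
    choose c hc using hy
    refine ⟨∑ i, l i * c i, ?_⟩
    rw [inner_sum_smul]
    push_cast
    simp only [hc]
  have hφv (x i) : ⟪φ x, v i⟫ = ((x i : ℕ) : ℤ) := inner_dualRep hvm (fun i => (hm i).1) x i
  have hφM (x l) : ∃ k : ℤ, ⟪φ x, M l⟫ = k := hM (fun i => ⟨_, hφv x i⟩) l
  have hMM (l) : ∃ k : ℤ, ⟪M l, M l⟫ = 2 * (k : ℝ) := by
    choose r hr using fun i => (hm i).2
    refine ⟨∑ i, l i * (l i * r i), ?_⟩
    have hMv (i) : ⟪M l, v i⟫ = l i * m i := by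
      simp [M, sum_inner, real_inner_smul_left, hvm]
    rw [inner_sum_smul]
    simp only [hMv]
    push_cast
    rw [Finset.mul_sum]
    refine Finset.sum_congr rfl fun i _ => ?_
    rw [show (m i : ℝ) = r i + r i by exact_mod_cast hr i]
    ring
  let u : ((i : Fin n) → Fin (m i)) → EuclideanSpace ℝ (Fin n) := fun x => φ x - (1 / 2 : ℝ) • ξ
  have huM (x l) : ∃ k : ℤ, ⟪u x, M l⟫ = k := by
    obtain ⟨a, ha⟩ := hφM x l
    obtain ⟨b, hb⟩ := hMM l
    obtain ⟨c, hc⟩ := hξ.2 _ (hML l)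
    refine ⟨a - b - c, ?_⟩
    rw [inner_sub_left, real_inner_smul_left]
    push_cast
    linarith
  have hrep {y : EuclideanSpace ℝ (Fin n)} (hy : y ∈ dualSet L) : ∃ x l, φ x = y + M l :=
    exists_dualRep hvm (fun i => (hm i).1) fun i => hy _ (hv i)
  have hadd (x y) : ∃ l, φ (x + y) = φ x + φ y + M l := dualRep_add x y
  have hφ0 : φ 0 = 0 := by simp [φ, dualRep]
  let H : Finset ((i : Fin n) → Fin (m i)) := {h | φ h ∈ L}
  have hHmem (h) : h ∈ H ↔ φ h ∈ L := by simp [H]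
  have hsum := sum_eq_sum_filter_of_shift H (by rw [hHmem, hφ0]; exact hL.1.1.1) ?_
    (fun x => expNorm (φ x)) (fun x h => cexp (2 * Real.pi * I * (⟪u x, φ h⟫ : ℝ))) ?_ ?_
    (fun x => u x ∈ dualSet L) ?_ ?_
  rotate_left
  · intro h k hk
    rw [hHmem] at hk
    rw [hHmem, hHmem]
    obtain ⟨l, hl⟩ := hadd h k
    rw [hl]
    refine ⟨fun h1 => ?_, fun h1 => hL.1.add_mem (hL.1.add_mem h1 hk) (hML l)⟩
    convert hL.1.sub_mem (hL.1.sub_mem h1 (hML l)) hk using 1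
    abel
  · intro x h hh
    rw [hHmem] at hh
    obtain ⟨l, hl⟩ := hadd x h
    obtain ⟨a, ha⟩ := hξ.2 _ hh
    rw [hl, expNorm_add]
    · rw [expNorm, expNorm, ← Complex.exp_add,
        show (Real.pi : ℂ) * I * (⟪φ x, φ x⟫ : ℝ) + 2 * Real.pi * I * (⟪u x, φ h⟫ : ℝ) =
          Real.pi * I * ((⟪φ x, φ x⟫ + 2 * ⟪u x, φ h⟫ : ℝ) : ℂ) by push_cast; ring]
      obtain ⟨b, hb⟩ := hL.1.2.2.2 _ hh _ hh
      refine cexp_pi_mul_eq_of_sub_even ⟨b + a, ?_⟩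
      rw [real_inner_add_add_self, inner_sub_left, real_inner_smul_left]
      push_cast
      linarith
    · obtain ⟨b, hb⟩ := hφM x l
      obtain ⟨c, hc⟩ := hφM h l
      exact ⟨b + c, by rw [inner_add_left, hb, hc]; push_cast; rfl⟩
    · exact hMM l
  · intro x h _ k _
    obtain ⟨l, hl⟩ := hadd h k
    obtain ⟨a, ha⟩ := huM x l
    rw [← Complex.exp_add, Complex.exp_eq_exp_iff_exists_int]
    refine ⟨a, ?_⟩
    rw [hl, inner_add_right, inner_add_right, ha]
    push_cast
    ring
  · intro x hx h hh
    rw [hHmem] at hh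
    obtain ⟨a, ha⟩ := hx _ hh
    rw [ha, Complex.exp_eq_one_iff]
    exact ⟨a, by push_cast; ring⟩
  · intro x hx
    obtain ⟨l, hl, hne⟩ : ∃ l ∈ L, ∀ k : ℤ, ⟪u x, l⟫ ≠ k := by
      by_contra! h
      exact hx h
    obtain ⟨h, c, hc⟩ := hrep (hL.1.subset_dualSet hl)
    refine ⟨h, by rw [hHmem, hc]; exact hL.1.add_mem hl (hML c), fun h1 => ?_⟩
    obtain ⟨a, ha⟩ := huM x c
    rw [Complex.exp_eq_one_iff] at h1
    obtain ⟨b, hb⟩ := h1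
    rw [hc, inner_add_right, ha] at hb
    apply hne (b - a)
    have hb' : (Real.pi * I * 2) * ((⟪u x, l⟫ + a - b : ℝ) : ℂ) = 0 := by
      push_cast at hb ⊢
      linear_combination hb
    have h0 := (mul_eq_zero.mp hb').resolve_left (by simp [Real.pi_ne_zero])
    have h0 : ⟪u x, l⟫ + a - b = 0 := by exact_mod_cast h0
    push_cast
    linarith
  obtain ⟨p, hp⟩ := hL.inner_self_of_notMem hw hw'
  obtain ⟨q, hq⟩ := hL.charSet_inner_dual hξ hw
  let ω := cexp (Real.pi * I * ((⟪ξ, ξ⟫ / 4 : ℝ) : ℂ))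
  let ζ := cexp (Real.pi * I * (((p + q : ℤ) + 1 / 2 : ℝ) : ℂ))
  have hnorm (x) : ⟪φ x, φ x⟫ = ⟪ξ, ξ⟫ / 4 + (⟪ξ, u x⟫ + ⟪u x, u x⟫) := by
    rw [show φ x = (1 / 2 : ℝ) • ξ + u x by simp [u], real_inner_add_add_self,
      real_inner_smul_left, real_inner_smul_left, real_inner_smul_right]
    ring
  have hval0 (x) (hx : u x ∈ L) : expNorm (φ x) = ω := by
    obtain ⟨a, ha⟩ := hξ.2 _ hx
    obtain ⟨b, hb⟩ := hL.1.2.2.2 _ hx _ hx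
    refine cexp_pi_mul_eq_of_sub_even ⟨a + b, ?_⟩
    rw [hnorm]
    push_cast
    linarith
  have hval1 (x) (hx : u x ∈ dualSet L) (hx' : u x ∉ L) : expNorm (φ x) = ω * ζ := by
    have hd := hL.sub_mem_of_notMem hx hx' hw hw'
    obtain ⟨a, ha⟩ := hξ.2 _ hd
    obtain ⟨b, hb⟩ := hL.1.2.2.2 _ hd _ hd
    obtain ⟨c, hc⟩ := hw _ hd
    simp only [ω, ζ]
    rw [← Complex.exp_add, ← mul_add, ← ofReal_add, expNorm]
    refine cexp_pi_mul_eq_of_sub_even ⟨a + b + c, ?_⟩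
    rw [hnorm]
    simp only [inner_sub_left, inner_sub_right, real_inner_comm w (u x)] at ha hb hc
    push_cast
    linarith
  obtain ⟨h, l, hl⟩ := hrep hw
  have hcard : ({x | u x ∈ L} : Finset ((i : Fin n) → Fin (m i))).card =
      ({x | u x ∈ dualSet L ∧ u x ∉ L} : Finset ((i : Fin n) → Fin (m i))).card := by
    refine Finset.card_equiv (Equiv.addRight h) fun x => ?_
    obtain ⟨c, hc⟩ := hadd x h
    have hu : u (x + h) = u x + (w + (M l + M c)) := by
      simp only [u, hc, hl]
      abel
    have hz : M l + M c ∈ L := hL.1.add_mem (hML l) (hML c)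
    have hw1 : w + (M l + M c) ∈ dualSet L := dualSet_add hw (hL.1.subset_dualSet hz)
    have hw2 : w + (M l + M c) ∉ L := fun h1 => hw' (by simpa using hL.1.sub_mem h1 hz)
    simp only [Finset.mem_filter, Finset.mem_univ, true_and, Equiv.coe_addRight, hu]
    refine ⟨fun hx => ⟨dualSet_add (hL.1.subset_dualSet hx) hw1, fun h1 => hw2 ?_⟩,
      fun ⟨h1, h2⟩ => ?_⟩
    · simpa using hL.1.sub_mem h1 hx
    · simpa using hL.sub_mem_of_notMem h1 h2 hw1 hw2
  set N := ({x | u x ∈ L} : Finset ((i : Fin n) → Fin (m i))).card with hN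
  have hS : ∑ x with u x ∈ dualSet L, expNorm (φ x) = N * (ω * (1 + ζ)) := by
    rw [← Finset.sum_filter_add_sum_filter_not _ (fun x => u x ∈ L), Finset.filter_filter,
      Finset.filter_filter, Finset.sum_congr rfl (g := fun _ => ω),
      Finset.sum_congr (s₁ := Finset.filter (fun x => u x ∈ dualSet L ∧ u x ∉ L) _) rfl
        (g := fun _ => ω * ζ)]
    · rw [Finset.sum_const, Finset.sum_const, ← hcard, nsmul_eq_mul, nsmul_eq_mul,
        show ({x | u x ∈ dualSet L ∧ u x ∈ L} : Finset ((i : Fin n) → Fin (m i))) =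
          ({x | u x ∈ L} : Finset ((i : Fin n) → Fin (m i))) from
          Finset.filter_congr fun x _ => ⟨fun h => h.2, fun h => ⟨hL.1.subset_dualSet h, h⟩⟩]
      ring
    · intro x hx
      simp only [Finset.mem_filter, Finset.mem_univ, true_and] at hx
      exact hval1 x hx.1 hx.2
    · intro x hx
      simp only [Finset.mem_filter, Finset.mem_univ, true_and] at hx
      exact hval0 x hx.2
  obtain ⟨s, hs, hζ⟩ := one_add_cexp_half_int (p + q)
  have hfin := (sum_expNorm_dualRep hvm fun i => (hm i).2).symm.trans (hsum.trans hS)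
  rw [show 1 + ζ = _ from hζ] at hfin
  have hnexp (t : ℝ) : ‖cexp (Real.pi * I * t)‖ = 1 := by
    rw [show (Real.pi : ℂ) * I * t = ((Real.pi * t : ℝ) : ℂ) * I by push_cast; ring,
      norm_exp_ofReal_mul_I]
  have e1 : (Real.pi : ℂ) * I * n / 4 = Real.pi * I * ((n / 4 : ℝ) : ℂ) := by push_cast; ring
  have e2 : (Real.pi : ℂ) * I * s / 4 = Real.pi * I * ((s / 4 : ℝ) : ℂ) := by push_cast; ring
  have hR : 0 < ∏ i, √(m i) := Finset.prod_pos fun i _ =>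
    Real.sqrt_pos.mpr (by exact_mod_cast Nat.pos_of_ne_zero (hm i).1)
  rw [e1, e2] at hfin
  have hRN : ∏ i, √(m i) = N * √2 := by
    have := congrArg norm hfin
    simpa only [norm_mul, hnexp, ω, norm_real, Complex.norm_natCast, Real.norm_eq_abs,
      abs_of_pos hR, abs_of_nonneg (Real.sqrt_nonneg _), mul_one, one_mul] using this
  have hexp : cexp (Real.pi * I * ((n / 4 : ℝ) : ℂ)) =
      cexp (Real.pi * I * ((⟪ξ, ξ⟫ / 4 + s / 4 : ℝ) : ℂ)) := by
    apply mul_left_cancel₀ (ofReal_ne_zero.mpr hR.ne')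
    rw [hfin, hRN, ofReal_add, mul_add, Complex.exp_add]
    simp only [ω, ofReal_mul, ofReal_natCast]
    ring
  rw [Complex.exp_eq_exp_iff_exists_int] at hexp
  obtain ⟨k, hk⟩ := hexp
  have hk' : (Real.pi * I) * ((n / 4 - (⟪ξ, ξ⟫ / 4 + s / 4) - 2 * k : ℝ) : ℂ) = 0 := by
    push_cast at hk ⊢
    linear_combination hk
  have h0 := (mul_eq_zero.mp hk').resolve_left (by simp [Real.pi_ne_zero])
  have h0 : (n / 4 - (⟪ξ, ξ⟫ / 4 + s / 4) - 2 * k : ℝ) = 0 := by exact_mod_cast h0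
  refine ⟨-s, by omega, -k, ?_⟩
  push_cast
  linarith

end VanDerBlij

section Double

open scoped Pointwise

lemma inner_pairE {n m : ℕ} (x x' : EuclideanSpace ℝ (Fin n)) (y y' : EuclideanSpace ℝ (Fin m)) :
    ⟪pairE x y, pairE x' y'⟫ = ⟪x, x'⟫ + ⟪y, y'⟫ := by
  simp [pairE, PiLp.inner_apply, Fin.sum_univ_add]

lemma pairE_restFst_restSnd {n m : ℕ} (z : EuclideanSpace ℝ (Fin (n + m))) :
    pairE (restFst z) (restSnd z) = z := by
  ext i
  refine Fin.addCases (fun i => ?_) (fun i => ?_) i <;> simp [pairE, restFst, restSnd]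

variable {n : ℕ} {L : Set (EuclideanSpace ℝ (Fin n))}

lemma pairE_comm_mem_charSet_overLattice {ξ η : EuclideanSpace ℝ (Fin n)}
    (h : pairE ξ η ∈ CharSet (overLattice L L)) : pairE η ξ ∈ CharSet (overLattice L L) := by
  refine ⟨fun z hz => ?_, fun z hz => ?_⟩
  all_goals
    obtain ⟨x, y, rfl, hyx⟩ : ∃ x y, z = pairE x y ∧ pairE y x ∈ overLattice L L := by
      rcases hz with ⟨x, hx, y, hy, rfl⟩ | ⟨x, hx, y, hy, rfl⟩
      · exact ⟨x, y, rfl, Or.inl ⟨y, hy, x, hx, rfl⟩⟩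
      · exact ⟨x, y, rfl, Or.inr ⟨y, hy, x, hx, rfl⟩⟩
  · obtain ⟨k, hk⟩ := h.1 _ hyx
    exact ⟨k, by rw [← hk, inner_pairE, inner_pairE, add_comm]⟩
  · obtain ⟨k, hk⟩ := h.2 _ hyx
    refine ⟨k, ?_⟩
    rw [← hk]
    simp only [inner_pairE]
    ring

lemma left_mem_charSet_of_pairE (hL : IsLattice L) {ξ η : EuclideanSpace ℝ (Fin n)}
    (h : pairE ξ η ∈ CharSet (overLattice L L)) : ξ ∈ CharSet L := by
  have hmem {v} (hv : v ∈ L) : pairE v 0 ∈ overLattice L L := Or.inl ⟨v, hv, 0, hL.1.1, rfl⟩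
  refine ⟨fun v hv => ?_, fun v hv => ?_⟩
  · simpa [inner_pairE] using h.1 _ (hmem hv)
  · obtain ⟨k, hk⟩ := h.2 _ (hmem hv)
    rw [inner_pairE, inner_pairE] at hk
    exact ⟨k, by simpa using hk⟩

lemma IsBimodular.exists_charSign_of_pairE (hL : IsBimodular L) {ξ η : EuclideanSpace ℝ (Fin n)}
    (h : pairE ξ η ∈ CharSet (overLattice L L)) :
    ∃ s : ℤ, (s = 1 ∨ s = -1) ∧ ξ ∈ CharSign L s ∧ η ∈ CharSign L (-s) := by
  have hξ := left_mem_charSet_of_pairE hL.1 h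
  have hη := left_mem_charSet_of_pairE hL.1 (pairE_comm_mem_charSet_overLattice h)
  obtain ⟨s, hs, a, ha⟩ := hL.inner_self_charSet hξ
  obtain ⟨t, ht, b, hb⟩ := hL.inner_self_charSet hη
  obtain rfl | rfl : t = s ∨ t = -s := by omega
  · obtain ⟨u, hu, hξη⟩ := exists_eq_add_two_smul hξ hη
    have huL : u ∈ L := by
      by_contra hu'
      obtain ⟨k, hk⟩ := hL.inner_self_add_two_smul_of_notMem hη hu hu'
      rw [← hξη, ha, hb] at hk
      have hk' : 8 * a = 8 * b + 4 * k + 2 := by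
        have : (8 * a : ℝ) = 8 * b + 4 * k + 2 := by linarith
        exact_mod_cast this
      omega
    obtain ⟨w, hw, -⟩ := hL.2
    obtain ⟨k, hk⟩ := h.2 (pairE w w) (Or.inr ⟨w, hw, w, hw, rfl⟩)
    obtain ⟨c, hc⟩ := hL.charSet_inner_dual hη hw.1
    obtain ⟨d, hd⟩ := hw.1 u huL
    obtain ⟨p, hp⟩ := hL.inner_self_of_notMem hw.1 hw.2
    rw [inner_pairE, inner_pairE, hξη, inner_add_left, real_inner_smul_left,
      real_inner_comm w u, hc, hd, hp] at hk
    have hk' : 2 * c + 2 * d - 2 * p - 1 = 2 * k := by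
      have : (2 * c + 2 * d - 2 * p - 1 : ℝ) = 2 * k := by linarith
      exact_mod_cast this
    omega
  · exact ⟨s, hs, ⟨hξ, a, ha⟩, hη, b, hb⟩

lemma IsBimodular.pairE_mem_charSet (hL : IsBimodular L) {ξ η : EuclideanSpace ℝ (Fin n)}
    (hξ : ξ ∈ CharSign L 1) (hη : η ∈ CharSign L (-1)) :
    pairE ξ η ∈ CharSet (overLattice L L) := by
  obtain ⟨hξ, a, ha⟩ := hξ
  obtain ⟨hη, b, hb⟩ := hη
  obtain ⟨u, hu, hξη⟩ := exists_eq_add_two_smul hξ hη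
  have hu' : u ∉ L := by
    intro huL
    obtain ⟨k, hk⟩ := inner_self_add_two_smul_of_mem hL.1 hη huL
    rw [← hξη, ha, hb] at hk
    have hk' : 1 + 8 * a = -1 + 8 * b + 8 * k := by
      have : (1 + 8 * a : ℝ) = -1 + 8 * b + 8 * k := by push_cast at hk; linarith
      exact_mod_cast this
    omega
  refine ⟨?_, ?_⟩
  · rintro _ (⟨x, hx, y, hy, rfl⟩ | ⟨x, hx, y, hy, rfl⟩)
    · obtain ⟨c, hc⟩ := hξ.1 x hx
      obtain ⟨d, hd⟩ := hη.1 y hy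
      exact ⟨c + d, by rw [inner_pairE, hc, hd]; push_cast; rfl⟩
    · obtain ⟨c, hc⟩ := hL.charSet_inner_dual hξ hx.1
      obtain ⟨d, hd⟩ := hL.charSet_inner_dual hη hy.1
      exact ⟨c + d, by rw [inner_pairE, hc, hd]; push_cast; rfl⟩
  · rintro _ (⟨x, hx, y, hy, rfl⟩ | ⟨x, hx, y, hy, rfl⟩)
    · obtain ⟨c, hc⟩ := hξ.2 x hx
      obtain ⟨d, hd⟩ := hη.2 y hy
      refine ⟨c + d, ?_⟩
      rw [inner_pairE, inner_pairE]
      push_cast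
      linarith
    · have hl := hL.sub_mem_of_notMem hy.1 hy.2 hx.1 hx.2
      have hr := hL.sub_mem_of_notMem hu hu' hx.1 hx.2
      obtain ⟨l, rfl⟩ : ∃ l, y = x + l := ⟨y - x, by abel⟩
      obtain ⟨r, rfl⟩ : ∃ r, u = x + r := ⟨u - x, by abel⟩
      rw [add_sub_cancel_left] at hl hr
      obtain ⟨c, hc⟩ := hL.charSet_inner_dual hη hx.1
      obtain ⟨d, hd⟩ := hη.2 l hl
      obtain ⟨e, he⟩ := hx.1 l hl
      obtain ⟨f, hf⟩ := hx.1 r hr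
      refine ⟨c + d - e + f, ?_⟩
      rw [inner_pairE, inner_pairE, hξη, real_inner_add_add_self]
      simp only [inner_add_left, inner_add_right, real_inner_smul_left]
      rw [real_inner_comm x r] at *
      push_cast
      linarith

lemma IsBimodular.charSign_nonempty (hL : IsBimodular L) :
    (CharSign L 1).Nonempty ∧ (CharSign L (-1)).Nonempty := by
  obtain ⟨η, hη⟩ := hL.1.charSet_nonempty_s10
  obtain ⟨w, ⟨hw, hw'⟩, -⟩ := hL.2
  have hξ := add_two_smul_mem_charSet hη hw
  obtain ⟨k, hk⟩ := hL.inner_self_add_two_smul_of_notMem hη hw hw'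
  obtain ⟨s, hs, a, ha⟩ := hL.inner_self_charSet hξ
  obtain ⟨t, ht, b, hb⟩ := hL.inner_self_charSet hη
  rw [ha, hb] at hk
  have hk' : s + 8 * a = t + 8 * b + 4 * k + 2 := by
    have : (s + 8 * a : ℝ) = t + 8 * b + 4 * k + 2 := by linarith
    exact_mod_cast this
  obtain ⟨rfl, rfl⟩ | ⟨rfl, rfl⟩ : s = 1 ∧ t = -1 ∨ s = -1 ∧ t = 1 := by omega
  · exact ⟨⟨_, hξ, a, ha⟩, ⟨_, hη, b, hb⟩⟩
  · exact ⟨⟨_, hη, b, hb⟩, ⟨_, hξ, a, ha⟩⟩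

lemma bddBelow_image_inner_self (S : Set (EuclideanSpace ℝ (Fin n))) :
    BddBelow ((fun ξ => (⟪ξ, ξ⟫ - (n : ℝ)) / 4) '' S) := by
  refine ⟨-(n : ℝ) / 4, ?_⟩
  rintro _ ⟨ξ, -, rfl⟩
  have : 0 ≤ ⟪ξ, ξ⟫ := real_inner_self_nonneg
  dsimp only
  linarith

end Double

/-- for a bimodular lattice `L ⊂ ℝ^n`, the defect of the double
`D = (L × L) ∪ ((L' \ L) × (L' \ L)) ⊂ ℝ^{2n}` satisfies `d(D) = d_+(L) + d_−(L)`. -/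
theorem stmt10 {n : ℕ} (L : Set (EuclideanSpace ℝ (Fin n))) (hL : IsBimodular L) :
    defect (overLattice L L) = defectSign L 1 + defectSign L (-1) := by
  obtain ⟨hpos, hneg⟩ := hL.charSign_nonempty
  rw [defect, defectSign, defectSign, ← csInf_add (hpos.image _) (bddBelow_image_inner_self _)
    (hneg.image _) (bddBelow_image_inner_self _)]
  congr 1
  ext t
  rw [Set.mem_add]
  constructor
  · rintro ⟨z, hz, rfl⟩
    rw [← pairE_restFst_restSnd z] at hz ⊢
    obtain ⟨s, rfl | rfl, h1, h2⟩ := hL.exists_charSign_of_pairE hz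
    · refine ⟨_, ⟨_, h1, rfl⟩, _, ⟨_, h2, rfl⟩, ?_⟩
      simp only [inner_pairE]
      push_cast
      ring
    · rw [neg_neg] at h2
      refine ⟨_, ⟨_, h2, rfl⟩, _, ⟨_, h1, rfl⟩, ?_⟩
      simp only [inner_pairE]
      push_cast
      ring
  · rintro ⟨_, ⟨ξ, hξ, rfl⟩, _, ⟨η, hη, rfl⟩, rfl⟩
    refine ⟨pairE ξ η, hL.pairE_mem_charSet hξ hη, ?_⟩
    simp only [inner_pairE]
    push_cast
    ring

end
end
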